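/- The Whitten group Γ₅ (a group of order 7680) has exactly 270131 subgroups, and these subgroups fall into exactly 6382 conjugacy classes. -/

import Mathlib

/-- The homomorphism `ω : S_μ → Aut(Z₂^{μ+1})`: a permutation `p` fixes the 0th
coordinate (indexed by `none`) and permutes the remaining `μ` coordinates
(indexed by `some i`). -/
def whittenHom (μ : ℕ) :
    Equiv.Perm (Fin μ) →* MulAut (Option (Fin μ) → Multiplicative (ZMod 2)) where
  toFun p := MulEquiv.arrowCongr (Equiv.optionCongr p) (MulEquiv.refl _)
  map_one' := by
    ext f x
    cases x <;> rfl
  map_mul' := by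
    intro p q
    ext f x
    cases x <;> rfl

/-- The Whitten group `Γ_μ = Z₂^{μ+1} ⋊_ω S_μ`. -/
abbrev WhittenGroup (μ : ℕ) : Type :=
  (Option (Fin μ) → Multiplicative (ZMod 2)) ⋊[whittenHom μ] Equiv.Perm (Fin μ)

/-- Two subgroups are conjugate if one is carried to the other by conjugation. -/
def subgroupConj {G : Type*} [Group G] (H K : Subgroup G) : Prop :=
  ∃ γ : G, Subgroup.map (MulAut.conj γ).toMonoidHom H = K

namespace Whitten

/-! ### Vectors as bit patterns -/

/-- The bit position representing a coordinate of `Z₂⁶`. -/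
def coordIdx : Option (Fin 5) → ℕ
  | none => 0
  | some i => i + 1

/-- The vector of `Z₂⁶` whose coordinates are the six lowest bits of a number. -/
def vec (x : ℕ) : Option (Fin 5) → Multiplicative (ZMod 2) :=
  fun o => Multiplicative.ofAdd (if x.testBit (coordIdx o) then 1 else 0)

theorem vec_xor (x y : ℕ) : vec (x ^^^ y) = vec x * vec y := by
  funext o
  simp only [vec, Nat.testBit_xor, Pi.mul_apply]
  cases x.testBit (coordIdx o) <;> cases y.testBit (coordIdx o) <;> decide

theorem vec_zero : vec 0 = 1 := by
  funext o
  simp [vec]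

theorem vec_eq_iff (x y : ℕ) : vec x = vec y ↔ ∀ i < 6, x.testBit i = y.testBit i := by
  have h (a b : Bool) : Multiplicative.ofAdd (if a then (1 : ZMod 2) else 0) =
      Multiplicative.ofAdd (if b then 1 else 0) ↔ a = b := by
    cases a <;> cases b <;> decide
  simp only [vec, funext_iff, h]
  constructor
  · intro H i hi
    rcases i with _ | i
    · exact H none
    · exact H (some ⟨i, by omega⟩)
  · rintro H (_ | i)
    · exact H 0 (by omega)
    · exact H (i + 1) (by omega)

theorem vec_inj {x y : ℕ} (hx : x < 64) (hy : y < 64) (h : vec x = vec y) : x = y := by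
  apply Nat.eq_of_testBit_eq
  intro i
  by_cases hi : i < 6
  · exact (vec_eq_iff x y).1 h i hi
  · have : 64 ≤ 2 ^ i := (by norm_num : 64 = 2 ^ 6) ▸ Nat.pow_le_pow_right (by norm_num) (by omega)
    rw [Nat.testBit_lt_two_pow (by omega), Nat.testBit_lt_two_pow (by omega)]

theorem card_vectors : Fintype.card (Option (Fin 5) → Multiplicative (ZMod 2)) = 64 := by
  rw [Fintype.card_fun, Fintype.card_option, Fintype.card_fin]
  rfl

theorem exists_vec (v : Option (Fin 5) → Multiplicative (ZMod 2)) : ∃ x < 64, vec x = v := by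
  have hb : Function.Bijective (fun x : Fin 64 => vec x) := by
    rw [Fintype.bijective_iff_injective_and_card, card_vectors]
    exact ⟨fun x y h => Fin.ext (vec_inj x.2 y.2 h), by simp⟩
  obtain ⟨x, hx⟩ := hb.2 v
  exact ⟨x, x.2, hx⟩

/-- The number below `64` representing a vector. -/
noncomputable def vecCode (v : Option (Fin 5) → Multiplicative (ZMod 2)) : ℕ :=
  (exists_vec v).choose

theorem vecCode_lt (v) : vecCode v < 64 := (exists_vec v).choose_spec.1

theorem vec_vecCode (v) : vec (vecCode v) = v := (exists_vec v).choose_spec.2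

theorem vecCode_vec {x : ℕ} (hx : x < 64) : vecCode (vec x) = x :=
  vec_inj (vecCode_lt _) hx (vec_vecCode _)

theorem vecCode_mul (v w) : vecCode (v * w) = vecCode v ^^^ vecCode w := by
  apply vec_inj (vecCode_lt _) (Nat.xor_lt_two_pow (n := 6) (vecCode_lt _) (vecCode_lt _))
  rw [vec_xor, vec_vecCode, vec_vecCode, vec_vecCode]

theorem vec_inv (x : ℕ) : (vec x)⁻¹ = vec x := by
  rw [inv_eq_iff_mul_eq_one, ← vec_xor, Nat.xor_self, vec_zero]

/-! ### Permutations as octal numbers -/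

/-- The `i`-th octal digit. -/
def dig (p i : ℕ) : ℕ := Nat.land (Nat.shiftRight p (Nat.mul 3 i)) 7

/-- The code of a permutation: the octal digit `i + 1` is `p i + 1`. -/
def enc (p : Equiv.Perm (Fin 5)) : ℕ := ∑ i : Fin 5, (p i + 1) * 8 ^ (i + 1 : ℕ)

/-- Composition of permutation codes. -/
def mulc (p q : ℕ) : ℕ :=
  Nat.add (Nat.mul (dig p (dig q 1)) 8) (Nat.add (Nat.mul (dig p (dig q 2)) 64)
    (Nat.add (Nat.mul (dig p (dig q 3)) 512) (Nat.add (Nat.mul (dig p (dig q 4)) 4096)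
      (Nat.mul (dig p (dig q 5)) 32768))))

/-- Inversion of permutation codes. -/
def invc (p : ℕ) : ℕ :=
  Nat.add (Nat.pow 8 (dig p 1)) (Nat.add (Nat.mul 2 (Nat.pow 8 (dig p 2)))
    (Nat.add (Nat.mul 3 (Nat.pow 8 (dig p 3))) (Nat.add (Nat.mul 4 (Nat.pow 8 (dig p 4)))
      (Nat.mul 5 (Nat.pow 8 (dig p 5))))))

/-- The action of a permutation code on the bit pattern of a vector. -/
def act (p x : ℕ) : ℕ :=
  Nat.xor (Nat.land x 1) (Nat.xor (Nat.mul (Nat.land (Nat.shiftRight x 1) 1) (Nat.pow 2 (dig p 1)))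
    (Nat.xor (Nat.mul (Nat.land (Nat.shiftRight x 2) 1) (Nat.pow 2 (dig p 2)))
      (Nat.xor (Nat.mul (Nat.land (Nat.shiftRight x 3) 1) (Nat.pow 2 (dig p 3)))
        (Nat.xor (Nat.mul (Nat.land (Nat.shiftRight x 4) 1) (Nat.pow 2 (dig p 4)))
          (Nat.mul (Nat.land (Nat.shiftRight x 5) 1) (Nat.pow 2 (dig p 5)))))))

theorem dig_eq (p i : ℕ) : dig p i = p / 8 ^ i % 8 := by
  change (p >>> (3 * i)) &&& 7 = _
  rw [Nat.shiftRight_eq_div_pow, pow_mul, show 7 = 2 ^ 3 - 1 by rfl, Nat.and_two_pow_sub_one_eq_mod]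
  norm_num

theorem dig_enc (p : Equiv.Perm (Fin 5)) (i : Fin 5) : dig (enc p) (i + 1) = p i + 1 := by
  have h0 := (p 0).2
  have h1 := (p 1).2
  have h2 := (p 2).2
  have h3 := (p 3).2
  have h4 := (p 4).2
  rw [dig_eq, enc, Fin.sum_univ_five]
  fin_cases i <;> simp <;> omega

theorem dig_enc_zero (p : Equiv.Perm (Fin 5)) :
    dig (enc p) 1 = p 0 + 1 ∧ dig (enc p) 2 = p 1 + 1 ∧ dig (enc p) 3 = p 2 + 1 ∧
      dig (enc p) 4 = p 3 + 1 ∧ dig (enc p) 5 = p 4 + 1 :=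
  ⟨dig_enc p 0, dig_enc p 1, dig_enc p 2, dig_enc p 3, dig_enc p 4⟩

theorem enc_injective : Function.Injective enc := by
  intro p q h
  ext i
  have h1 := dig_enc p i
  rw [h, dig_enc q i] at h1
  omega

theorem enc_mul (p q : Equiv.Perm (Fin 5)) : enc (p * q) = mulc (enc p) (enc q) := by
  obtain ⟨h0, h1, h2, h3, h4⟩ := dig_enc_zero q
  rw [mulc, h0, h1, h2, h3, h4, dig_enc, dig_enc, dig_enc, dig_enc, dig_enc, enc,
    Fin.sum_univ_five]
  simp only [Equiv.Perm.mul_apply, Nat.add_eq, Nat.mul_eq]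
  simp
  ring

theorem enc_inv (p : Equiv.Perm (Fin 5)) : enc p⁻¹ = invc (enc p) := by
  obtain ⟨h0, h1, h2, h3, h4⟩ := dig_enc_zero p
  rw [invc, h0, h1, h2, h3, h4, enc, ← Equiv.sum_comp p, Fin.sum_univ_five]
  simp only [Equiv.Perm.inv_def, Equiv.symm_apply_apply, Nat.add_eq, Nat.mul_eq, Nat.pow_eq]
  simp
  ring

theorem testBit_land_one_mul_two_pow (x i d j : ℕ) :
    (Nat.mul (Nat.land (Nat.shiftRight x i) 1) (Nat.pow 2 d)).testBit j =
      (decide (d = j) && x.testBit i) := by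
  change (((x >>> i) &&& 1) * 2 ^ d).testBit j = _
  have h : (x >>> i) &&& 1 = (x.testBit i).toNat := by
    rw [Nat.and_one_is_mod, Nat.toNat_testBit, Nat.shiftRight_eq_div_pow]
  rw [h]
  cases x.testBit i
  · simp
  · simp [Nat.testBit_two_pow]

theorem testBit_act (p : Equiv.Perm (Fin 5)) (x j : ℕ) :
    (act (enc p) x).testBit j = ((decide (j = 0) && x.testBit 0) ^^
      ((decide (p 0 + 1 = j) && x.testBit 1) ^^ ((decide (p 1 + 1 = j) && x.testBit 2) ^^
        ((decide (p 2 + 1 = j) && x.testBit 3) ^^ ((decide (p 3 + 1 = j) && x.testBit 4) ^^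
          (decide (p 4 + 1 = j) && x.testBit 5)))))) := by
  obtain ⟨h0, h1, h2, h3, h4⟩ := dig_enc_zero p
  have hx (a b : ℕ) : (Nat.xor a b).testBit j = (a.testBit j ^^ b.testBit j) :=
    Nat.testBit_xor ..
  have h5 : (Nat.land x 1).testBit j = (decide (j = 0) && x.testBit 0) := by
    change (x &&& 1).testBit j = _
    rcases j with _ | j
    · simp
    · have h : Nat.testBit 1 (j + 1) = false := by
        rw [Bool.eq_false_iff, ne_eq, Nat.testBit_one_eq_true_iff_self_eq_zero]
        omega
      rw [Nat.testBit_and, h]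
      simp
  rw [act, hx, hx, hx, hx, hx, h0, h1, h2, h3, h4]
  simp only [testBit_land_one_mul_two_pow, h5]

theorem act_lt (p : Equiv.Perm (Fin 5)) (x : ℕ) : act (enc p) x < 64 := by
  refine Nat.lt_pow_two_of_testBit (n := 6) _ fun j hj => ?_
  have h (i : Fin 5) : ¬ ((p i : ℕ) + 1 = j) := by have := (p i).2; omega
  rw [testBit_act]
  simp [h, show j ≠ 0 by omega]

theorem vec_act (p : Equiv.Perm (Fin 5)) (x : ℕ) :
    vec (act (enc p) x) = whittenHom 5 p (vec x) := by
  have hp (i j : Fin 5) : (p i : ℕ) + 1 = p j + 1 ↔ i = j := by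
    rw [Nat.add_right_cancel_iff, Fin.val_inj, p.injective.eq_iff]
  funext o
  rcases o with _ | j
  · change vec _ none = vec x none
    simp only [vec, coordIdx, testBit_act]
    simp
  · change vec _ (some j) = vec x (some (p.symm j))
    obtain ⟨i, rfl⟩ := p.surjective j
    rw [Equiv.symm_apply_apply]
    simp only [vec, coordIdx, testBit_act, hp]
    congr 3
    fin_cases i <;> simp

theorem act_xor (p : Equiv.Perm (Fin 5)) (x y : ℕ) :
    act (enc p) (x ^^^ y) = act (enc p) x ^^^ act (enc p) y := by
  apply vec_inj (act_lt _ _) (Nat.xor_lt_two_pow (n := 6) (act_lt _ _) (act_lt _ _))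
  rw [vec_act, vec_xor, map_mul, vec_xor, vec_act, vec_act]

/-- The list of all permutation codes. -/
def codes : List ℕ :=
  [181896, 153224, 178312, 120968, 146056, 117384, 181448, 152776, 174280, 88264, 142024,
    84680, 177416, 120072, 173832, 87816, 109320, 80648, 144712, 116040, 141128, 83784, 108872,
    80200, 181840, 153168, 178256, 120912, 146000, 117328, 180944, 152272, 170192, 55504,
    137936, 51920, 176912, 119568, 169744, 55056, 105232, 47888, 144208, 115536, 137040, 51024,
    104784, 47440, 181336, 152664, 174168, 88152, 141912, 84568, 180888, 152216, 170136, 55448,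
    137880, 51864, 172824, 86808, 169240, 54552, 72472, 43800, 140120, 82776, 136536, 50520,
    72024, 43352, 177248, 119904, 173664, 87648, 109152, 80480, 176800, 119456, 169632, 54944,
    105120, 47776, 172768, 86752, 169184, 54496, 72416, 43744, 107360, 78688, 103776, 46432,
    71520, 42848, 144488, 115816, 140904, 83560, 108648, 79976, 144040, 115368, 136872, 50856,
    104616, 47272, 140008, 82664, 136424, 50408, 71912, 43240, 107304, 78632, 103720, 46376,
    71464, 42792]

theorem enc_mem_codes (p : Equiv.Perm (Fin 5)) : enc p ∈ codes := by
  revert p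
  decide +kernel

theorem exists_enc {c : ℕ} (hc : c ∈ codes) : ∃ p, enc p = c := by
  have h : Finset.univ.image enc = codes.toFinset := by
    apply Finset.eq_of_subset_of_card_le
    · intro c hc
      obtain ⟨p, -, rfl⟩ := Finset.mem_image.1 hc
      exact List.mem_toFinset.2 (enc_mem_codes p)
    · rw [Finset.card_image_of_injective _ enc_injective, Finset.card_univ, Fintype.card_perm,
        Fintype.card_fin]
      exact (List.toFinset_card_le _).trans (by decide +kernel)
  obtain ⟨p, -, hp⟩ := Finset.mem_image.1 (h ▸ List.mem_toFinset.2 hc)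
  exact ⟨p, hp⟩

open Classical in
/-- The permutation with a given code. -/
noncomputable def dec (c : ℕ) : Equiv.Perm (Fin 5) :=
  if h : ∃ p, enc p = c then h.choose else 1

theorem enc_dec {c : ℕ} (hc : c ∈ codes) : enc (dec c) = c := by
  have h := exists_enc hc
  rw [dec, dif_pos h]
  exact h.choose_spec

theorem dec_enc (p : Equiv.Perm (Fin 5)) : dec (enc p) = p :=
  enc_injective (enc_dec (enc_mem_codes p))

/-! ### Summation over all subgroups of `Z₂⁶` -/

/-- Reduction of a bit pattern modulo a basis in echelon form. A basis consists of pairs `(t, u)`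
with `t` the leading bit of `u`, in decreasing order. -/
noncomputable def red (B : List (ℕ × ℕ)) : ℕ → ℕ :=
  @List.rec (ℕ × ℕ) (fun _ => ℕ → ℕ) (fun x => x) (fun b _ ih x =>
    ih (Nat.xor x (Nat.mul b.2 (Nat.land (Nat.shiftRight x b.1) 1)))) B

theorem red_nil (x : ℕ) : red [] x = x := rfl

theorem red_cons (b : ℕ × ℕ) (B : List (ℕ × ℕ)) (x : ℕ) :
    red (b :: B) x = red B (if x.testBit b.1 then x ^^^ b.2 else x) := by
  change red B (x ^^^ (b.2 * ((x >>> b.1) &&& 1))) = _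
  rw [Nat.and_one_is_mod, Nat.shiftRight_eq_div_pow, ← Nat.toNat_testBit]
  cases x.testBit b.1 <;> simp

theorem red_xor (B : List (ℕ × ℕ)) (x y : ℕ) : red B (x ^^^ y) = red B x ^^^ red B y := by
  induction B generalizing x y with
  | nil => rfl
  | cons b B ih =>
    simp only [red_cons, Nat.testBit_xor]
    rw [← ih]
    congr 1
    cases x.testBit b.1 <;> cases y.testBit b.1 <;> simp [Nat.xor_left_comm, Nat.xor_comm]

theorem red_zero (B : List (ℕ × ℕ)) : red B 0 = 0 := by
  have h := red_xor B 0 0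
  rwa [Nat.xor_self, Nat.xor_self] at h

/-- Echelon bases of subspaces of `Z₂ᶜ`, together with the mask of leading bits. -/
inductive Echelon : ℕ → ℕ → List (ℕ × ℕ) → Prop
  | nil : Echelon 0 0 []
  | skip {c m B} : Echelon c m B → Echelon (c + 1) m B
  | step {c m B x} : Echelon c m B → x < 2 ^ c → x &&& m = 0 →
      Echelon (c + 1) (m + 2 ^ c) ((c, x + 2 ^ c) :: B)

theorem two_pow_add_eq_xor {c x : ℕ} (hx : x < 2 ^ c) : x + 2 ^ c = x ^^^ 2 ^ c := by
  have h := Nat.two_pow_add_eq_or_of_lt hx 1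
  rw [mul_one] at h
  rw [add_comm, h]
  apply Nat.eq_of_testBit_eq
  intro i
  rw [Nat.testBit_or, Nat.testBit_xor, Nat.testBit_two_pow]
  by_cases hi : c = i
  · subst hi
    simp [Nat.testBit_lt_two_pow hx]
  · simp [hi]

theorem testBit_add_two_pow {c x : ℕ} (hx : x < 2 ^ c) (i : ℕ) :
    (x + 2 ^ c).testBit i = (x.testBit i || decide (c = i)) := by
  rw [two_pow_add_eq_xor hx, Nat.testBit_xor, Nat.testBit_two_pow]
  by_cases hi : c = i
  · subst hi
    simp [Nat.testBit_lt_two_pow hx]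
  · simp [hi]

theorem Echelon.mask_lt {c m B} (h : Echelon c m B) : m < 2 ^ c := by
  induction h with
  | nil => simp
  | skip _ ih => rw [pow_succ]; omega
  | step _ _ _ ih => rw [pow_succ]; omega

theorem Echelon.mem_lt {c m B} (h : Echelon c m B) : ∀ b ∈ B, b.1 < c ∧ b.2 < 2 ^ c := by
  induction h with
  | nil => simp
  | skip _ ih =>
    intro b hb
    have := ih b hb
    rw [pow_succ]
    omega
  | step _ hx _ ih =>
    intro b hb
    rw [pow_succ]
    rcases List.mem_cons.1 hb with rfl | hb
    · simp only
      omega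
    · have := ih b hb
      omega

theorem testBit_red_of_le {B : List (ℕ × ℕ)} {c i : ℕ} (h : ∀ b ∈ B, b.2 < 2 ^ c) (hi : c ≤ i)
    (x : ℕ) : (red B x).testBit i = x.testBit i := by
  induction B generalizing x with
  | nil => rfl
  | cons b B ih =>
    rw [red_cons, ih fun b hb => h b (List.mem_cons_of_mem _ hb)]
    split
    · rw [Nat.testBit_xor, Nat.testBit_lt_two_pow
        ((h b List.mem_cons_self).trans_le (Nat.pow_le_pow_right two_pos hi)), Bool.xor_false]
    · rfl

theorem Echelon.red_lt {c m B} (h : Echelon c m B) {x : ℕ} (hx : x < 2 ^ c) : red B x < 2 ^ c := by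
  refine Nat.lt_pow_two_of_testBit _ fun i hi => ?_
  rw [testBit_red_of_le (fun b hb => (h.mem_lt b hb).2) hi]
  exact Nat.testBit_lt_two_pow (hx.trans_le (Nat.pow_le_pow_right two_pos hi))

theorem land_add_two_pow {c m x : ℕ} (hm : m < 2 ^ c) (i : ℕ) :
    (x &&& (m + 2 ^ c)).testBit i = ((x &&& m).testBit i || (x.testBit i && decide (c = i))) := by
  rw [Nat.testBit_and, Nat.testBit_and, testBit_add_two_pow hm, Bool.and_or_distrib_left]

theorem land_add_two_pow_eq_zero {c m x : ℕ} (hm : m < 2 ^ c) :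
    x &&& (m + 2 ^ c) = 0 ↔ x &&& m = 0 ∧ x.testBit c = false := by
  constructor
  · intro h
    have h' (i : ℕ) := land_add_two_pow (x := x) hm i
    rw [h] at h'
    constructor
    · apply Nat.eq_of_testBit_eq
      intro i
      have := h' i
      simp only [Nat.zero_testBit, Bool.false_eq, Bool.or_eq_false_iff] at this
      simp [this.1]
    · have := h' c
      simp only [Nat.zero_testBit, Bool.false_eq, Bool.or_eq_false_iff] at this
      simpa using this.2
  · rintro ⟨h1, h2⟩
    apply Nat.eq_of_testBit_eq
    intro i
    rw [land_add_two_pow hm, h1]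
    by_cases hi : c = i
    · subst hi; simp [h2]
    · simp [hi]

theorem Echelon.red_land {c m B} (h : Echelon c m B) (x : ℕ) : red B x &&& m = 0 := by
  induction h generalizing x with
  | nil => exact Nat.and_zero _
  | skip _ ih => exact ih x
  | step hB hx _ ih =>
    rw [red_cons, land_add_two_pow_eq_zero hB.mask_lt]
    refine ⟨ih _, ?_⟩
    rw [testBit_red_of_le (fun b hb => (hB.mem_lt b hb).2) le_rfl]
    split
    · next hc =>
      rw [Nat.testBit_xor, testBit_add_two_pow hx, Nat.testBit_lt_two_pow hx]
      simpa using hc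
    · next hc => simpa using hc

theorem Echelon.red_of_land {c m B} (h : Echelon c m B) {x : ℕ} (hx : x &&& m = 0) :
    red B x = x := by
  induction h generalizing x with
  | nil => rfl
  | skip _ ih => exact ih hx
  | step hB _ _ ih =>
    rw [land_add_two_pow_eq_zero hB.mask_lt] at hx
    rw [red_cons, hx.2]
    exact ih hx.1

theorem Echelon.red_add_two_pow_ne {c m B} (h : Echelon c m B) {x : ℕ} (hx : x < 2 ^ c) :
    red B (x + 2 ^ c) ≠ 0 := by
  intro h0
  have := testBit_red_of_le (fun b hb => (h.mem_lt b hb).2) le_rfl (x + 2 ^ c)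
  rw [h0, testBit_add_two_pow hx] at this
  simp at this

/-- The basis `B` describes the intersection of `U` with the span of the `c` lowest bits. -/
def Describes (c : ℕ) (B : List (ℕ × ℕ)) (U : Subgroup (Option (Fin 5) → Multiplicative (ZMod 2))) :
    Prop :=
  ∀ x < 2 ^ c, vec x ∈ U ↔ red B x = 0

variable {U : Subgroup (Option (Fin 5) → Multiplicative (ZMod 2))}

theorem describes_zero : Describes 0 [] U := by
  intro x hx
  obtain rfl : x = 0 := by simpa using hx
  simp [vec_zero, red_nil, U.one_mem]

theorem Describes.of_skip {c m B} (h : Echelon c m B) (hU : Describes (c + 1) B U) :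
    Describes c B U ∧ ∀ x < 2 ^ c, vec (x + 2 ^ c) ∉ U := by
  refine ⟨fun x hx => hU x (by rw [pow_succ]; omega), fun x hx => ?_⟩
  rw [hU (x + 2 ^ c) (by rw [pow_succ]; omega)]
  exact h.red_add_two_pow_ne hx

theorem red_step {c m B x} (h : Echelon c m B) (hx : x < 2 ^ c) (hm : x &&& m = 0) {y : ℕ}
    (hy : y < 2 ^ c) : red ((c, x + 2 ^ c) :: B) (y + 2 ^ c) = red B y ^^^ x := by
  rw [red_cons, testBit_add_two_pow hy]
  simp only [decide_true, Bool.or_true, if_true]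
  rw [two_pow_add_eq_xor hx, two_pow_add_eq_xor hy, ← Nat.xor_assoc, Nat.xor_right_comm y,
    Nat.xor_assoc, Nat.xor_self, Nat.xor_zero, red_xor, h.red_of_land hm]

theorem red_step_low {c B x y} (hy : y < 2 ^ c) : red ((c, x + 2 ^ c) :: B) y = red B y := by
  rw [red_cons, Nat.testBit_lt_two_pow hy]
  rfl

theorem Describes.of_step {c m B x} (h : Echelon c m B) (hx : x < 2 ^ c) (hm : x &&& m = 0)
    (hU : Describes (c + 1) ((c, x + 2 ^ c) :: B) U) :
    Describes c B U ∧ ∀ y < 2 ^ c, vec (y + 2 ^ c) ∈ U ↔ red B y = x := by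
  refine ⟨fun y hy => ?_, fun y hy => ?_⟩
  · rw [hU y (by rw [pow_succ]; omega), red_step_low hy]
  · rw [hU (y + 2 ^ c) (by rw [pow_succ]; omega), red_step h hx hm hy, Nat.xor_eq_zero_iff]

theorem Describes.skip {c m B} (h : Echelon c m B) (hU : Describes c B U)
    (h' : ∀ x < 2 ^ c, vec (x + 2 ^ c) ∉ U) : Describes (c + 1) B U := by
  intro x hx
  by_cases hc : x < 2 ^ c
  · exact hU x hc
  · obtain ⟨y, rfl⟩ := Nat.exists_eq_add_of_le (not_lt.1 hc)
    rw [add_comm] at hx ⊢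
    have hy : y < 2 ^ c := by rw [pow_succ] at hx; omega
    exact iff_of_false (h' y hy) (h.red_add_two_pow_ne hy)

theorem Describes.step {c m B z} (h : Echelon c m B) (hU : Describes c B U) (hz : z < 2 ^ c)
    (hzU : vec (z + 2 ^ c) ∈ U) : Describes (c + 1) ((c, red B z + 2 ^ c) :: B) U := by
  intro x hx
  by_cases hc : x < 2 ^ c
  · rw [red_step_low hc]
    exact hU x hc
  · obtain ⟨y, rfl⟩ := Nat.exists_eq_add_of_le (not_lt.1 hc)
    rw [add_comm] at hx ⊢
    have hy : y < 2 ^ c := by rw [pow_succ] at hx; omega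
    rw [red_step h (h.red_lt hz) (h.red_land z) hy, ← red_xor,
      ← hU _ (Nat.xor_lt_two_pow hy hz), ← U.mul_mem_cancel_right hzU, ← vec_xor,
      two_pow_add_eq_xor hy, two_pow_add_eq_xor hz, Nat.xor_assoc, Nat.xor_comm (2 ^ c),
      Nat.xor_assoc, Nat.xor_self, Nat.xor_zero]

/-- Sum over the numbers below `n` that are disjoint from the mask `m`. -/
noncomputable def sumReduced (m : ℕ) (k : ℕ → ℕ) (n : ℕ) : ℕ :=
  @Nat.rec (fun _ => ℕ) 0 (fun x ih =>
    Nat.add (@Bool.rec (fun _ => ℕ) 0 (k x) (Nat.beq (Nat.land x m) 0)) ih) n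

/-- Sum of `leaf` over the echelon bases extending a given one by `n` coordinates. -/
noncomputable def sumBases (leaf : List (ℕ × ℕ) → ℕ) (n : ℕ) : ℕ → ℕ → List (ℕ × ℕ) → ℕ :=
  @Nat.rec (fun _ => ℕ → ℕ → List (ℕ × ℕ) → ℕ) (fun _ _ B => leaf B)
    (fun _ ih c m B => Nat.add (ih (Nat.succ c) m B) (sumReduced m
      (fun x => ih (Nat.succ c) (Nat.add m (Nat.pow 2 c)) ((c, Nat.add x (Nat.pow 2 c)) :: B))
      (Nat.pow 2 c))) n

theorem sumReduced_eq (m : ℕ) (k : ℕ → ℕ) (n : ℕ) :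
    sumReduced m k n = ∑ x ∈ Finset.range n, if x &&& m = 0 then k x else 0 := by
  induction n with
  | zero => rfl
  | succ n ih =>
    rw [Finset.sum_range_succ, ← ih, add_comm (sumReduced m k n)]
    change (@Bool.rec (fun _ => ℕ) 0 (k n) (Nat.beq (n &&& m) 0)) + _ = _
    congr 1
    by_cases h : n &&& m = 0
    · rw [if_pos h, h]; rfl
    · rw [if_neg h, show Nat.beq (n &&& m) 0 = false from by
        rw [Bool.eq_false_iff]; exact fun h' => h (Nat.eq_of_beq_eq_true h')]

open Classical in
theorem describes_split {c m B} (h : Echelon c m B) (a : ℕ) :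
    (if Describes c B U then a else 0) = (if Describes (c + 1) B U then a else 0) +
      ∑ x ∈ Finset.range (2 ^ c), if x &&& m = 0 then
        (if Describes (c + 1) ((c, x + 2 ^ c) :: B) U then a else 0) else 0 := by
  by_cases hU : Describes c B U
  · rw [if_pos hU]
    by_cases h' : ∀ x < 2 ^ c, vec (x + 2 ^ c) ∉ U
    · rw [if_pos (hU.skip h h'), Finset.sum_eq_zero, add_zero]
      intro x hx
      rw [Finset.mem_range] at hx
      split_ifs with h1 h2
      · exact absurd (((h2.of_step h hx h1).2 x hx).2 (h.red_of_land h1)) (h' x hx)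
      · rfl
      · rfl
    · have h0 : ¬ Describes (c + 1) B U := fun H => h' (H.of_skip h).2
      push Not at h'
      obtain ⟨z, hz, hzU⟩ := h'
      rw [if_neg h0, zero_add, Finset.sum_eq_single (red B z)]
      · rw [if_pos (h.red_land z), if_pos (hU.step h hz hzU)]
      · intro x hx hne
        rw [Finset.mem_range] at hx
        split_ifs with h1 h2
        · exact absurd (((h2.of_step h hx h1).2 z hz).1 hzU) hne.symm
        · rfl
        · rfl
      · intro hr
        exact absurd (Finset.mem_range.2 (h.red_lt hz)) hr
  · rw [if_neg hU, if_neg fun H => hU (H.of_skip h).1, zero_add, eq_comm]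
    refine Finset.sum_eq_zero ?_
    intro x hx
    rw [Finset.mem_range] at hx
    split_ifs with h1 h2
    · exact absurd (h2.of_step h hx h1).1 hU
    · rfl
    · rfl

/-- The subgroup with a given basis. -/
noncomputable def spanned (B : List (ℕ × ℕ)) :
    Subgroup (Option (Fin 5) → Multiplicative (ZMod 2)) where
  carrier := {v | red B (vecCode v) = 0}
  one_mem' := by
    rw [Set.mem_ofPred_eq, ← vec_zero, vecCode_vec (by norm_num), red_zero]
  mul_mem' := by
    intro v w hv hw
    rw [Set.mem_ofPred_eq] at hv hw ⊢
    rw [vecCode_mul, red_xor, hv, hw, Nat.xor_self]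
  inv_mem' := by
    intro v hv
    rwa [Set.mem_ofPred_eq, ← vec_vecCode v, vec_inv, vec_vecCode]

theorem describes_spanned (B : List (ℕ × ℕ)) : Describes 6 B (spanned B) := by
  intro x hx
  change red B (vecCode (vec x)) = 0 ↔ _
  rw [vecCode_vec hx]

theorem Describes.unique {B} {U U'} (hU : Describes 6 B U) (hU' : Describes 6 B U') : U = U' := by
  ext v
  rw [← vec_vecCode v, hU _ (vecCode_lt v), hU' _ (vecCode_lt v)]

open Classical in
theorem sumBases_eq_sum_ite (leaf : List (ℕ × ℕ) → ℕ)
    (f : Subgroup (Option (Fin 5) → Multiplicative (ZMod 2)) → ℕ)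
    (hleaf : ∀ m B U, Echelon 6 m B → Describes 6 B U → leaf B = f U) (n c m : ℕ)
    (B : List (ℕ × ℕ)) (hn : c + n = 6) (hB : Echelon c m B) :
    sumBases leaf n c m B = ∑ U, if Describes c B U then f U else 0 := by
  induction n generalizing c m B with
  | zero =>
    obtain rfl : c = 6 := hn
    rw [Finset.sum_eq_single (spanned B), if_pos (describes_spanned B)]
    · exact hleaf m B _ hB (describes_spanned B)
    · intro U _ hne
      rw [if_neg fun h => hne (h.unique (describes_spanned B))]
    · exact fun h => absurd (Finset.mem_univ _) h
  | succ n ih =>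
    simp_rw [describes_split hB, Finset.sum_add_distrib]
    rw [Finset.sum_comm]
    change sumBases leaf n (c + 1) m B + sumReduced m (fun x =>
      sumBases leaf n (c + 1) (m + 2 ^ c) ((c, x + 2 ^ c) :: B)) (2 ^ c) = _
    rw [ih (c + 1) m B (by omega) hB.skip, sumReduced_eq]
    congr 1
    refine Finset.sum_congr rfl fun x hx => ?_
    split_ifs with h1
    · exact ih _ _ _ (by omega) (hB.step (Finset.mem_range.1 hx) h1)
    · simp

theorem sumBases_eq (leaf : List (ℕ × ℕ) → ℕ)
    (f : Subgroup (Option (Fin 5) → Multiplicative (ZMod 2)) → ℕ)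
    (hleaf : ∀ m B U, Echelon 6 m B → Describes 6 B U → leaf B = f U) :
    sumBases leaf 6 0 0 [] = ∑ U, f U := by
  classical
  rw [sumBases_eq_sum_ite leaf f hleaf 6 0 0 [] rfl .nil]
  simp [describes_zero]

theorem Echelon.card_span {c m B} (h : Echelon c m B) :
    ((Finset.range (2 ^ c)).filter fun x => red B x = 0).card = 2 ^ B.length := by
  induction h with
  | nil => rfl
  | @skip c m B hB ih =>
    rw [← ih]
    congr 1
    ext x
    simp only [Finset.mem_filter, Finset.mem_range]
    refine ⟨fun ⟨h1, h2⟩ => ⟨?_, h2⟩, fun ⟨h1, h2⟩ => ⟨by rw [pow_succ]; omega, h2⟩⟩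
    by_contra hc
    obtain ⟨y, rfl⟩ := Nat.exists_eq_add_of_le (not_lt.1 hc)
    rw [pow_succ] at h1
    rw [add_comm] at h2
    exact hB.red_add_two_pow_ne (by omega) h2
  | @step c m B x hB hx hm ih =>
    have hs : (Finset.range (2 ^ (c + 1))).filter (fun y => red ((c, x + 2 ^ c) :: B) y = 0) =
        ((Finset.range (2 ^ c)).filter fun y => red B y = 0) ∪
          ((Finset.range (2 ^ c)).filter fun y => red B y = 0).image
            fun y => (y ^^^ x) + 2 ^ c := by
      ext y
      simp only [Finset.mem_filter, Finset.mem_range, Finset.mem_union, Finset.mem_image]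
      constructor
      · rintro ⟨h1, h2⟩
        by_cases hc : y < 2 ^ c
        · exact .inl ⟨hc, by rwa [red_step_low hc] at h2⟩
        · obtain ⟨z, rfl⟩ := Nat.exists_eq_add_of_le' (not_lt.1 hc)
          have hz : z < 2 ^ c := by rw [pow_succ] at h1; omega
          rw [red_step hB hx hm hz] at h2
          refine .inr ⟨z ^^^ x, ⟨Nat.xor_lt_two_pow hz hx, ?_⟩, ?_⟩
          · rw [red_xor, hB.red_of_land hm, h2]
          · rw [Nat.xor_assoc, Nat.xor_self, Nat.xor_zero]
      · rintro (⟨h1, h2⟩ | ⟨z, ⟨h1, h2⟩, rfl⟩)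
        · exact ⟨by rw [pow_succ]; omega, by rwa [red_step_low h1]⟩
        · have hz := Nat.xor_lt_two_pow h1 hx
          refine ⟨by rw [pow_succ]; omega, ?_⟩
          rw [red_step hB hx hm hz, red_xor, h2, hB.red_of_land hm, Nat.zero_xor, Nat.xor_self]
    rw [hs, Finset.card_union_of_disjoint, Finset.card_image_of_injective, ih, List.length_cons,
      pow_succ, mul_two]
    · intro y z h
      simpa using h
    · rw [Finset.disjoint_left]
      intro y hy hy'
      simp only [Finset.mem_filter, Finset.mem_range, Finset.mem_image] at hy hy'
      obtain ⟨z, -, rfl⟩ := hy'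
      omega

/-! ### Counting solutions of linear systems over `Z₂` -/

/-- The number of sublists of `vs` whose sum is `y`. -/
def cnt : List ℕ → ℕ → ℕ
  | [], y => if y = 0 then 1 else 0
  | v :: vs, y => cnt vs y + cnt vs (y ^^^ v)

/-- Addition of `v` to those entries that meet the mask `m`. -/
noncomputable def elim (m v : ℕ) (vs : List ℕ) : List ℕ :=
  @List.rec ℕ (fun _ => List ℕ) [] (fun w _ ih =>
    List.cons (@Bool.rec (fun _ => ℕ) (Nat.xor w v) w (Nat.beq (Nat.land w m) 0)) ih) vs

/-- The number of sublists with sum `0`, by Gaussian elimination. The first argument bounds the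
length of the list. -/
noncomputable def ker (n : ℕ) : List ℕ → ℕ :=
  @Nat.rec (fun _ => List ℕ → ℕ) (fun _ => 1) (fun _ ih vs =>
    @List.rec ℕ (fun _ => ℕ) 1 (fun v vs _ =>
      @Bool.rec (fun _ => ℕ) (ih (elim (Nat.xor v (Nat.land v (Nat.pred v))) v vs))
        (Nat.mul 2 (ih vs)) (Nat.beq v 0)) vs) n

theorem elim_cons (m v w : ℕ) (vs : List ℕ) :
    elim m v (w :: vs) = (if w &&& m = 0 then w else w ^^^ v) :: elim m v vs := by
  change (@Bool.rec (fun _ => ℕ) (w ^^^ v) w (Nat.beq (w &&& m) 0)) :: elim m v vs = _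
  congr 1
  by_cases h : w &&& m = 0
  · rw [if_pos h, h]; rfl
  · rw [if_neg h, show Nat.beq (w &&& m) 0 = false from by
      rw [Bool.eq_false_iff]; exact fun h' => h (Nat.eq_of_beq_eq_true h')]

theorem length_elim (m v : ℕ) (vs : List ℕ) : (elim m v vs).length = vs.length := by
  induction vs with
  | nil => rfl
  | cons w vs ih => rw [elim_cons, List.length_cons, List.length_cons, ih]

theorem cnt_elim (m v : ℕ) (vs : List ℕ) (y : ℕ) :
    cnt (v :: elim m v vs) y = cnt (v :: vs) y := by
  induction vs generalizing y with
  | nil => rfl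
  | cons w vs ih =>
    have h1 := ih y
    have h2 := ih (y ^^^ w)
    have e1 : y ^^^ w ^^^ v = y ^^^ v ^^^ w := Nat.xor_right_comm ..
    have e2 : y ^^^ v ^^^ (w ^^^ v) = y ^^^ w := by
      rw [Nat.xor_comm w v, ← Nat.xor_assoc, Nat.xor_assoc y v v, Nat.xor_self, Nat.xor_zero]
    have e3 : y ^^^ (w ^^^ v) = y ^^^ v ^^^ w := by rw [← Nat.xor_assoc, e1]
    simp only [cnt, elim_cons] at h1 h2 ⊢
    split_ifs
    · rw [e1] at h2
      omega
    · rw [e2, e3]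
      rw [e1] at h2
      omega

theorem cnt_eq_zero (j : ℕ) (vs : List ℕ) (h : ∀ v ∈ vs, v.testBit j = false) (y : ℕ)
    (hy : y.testBit j = true) : cnt vs y = 0 := by
  induction vs generalizing y with
  | nil =>
    rw [cnt, if_neg]
    rintro rfl
    simp at hy
  | cons v vs ih =>
    rw [cnt, ih (fun v hv => h v (List.mem_cons_of_mem _ hv)) y hy,
      ih (fun v hv => h v (List.mem_cons_of_mem _ hv))]
    rw [Nat.testBit_xor, hy, h v List.mem_cons_self]
    rfl

theorem exists_lowest_bit (v : ℕ) (hv : v ≠ 0) :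
    ∃ j, v ^^^ (v &&& (v - 1)) = 2 ^ j ∧ v.testBit j = true := by
  induction v using Nat.strong_induction_on with
  | _ v ih =>
    obtain ⟨a, rfl | rfl⟩ : ∃ a, v = 2 * a ∨ v = 2 * a + 1 := ⟨v / 2, by omega⟩
    · obtain ⟨j, hj, hb⟩ := ih a (by omega) (by omega)
      refine ⟨j + 1, ?_, by rw [Nat.testBit_succ]; simpa using hb⟩
      rw [pow_succ', ← hj]
      apply Nat.eq_of_testBit_eq
      intro i
      have e : 2 * a - 1 = 2 * (a - 1) + 1 := by omega
      rcases i with _ | i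
      · simp
      · have h1 : (2 * a) / 2 = a := by omega
        have h2 : (2 * a - 1) / 2 = a - 1 := by omega
        have h3 (b : ℕ) : (2 * b) / 2 = b := by omega
        rw [Nat.testBit_xor, Nat.testBit_and, Nat.testBit_succ, Nat.testBit_succ, Nat.testBit_succ,
          h1, h2, h3, Nat.testBit_xor, Nat.testBit_and]
    · refine ⟨0, ?_, by simp⟩
      apply Nat.eq_of_testBit_eq
      intro i
      rw [Nat.testBit_xor, Nat.testBit_and, Nat.add_sub_cancel]
      rcases i with _ | i
      · simp
      · have h1 : (2 * a + 1) / 2 = a := by omega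
        have h2 : (2 * a) / 2 = a := by omega
        rw [Nat.testBit_succ, Nat.testBit_succ, h1, h2, Nat.testBit_two_pow]
        simp

theorem testBit_elim {j v : ℕ} (hv : v.testBit j = true) (vs : List ℕ) :
    ∀ w ∈ elim (2 ^ j) v vs, w.testBit j = false := by
  induction vs with
  | nil => intro w hw; cases hw
  | cons u vs ih =>
    intro w hw
    rw [elim_cons, List.mem_cons] at hw
    rcases hw with rfl | hw
    · rw [Nat.and_two_pow]
      cases h : u.testBit j <;> simp [h, hv]
    · exact ih w hw

theorem ker_eq (n : ℕ) (vs : List ℕ) (hn : vs.length ≤ n) : ker n vs = cnt vs 0 := by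
  induction n generalizing vs with
  | zero =>
    obtain rfl := List.length_eq_zero_iff.1 (Nat.le_zero.1 hn)
    rfl
  | succ n ih =>
    rcases vs with _ | ⟨v, vs⟩
    · rfl
    · rw [List.length_cons] at hn
      change @Bool.rec (fun _ => ℕ) (ker n (elim (v ^^^ (v &&& (v - 1))) v vs))
        (2 * ker n vs) (Nat.beq v 0) = _
      by_cases hv : v = 0
      · subst hv
        change 2 * ker n vs = _
        rw [ih vs (by omega), cnt, Nat.xor_zero, two_mul]
      · rw [show Nat.beq v 0 = false from by
          rw [Bool.eq_false_iff]; exact fun h' => hv (Nat.eq_of_beq_eq_true h')]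
        obtain ⟨j, hj, hb⟩ := exists_lowest_bit v hv
        change ker n (elim (v ^^^ (v &&& (v - 1))) v vs) = _
        rw [ih _ (by rw [length_elim]; omega), hj, ← cnt_elim (2 ^ j), cnt, left_eq_add]
        exact cnt_eq_zero j _ (testBit_elim hb vs) _ (by rwa [Nat.zero_xor])

/-- The values of `f` at the powers of two below `2 ^ n`. -/
noncomputable def columns (f : ℕ → ℕ) (n : ℕ) : List ℕ :=
  @Nat.rec (fun _ => List ℕ) [] (fun i ih => List.cons (f (Nat.pow 2 i)) ih) n

theorem length_columns (f : ℕ → ℕ) (n : ℕ) : (columns f n).length = n := by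
  induction n with
  | zero => rfl
  | succ n ih => exact congrArg Nat.succ ih

theorem map_columns (g f : ℕ → ℕ) (n : ℕ) : (columns f n).map g = columns (fun x => g (f x)) n := by
  induction n with
  | zero => rfl
  | succ n ih => exact congrArg _ ih

theorem card_fiber {f : ℕ → ℕ} (hf : ∀ x y, f (x ^^^ y) = f x ^^^ f y) (n y : ℕ) :
    ((Finset.range (2 ^ n)).filter fun x => f x = y).card = cnt (columns f n) y := by
  have h0 : f 0 = 0 := by
    have h := hf 0 0
    rwa [Nat.xor_self, Nat.xor_self] at h
  induction n generalizing y with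
  | zero =>
    rw [pow_zero, Finset.range_one, Finset.filter_singleton, h0]
    change _ = if y = 0 then 1 else 0
    by_cases hy : y = 0
    · rw [if_pos hy, if_pos hy.symm]; rfl
    · rw [if_neg hy, if_neg (Ne.symm hy)]; rfl
  | succ n ih =>
    change _ = cnt (columns f n) y + cnt (columns f n) (y ^^^ f (2 ^ n))
    rw [← ih, ← ih]
    have hs : (Finset.range (2 ^ (n + 1))).filter (fun x => f x = y) =
        ((Finset.range (2 ^ n)).filter fun x => f x = y) ∪
          ((Finset.range (2 ^ n)).filter fun x => f x = y ^^^ f (2 ^ n)).image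
            fun x => x + 2 ^ n := by
      ext x
      simp only [Finset.mem_filter, Finset.mem_range, Finset.mem_union, Finset.mem_image]
      constructor
      · rintro ⟨h1, h2⟩
        by_cases hc : x < 2 ^ n
        · exact .inl ⟨hc, h2⟩
        · obtain ⟨z, rfl⟩ := Nat.exists_eq_add_of_le' (not_lt.1 hc)
          have hz : z < 2 ^ n := by rw [pow_succ] at h1; omega
          refine .inr ⟨z, ⟨hz, ?_⟩, rfl⟩
          rw [← h2, two_pow_add_eq_xor hz, hf, Nat.xor_assoc, Nat.xor_self, Nat.xor_zero]
      · rintro (⟨h1, h2⟩ | ⟨z, ⟨h1, h2⟩, rfl⟩)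
        · exact ⟨by rw [pow_succ]; omega, h2⟩
        · refine ⟨by rw [pow_succ]; omega, ?_⟩
          rw [two_pow_add_eq_xor h1, hf, h2, Nat.xor_assoc, Nat.xor_self, Nat.xor_zero]
    rw [hs, Finset.card_union_of_disjoint, Finset.card_image_of_injective]
    · exact add_left_injective _
    · rw [Finset.disjoint_left]
      intro x hx hx'
      simp only [Finset.mem_filter, Finset.mem_range, Finset.mem_image] at hx hx'
      obtain ⟨z, -, rfl⟩ := hx'
      omega

/-! ### Packing lists of bit patterns -/

/-- Concatenation of six-bit patterns. -/
noncomputable def pack (ls : List ℕ) : ℕ :=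
  @List.rec ℕ (fun _ => ℕ) 0 (fun l _ ih => Nat.add (Nat.mul 64 ih) l) ls

theorem pack_cons (l : ℕ) (ls : List ℕ) : pack (l :: ls) = 64 * pack ls + l := rfl

theorem testBit_sixtyfour_mul_add {l : ℕ} (hl : l < 64) (p j : ℕ) :
    (64 * p + l).testBit j = if j < 6 then l.testBit j else p.testBit (j - 6) :=
  Nat.testBit_two_pow_mul_add (i := 6) p hl j

theorem xor_sixtyfour_mul_add {l l' : ℕ} (hl : l < 64) (hl' : l' < 64) (p p' : ℕ) :
    (64 * p + l) ^^^ (64 * p' + l') = 64 * (p ^^^ p') + (l ^^^ l') := by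
  apply Nat.eq_of_testBit_eq
  intro j
  rw [Nat.testBit_xor, testBit_sixtyfour_mul_add hl, testBit_sixtyfour_mul_add hl',
    testBit_sixtyfour_mul_add (Nat.xor_lt_two_pow (n := 6) hl hl')]
  split <;> simp

theorem pack_xor {α : Type*} (f g h : α → ℕ) (hf : ∀ a, f a < 64) (hg : ∀ a, g a < 64)
    (hh : ∀ a, h a = f a ^^^ g a) (as : List α) :
    pack (as.map h) = pack (as.map f) ^^^ pack (as.map g) := by
  induction as with
  | nil => exact (Nat.xor_self 0).symm
  | cons a as ih =>
    rw [List.map_cons, List.map_cons, List.map_cons, pack_cons, pack_cons, pack_cons,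
      xor_sixtyfour_mul_add (hf a) (hg a), ih, hh]

theorem pack_eq_zero (ls : List ℕ) : pack ls = 0 ↔ ∀ l ∈ ls, l = 0 := by
  induction ls with
  | nil => simp [show pack [] = 0 from rfl]
  | cons l ls ih => simp [pack_cons, ih, and_comm]

/-- Simultaneous reduction of packed bit patterns; `M` is the mask of lowest bits. -/
noncomputable def redPacked (M : ℕ) (B : List (ℕ × ℕ)) : ℕ → ℕ :=
  @List.rec (ℕ × ℕ) (fun _ => ℕ → ℕ) (fun x => x) (fun b _ ih x =>
    ih (Nat.xor x (Nat.mul b.2 (Nat.land (Nat.shiftRight x b.1) M)))) B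

theorem redPacked_pack (B : List (ℕ × ℕ)) (hB : ∀ b ∈ B, b.1 < 6 ∧ b.2 < 64) (ls : List ℕ)
    (hls : ∀ l ∈ ls, l < 64) :
    redPacked (pack (ls.map fun _ => 1)) B (pack ls) = pack (ls.map (red B)) := by
  induction B generalizing ls with
  | nil =>
    rw [show red [] = id from rfl, List.map_id]
    rfl
  | cons b B ih =>
    obtain ⟨t, u⟩ := b
    obtain ⟨ht, hu⟩ := hB _ List.mem_cons_self
    simp only at ht hu
    have key : pack ls ^^^ u * ((pack ls >>> t) &&& pack (ls.map fun _ => 1)) =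
        pack (ls.map fun l => l ^^^ u * ((l >>> t) &&& 1)) := by
      clear ih
      induction ls with
      | nil =>
        change 0 ^^^ u * ((0 >>> t) &&& 0) = 0
        simp
      | cons l ls ih =>
        rw [List.map_cons, List.map_cons, pack_cons, pack_cons, pack_cons,
          ← ih fun l h => hls l (List.mem_cons_of_mem _ h)]
        have hl := hls l List.mem_cons_self
        have hb : (l >>> t) &&& 1 < 2 := by rw [Nat.and_one_is_mod]; omega
        have h1 : (64 * pack ls + l) >>> t &&& (64 * pack (ls.map fun _ => 1) + 1) =
            64 * ((pack ls >>> t) &&& pack (ls.map fun _ => 1)) + ((l >>> t) &&& 1) := by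
          apply Nat.eq_of_testBit_eq
          intro j
          rw [Nat.testBit_and, Nat.testBit_shiftRight, testBit_sixtyfour_mul_add hl,
            testBit_sixtyfour_mul_add (by norm_num), testBit_sixtyfour_mul_add (by omega)]
          by_cases hj : j < 6
          · rw [if_pos hj, if_pos hj, Nat.testBit_and, Nat.testBit_shiftRight]
            rcases j with _ | j
            · simp [ht]
            · simp [Nat.testBit_succ]
          · rw [if_neg hj, if_neg hj, if_neg (by omega), Nat.testBit_and, Nat.testBit_shiftRight,
              Nat.add_sub_assoc (by omega)]
        have hub : u * ((l >>> t) &&& 1) < 64 := by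
          interval_cases h : (l >>> t) &&& 1 <;> omega
        rw [h1, mul_add, Nat.mul_left_comm u 64, xor_sixtyfour_mul_add hl hub]
    change redPacked _ B (pack ls ^^^ u * ((pack ls >>> t) &&& pack (ls.map fun _ => 1))) = _
    rw [key]
    have hlt : ∀ l ∈ ls.map fun l => l ^^^ u * ((l >>> t) &&& 1), l < 64 := by
      intro l' hl'
      obtain ⟨l, hl, rfl⟩ := List.mem_map.1 hl'
      have hb : (l >>> t) &&& 1 < 2 := by rw [Nat.and_one_is_mod]; omega
      refine Nat.xor_lt_two_pow (n := 6) (hls l hl) ?_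
      interval_cases h : (l >>> t) &&& 1 <;> omega
    have := ih (fun b hb => hB b (List.mem_cons_of_mem _ hb)) _ hlt
    rw [List.map_map, List.map_map] at this
    exact this

/-! ### Subgroups with given image and given intersection with the kernel -/

section Extension

variable {G S : Type*} [Group G] [Group S]

/-- The product of generators along a word. -/
def wordProd (g : ℕ → G) (w : List ℕ) : G := (w.map g).prod

theorem wordProd_cons (g : ℕ → G) (i : ℕ) (w : List ℕ) :
    wordProd g (i :: w) = g i * wordProd g w := by
  simp [wordProd]

theorem wordProd_append (g : ℕ → G) (v w : List ℕ) :
    wordProd g (v ++ w) = wordProd g v * wordProd g w := by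
  simp [wordProd]

theorem wordProd_mem {g : ℕ → G} {w : List ℕ} {H : Subgroup G} (h : ∀ i ∈ w, g i ∈ H) :
    wordProd g w ∈ H :=
  H.list_prod_mem fun _ hx => by
    obtain ⟨i, hi, rfl⟩ := List.mem_map.1 hx
    exact h i hi

theorem map_wordProd (π : G →* S) (g : ℕ → G) (w : List ℕ) :
    π (wordProd g w) = wordProd (fun i => π (g i)) w := by
  simp [wordProd, map_list_prod, Function.comp_def]

/-- `T` is a set of words containing exactly one representative of the identity, and the relations
`E` suffice to reduce any word in the `k` generators `σ` to one in `T`. -/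
structure Rewrites (k : ℕ) (σ : ℕ → S) (T : Set (List ℕ)) (E : Set (List ℕ × List ℕ)) : Prop where
  nil_mem : [] ∈ T
  lt : ∀ w ∈ T, ∀ i ∈ w, i < k
  closed : ∀ w ∈ T, ∀ i < k, ∃ w' ∈ T, i :: w = w' ∨ (i :: w, w') ∈ E
  faithful : ∀ w ∈ T, wordProd σ w = 1 → w = []
  lt_left : ∀ r ∈ E, ∀ i ∈ r.1, i < k
  lt_right : ∀ r ∈ E, ∀ i ∈ r.2, i < k
  eq : ∀ r ∈ E, wordProd σ r.1 = wordProd σ r.2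

/-- The subgroup generated by `U` and `k` elements `g`. -/
def extend (U : Subgroup G) (g : ℕ → G) (k : ℕ) : Subgroup G :=
  Subgroup.closure (U ∪ g '' Set.Iio k)

theorem le_extend (U : Subgroup G) (g : ℕ → G) (k : ℕ) : U ≤ extend U g k :=
  Set.subset_union_left.trans Subgroup.subset_closure

theorem mem_extend (U : Subgroup G) (g : ℕ → G) {k i : ℕ} (hi : i < k) : g i ∈ extend U g k :=
  Subgroup.subset_closure (.inr ⟨i, hi, rfl⟩)

theorem extend_le {U H : Subgroup G} {g : ℕ → G} {k : ℕ} (hU : U ≤ H) (hg : ∀ i < k, g i ∈ H) :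
    extend U g k ≤ H := by
  rw [extend, Subgroup.closure_le]
  rintro x (hx | ⟨i, hi, rfl⟩)
  · exact hU hx
  · exact hg i hi

variable {π : G →* S} {U : Subgroup G} {g : ℕ → G} {k : ℕ}

theorem map_extend (hU : U ≤ π.ker) :
    (extend U g k).map π = Subgroup.closure ((fun i => π (g i)) '' Set.Iio k) := by
  rw [extend, MonoidHom.map_closure, Set.image_union, Subgroup.closure_union, Set.image_image,
    sup_eq_right, Subgroup.closure_le]
  rintro _ ⟨u, hu, rfl⟩
  rw [hU hu]
  exact Subgroup.one_mem _

theorem extend_inf_ker [Finite G] {σ : ℕ → S} {T E} (hR : Rewrites k σ T E)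
    (hσ : ∀ i < k, π (g i) = σ i) (hU : U ≤ π.ker)
    (hn : ∀ i < k, ∀ u ∈ U, g i * u * (g i)⁻¹ ∈ U)
    (hE : ∀ r ∈ E, wordProd g r.1 * (wordProd g r.2)⁻¹ ∈ U) : extend U g k ⊓ π.ker = U := by
  refine le_antisymm ?_ (le_inf (le_extend U g k) hU)
  have key (x : G) (hx : x ∈ extend U g k) : ∃ w ∈ T, x * (wordProd g w)⁻¹ ∈ U := by
    rw [extend, ← Subgroup.mem_toSubmonoid, Subgroup.closure_toSubmonoid_of_finite] at hx
    induction hx using Submonoid.closure_induction_left with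
    | one => exact ⟨[], hR.nil_mem, by simp [wordProd, U.one_mem]⟩
    | mul_left x hx y _ ih =>
      obtain ⟨w, hw, hy⟩ := ih
      rcases hx with hx | ⟨i, hi, rfl⟩
      · exact ⟨w, hw, by rw [mul_assoc]; exact U.mul_mem hx hy⟩
      · obtain ⟨w', hw', hc⟩ := hR.closed w hw i hi
        have h1 : wordProd g (i :: w) * (wordProd g w')⁻¹ ∈ U := by
          rcases hc with rfl | hc
          · rw [mul_inv_cancel]
            exact U.one_mem
          · exact hE _ hc
        refine ⟨w', hw', ?_⟩
        have := U.mul_mem (hn i hi _ hy) h1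
        rw [wordProd_cons] at this
        convert this using 1
        group
  rintro x ⟨hx, hx1⟩
  obtain ⟨w, hw, hxw⟩ := key x hx
  have h1 := hU hxw
  rw [MonoidHom.mem_ker, map_mul, map_inv, show π x = 1 from hx1, one_mul, inv_eq_one,
    map_wordProd] at h1
  have h2 : wordProd σ w = 1 := by
    rw [← h1, wordProd, wordProd]
    congr 1
    exact List.map_congr_left fun i hi => (hσ i (hR.lt w hw i hi)).symm
  rw [hR.faithful w hw h2] at hxw
  simpa [wordProd] using hxw

theorem eq_extend {H : Subgroup G} (hU : H ⊓ π.ker = U)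
    (hπ : H.map π = Subgroup.closure ((fun i => π (g i)) '' Set.Iio k))
    (hg : ∀ i < k, g i ∈ H) : H = extend U g k := by
  have hUH : U ≤ H := hU ▸ inf_le_left
  refine le_antisymm (fun x hx => ?_) (extend_le hUH hg)
  have h1 : π x ∈ (extend U g k).map π := by
    rw [map_extend (hU ▸ inf_le_right), ← hπ]
    exact Subgroup.mem_map_of_mem π hx
  obtain ⟨y, hy, hxy⟩ := h1
  have h2 : x * y⁻¹ ∈ U := by
    rw [← hU]
    refine ⟨H.mul_mem hx (H.inv_mem (extend_le hUH hg hy)), ?_⟩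
    change π _ = 1
    rw [map_mul, map_inv, hxy, mul_inv_cancel]
  have := (extend U g k).mul_mem (le_extend U g k h2) hy
  rwa [inv_mul_cancel_right] at this

theorem relation_mem {H : Subgroup G} (hU : H ⊓ π.ker = U) (hg : ∀ i < k, g i ∈ H) {v w : List ℕ}
    (hv : ∀ i ∈ v, i < k) (hw : ∀ i ∈ w, i < k) (h : π (wordProd g v) = π (wordProd g w)) :
    wordProd g v * (wordProd g w)⁻¹ ∈ U := by
  rw [← hU]
  refine ⟨H.mul_mem (wordProd_mem fun i hi => hg i (hv i hi))
    (H.inv_mem (wordProd_mem fun i hi => hg i (hw i hi))), ?_⟩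
  change π _ = 1
  rw [map_mul, map_inv, h, mul_inv_cancel]

end Extension

/-! ### Counting normalized subgroups by linear systems -/

/-- The normal subgroup `Z₂⁶` of the Whitten group. -/
abbrev Vec : Type := Option (Fin 5) → Multiplicative (ZMod 2)

instance : Finite (WhittenGroup 5) := .of_equiv _ SemidirectProduct.equivProd.symm

noncomputable instance : Fintype (Subgroup (WhittenGroup 5)) := Fintype.ofFinite _

/-- The `i`-th group of six bits of a number. -/
def slot (x i : ℕ) : ℕ := Nat.land (Nat.shiftRight x (Nat.mul 6 i)) 63

theorem slot_eq (x i : ℕ) : slot x i = x / 64 ^ i % 64 := by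
  change (x >>> (6 * i)) &&& 63 = _
  rw [Nat.shiftRight_eq_div_pow, pow_mul, show 63 = 2 ^ 6 - 1 by rfl,
    Nat.and_two_pow_sub_one_eq_mod]
  norm_num

theorem slot_lt (x i : ℕ) : slot x i < 64 := by
  rw [slot_eq]
  exact Nat.mod_lt _ (by norm_num)

theorem slot_xor (x y i : ℕ) : slot (x ^^^ y) i = slot x i ^^^ slot y i := by
  change ((x ^^^ y) >>> (6 * i)) &&& 63 = ((x >>> (6 * i)) &&& 63) ^^^ ((y >>> (6 * i)) &&& 63)
  rw [Nat.shiftRight_xor_distrib, Nat.and_xor_distrib_right]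

theorem card_slots (n : ℕ) (A : ℕ → Finset ℕ) (hA : ∀ i, ∀ a ∈ A i, a < 64) :
    ((Finset.range (64 ^ n)).filter fun x => ∀ i < n, slot x i ∈ A i).card =
      ∏ i ∈ Finset.range n, (A i).card := by
  induction n generalizing A with
  | zero => simp
  | succ n ih =>
    rw [Finset.prod_range_succ', ← ih (fun i => A (i + 1)) fun i => hA (i + 1), ←
      Finset.card_product]
    have h0 (y a : ℕ) (ha : a < 64) : slot (64 * y + a) 0 = a := by
      rw [slot_eq]; omega
    have h1 (y a i : ℕ) (ha : a < 64) : slot (64 * y + a) (i + 1) = slot y i := by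
      rw [slot_eq, slot_eq, pow_succ', ← Nat.div_div_eq_div_mul,
        show (64 * y + a) / 64 = y by omega]
    have hs : (Finset.range (64 ^ (n + 1))).filter (fun x => ∀ i < n + 1, slot x i ∈ A i) =
        (((Finset.range (64 ^ n)).filter fun x => ∀ i < n, slot x i ∈ A (i + 1)) ×ˢ A 0).image
          fun p => 64 * p.1 + p.2 := by
      ext x
      simp only [Finset.mem_filter, Finset.mem_range, Finset.mem_image, Finset.mem_product,
        Prod.exists]
      constructor
      · rintro ⟨hx, h⟩
        have hx' : 64 * (x / 64) + x % 64 = x := Nat.div_add_mod x 64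
        have hm : x % 64 < 64 := Nat.mod_lt _ (by norm_num)
        refine ⟨x / 64, x % 64, ⟨⟨?_, fun i hi => ?_⟩, ?_⟩, hx'⟩
        · rw [pow_succ] at hx; omega
        · rw [← h1 _ _ i hm, hx']; exact h (i + 1) (by omega)
        · rw [← h0 (x / 64) _ hm, hx']; exact h 0 (by omega)
      · rintro ⟨y, a, ⟨⟨hy, h⟩, ha⟩, rfl⟩
        have := hA 0 a ha
        refine ⟨by rw [pow_succ]; omega, fun i hi => ?_⟩
        rcases i with _ | i
        · rwa [h0 _ _ this]
        · rw [h1 _ _ _ this]; exact h i (by omega)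
    rw [hs, Finset.card_image_of_injOn]
    rintro ⟨y, a⟩ h ⟨y', a'⟩ h' he
    have h1 := hA 0 a (Finset.mem_product.1 h).2
    have h2 := hA 0 a' (Finset.mem_product.1 h').2
    simp only at he
    ext <;> simp only <;> omega

/-- The lifts of permutations to the Whitten group encoded by a number. -/
def lift (σ : ℕ → Equiv.Perm (Fin 5)) (x i : ℕ) : WhittenGroup 5 := ⟨vec (slot x i), σ i⟩

/-- The subgroup `H` lies over `P` and, if `b` holds, is normalized by `(v, s)`. -/
def Good (b : Bool) (P : Subgroup (Equiv.Perm (Fin 5))) (s : Equiv.Perm (Fin 5))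
    (p : Vec × Subgroup (WhittenGroup 5)) : Prop :=
  p.2.map SemidirectProduct.rightHom = P ∧
    (b = true → p.2.map (MulAut.conj (⟨p.1, s⟩ : WhittenGroup 5)).toMonoidHom = p.2)

theorem map_inl_le_ker (U : Subgroup Vec) :
    U.map (SemidirectProduct.inl : Vec →* WhittenGroup 5) ≤ SemidirectProduct.rightHom.ker := by
  rw [← SemidirectProduct.range_inl_eq_ker_rightHom]
  exact Subgroup.map_le_range _ _

theorem inf_ker_eq (H : Subgroup (WhittenGroup 5)) :
    H ⊓ SemidirectProduct.rightHom.ker = (H.comap SemidirectProduct.inl).map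
      (SemidirectProduct.inl : Vec →* WhittenGroup 5) := by
  rw [Subgroup.map_comap_eq, SemidirectProduct.range_inl_eq_ker_rightHom, inf_comm]

theorem conj_inl (g : WhittenGroup 5) (u : Vec) :
    g * SemidirectProduct.inl u * g⁻¹ = SemidirectProduct.inl (whittenHom 5 g.right u) := by
  ext1
  · simp [mul_comm, mul_left_comm]
  · simp

theorem mul_inv_mem_map_inl {g h : WhittenGroup 5} (hr : g.right = h.right) (U : Subgroup Vec) :
    g * h⁻¹ ∈ U.map SemidirectProduct.inl ↔ g.left * h.left⁻¹ ∈ U := by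
  have h1 : g * h⁻¹ = SemidirectProduct.inl (g.left * h.left⁻¹) := by
    ext1
    · simp [hr]
    · simp [hr]
  rw [h1]
  exact Subgroup.mem_map_iff_mem SemidirectProduct.inl_injective

variable {U : Subgroup Vec} {H : Subgroup (WhittenGroup 5)}

theorem invariant_of_mem (hU : H.comap SemidirectProduct.inl = U) {g : WhittenGroup 5}
    (hg : H.map (MulAut.conj g).toMonoidHom = H) (u : Vec) (hu : u ∈ U) :
    whittenHom 5 g.right u ∈ U := by
  rw [← hU, Subgroup.mem_comap] at hu ⊢
  rw [← conj_inl, ← hg]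
  exact Subgroup.mem_map_of_mem (MulAut.conj g).toMonoidHom hu

theorem map_conj_eq_of_le {G : Type*} [Group G] [Finite G] {H : Subgroup G} {g : G}
    (h : H.map (MulAut.conj g).toMonoidHom ≤ H) : H.map (MulAut.conj g).toMonoidHom = H :=
  Subgroup.eq_of_le_of_card_ge h
    (Subgroup.card_map_of_injective (MulAut.conj g).injective).ge

theorem map_conj_eq_of_mem {G : Type*} [Group G] [Finite G] {H : Subgroup G} {g : G} (h : g ∈ H) :
    H.map (MulAut.conj g).toMonoidHom = H := by
  apply map_conj_eq_of_le
  rintro _ ⟨x, hx, rfl⟩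
  exact H.mul_mem (H.mul_mem h hx) (H.inv_mem h)

/-- The linear conditions on lifts of the generators `σ` for them to generate a group meeting
`Z₂⁶` in `U` and, if `b` holds, normalized by the last lift. -/
def Solves (b : Bool) (k : ℕ) (σ : ℕ → Equiv.Perm (Fin 5)) (E : Set (List ℕ × List ℕ))
    (nw : ℕ → List ℕ) (U : Subgroup Vec) (x : ℕ) : Prop :=
  (∀ r ∈ E, wordProd (lift σ x) r.1 * (wordProd (lift σ x) r.2)⁻¹ ∈
    U.map SemidirectProduct.inl) ∧
  (b = true → ∀ i < k, wordProd (lift σ x) [k, i] * (wordProd (lift σ x) (nw i ++ [k]))⁻¹ ∈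
    U.map SemidirectProduct.inl)

variable {b : Bool} {k : ℕ} {σ : ℕ → Equiv.Perm (Fin 5)} {T : Set (List ℕ)}
  {E : Set (List ℕ × List ℕ)} {nw : ℕ → List ℕ}

theorem rightHom_wordProd_lift (x : ℕ) (w : List ℕ) :
    SemidirectProduct.rightHom (wordProd (lift σ x) w) = wordProd σ w :=
  map_wordProd _ _ _

theorem Solves.good (hR : Rewrites k σ T E)
    (hn : ∀ i < k, ∀ u ∈ U, whittenHom 5 (σ i) u ∈ U)
    (hs : b = true → ∀ u ∈ U, whittenHom 5 (σ k) u ∈ U)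
    (hw : b = true → ∀ i < k, ∀ j ∈ nw i, j < k) {x : ℕ} (hx : Solves b k σ E nw U x) :
    Good b (Subgroup.closure (σ '' Set.Iio k)) (σ k)
      (vec (slot x k), extend (U.map SemidirectProduct.inl) (lift σ x) k) ∧
    (extend (U.map SemidirectProduct.inl) (lift σ x) k).comap SemidirectProduct.inl = U := by
  have hU := map_inl_le_ker U
  refine ⟨⟨map_extend hU, fun hb => map_conj_eq_of_le ?_⟩, ?_⟩
  · rw [extend, MonoidHom.map_closure, Subgroup.closure_le]
    rintro _ ⟨y, hy | ⟨i, hi, rfl⟩, rfl⟩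
    · obtain ⟨u, hu, rfl⟩ := hy
      refine le_extend _ _ _ ?_
      change lift σ x k * _ * (lift σ x k)⁻¹ ∈ _
      rw [conj_inl]
      exact Subgroup.mem_map_of_mem _ (hs hb u hu)
    · have h1 := le_extend _ (lift σ x) k (hx.2 hb i hi)
      have h2 : wordProd (lift σ x) (nw i) ∈ extend (U.map SemidirectProduct.inl) (lift σ x) k :=
        wordProd_mem fun j hj => mem_extend _ _ (hw hb i hi j hj)
      have h3 := Subgroup.mul_mem _ h1 h2
      have h4 : lift σ x k * lift σ x i * (lift σ x k)⁻¹ ∈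
          extend (U.map SemidirectProduct.inl) (lift σ x) k := by
        convert h3 using 1
        rw [wordProd_append, wordProd_cons]
        simp only [wordProd, List.map_cons, List.map_nil, List.prod_cons, List.prod_nil]
        group
      exact h4
  · have h := extend_inf_ker (π := SemidirectProduct.rightHom) hR (g := lift σ x)
      (fun _ _ => rfl) hU (fun i hi u hu => ?_) hx.1
    · rw [inf_ker_eq] at h
      exact Subgroup.map_injective SemidirectProduct.inl_injective h
    · obtain ⟨u, hu, rfl⟩ := hu
      rw [conj_inl]
      exact Subgroup.mem_map_of_mem _ (hn i hi u hu)

theorem Good.solves (hR : Rewrites k σ T E)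
    (hw : b = true → ∀ i < k, ∀ j ∈ nw i, j < k)
    (hnw : b = true → ∀ i < k, wordProd σ [k, i] = wordProd σ (nw i ++ [k])) {x : ℕ}
    {P : Subgroup (Equiv.Perm (Fin 5))}
    (hg : Good b P (σ k) (vec (slot x k), H)) (hU : H.comap SemidirectProduct.inl = U)
    (hx : ∀ i < k, lift σ x i ∈ H) : Solves b k σ E nw U x := by
  have hU' := inf_ker_eq H
  rw [hU] at hU'
  refine ⟨fun r hr => relation_mem hU' hx (hR.lt_left r hr) (hR.lt_right r hr) ?_,
    fun hb i hi => ?_⟩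
  · rw [rightHom_wordProd_lift, rightHom_wordProd_lift, hR.eq r hr]
  · rw [← hU']
    constructor
    · have h1 : lift σ x k * lift σ x i * (lift σ x k)⁻¹ ∈ H := by
        have := Subgroup.mem_map_of_mem (MulAut.conj (lift σ x k)).toMonoidHom (hx i hi)
        rwa [show H.map (MulAut.conj (lift σ x k)).toMonoidHom = H from hg.2 hb] at this
      have h2 : wordProd (lift σ x) (nw i) ∈ H := wordProd_mem fun j hj => hx j (hw hb i hi j hj)
      have h3 := H.mul_mem h1 (H.inv_mem h2)
      change wordProd (lift σ x) [k, i] * (wordProd (lift σ x) (nw i ++ [k]))⁻¹ ∈ H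
      convert h3 using 1
      rw [wordProd_append, wordProd_cons]
      simp only [wordProd, List.map_cons, List.map_nil, List.prod_cons, List.prod_nil]
      group
    · change SemidirectProduct.rightHom _ = 1
      rw [map_mul, map_inv, rightHom_wordProd_lift, rightHom_wordProd_lift, hnw hb i hi,
        mul_inv_cancel]

open Classical in
theorem card_lifts {p : Equiv.Perm (Fin 5)} (hU : H.comap SemidirectProduct.inl = U)
    (hp : p ∈ H.map SemidirectProduct.rightHom) :
    ((Finset.range 64).filter fun y => (⟨vec y, p⟩ : WhittenGroup 5) ∈ H).card =
      ((Finset.range 64).filter fun y => vec y ∈ U).card := by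
  obtain ⟨g, hg, rfl⟩ := hp
  have hc := vecCode_lt g.left
  have key (y : ℕ) : (⟨vec y, g.right⟩ : WhittenGroup 5) ∈ H ↔ vec (y ^^^ vecCode g.left) ∈ U := by
    rw [← H.mul_mem_cancel_right (H.inv_mem hg), vec_xor, vec_vecCode, ← hU, Subgroup.mem_comap]
    congr! 1
    ext1
    · have h : g.left⁻¹ = g.left := by rw [← vec_vecCode g.left, vec_inv]
      simp [h]
    · simp
  have hs : (Finset.range 64).filter (fun y => (⟨vec y, g.right⟩ : WhittenGroup 5) ∈ H) =
      ((Finset.range 64).filter fun y => vec y ∈ U).image fun y => y ^^^ vecCode g.left := by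
    ext y
    simp only [Finset.mem_filter, Finset.mem_range, Finset.mem_image, key]
    constructor
    · rintro ⟨h1, h2⟩
      exact ⟨_, ⟨Nat.xor_lt_two_pow (n := 6) h1 hc, h2⟩,
        by rw [Nat.xor_assoc, Nat.xor_self, Nat.xor_zero]⟩
    · rintro ⟨z, ⟨h1, h2⟩, rfl⟩
      refine ⟨Nat.xor_lt_two_pow (n := 6) h1 hc, ?_⟩
      rwa [Nat.xor_assoc, Nat.xor_self, Nat.xor_zero]
  change ((Finset.range 64).filter fun y => (⟨vec y, g.right⟩ : WhittenGroup 5) ∈ H).card = _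
  rw [hs, Finset.card_image_of_injective]
  intro y z h
  simpa using h

open Classical in
theorem card_solves (hR : Rewrites k σ T E)
    (hn : ∀ i < k, ∀ u ∈ U, whittenHom 5 (σ i) u ∈ U)
    (hs : b = true → ∀ u ∈ U, whittenHom 5 (σ k) u ∈ U)
    (hw : b = true → ∀ i < k, ∀ j ∈ nw i, j < k)
    (hnw : b = true → ∀ i < k, wordProd σ [k, i] = wordProd σ (nw i ++ [k])) :
    ((Finset.range (64 ^ (k + 1))).filter fun x => Solves b k σ E nw U x).card =
      (Finset.univ.filter fun p => Good b (Subgroup.closure (σ '' Set.Iio k)) (σ k) p ∧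
        p.2.comap SemidirectProduct.inl = U).card *
        ((Finset.range 64).filter fun y => vec y ∈ U).card ^ k := by
  have hd := Finset.sum_card_bipartiteAbove_eq_sum_card_bipartiteBelow
    (s := (Finset.range (64 ^ (k + 1))).filter fun x => Solves b k σ E nw U x)
    (t := Finset.univ.filter fun p : Vec × Subgroup (WhittenGroup 5) =>
      Good b (Subgroup.closure (σ '' Set.Iio k)) (σ k) p ∧ p.2.comap SemidirectProduct.inl = U)
    fun x p => vec (slot x k) = p.1 ∧ ∀ i < k, lift σ x i ∈ p.2
  rw [Finset.sum_const_nat (m := 1), mul_one, Finset.sum_const_nat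
    (m := ((Finset.range 64).filter fun y => vec y ∈ U).card ^ k)] at hd
  · exact hd
  · rintro ⟨v, H⟩ hp
    obtain ⟨hg, hU⟩ := (Finset.mem_filter.1 hp).2
    have h := card_slots (k + 1) (fun i => if i < k then
      (Finset.range 64).filter fun y => (⟨vec y, σ i⟩ : WhittenGroup 5) ∈ H else {vecCode v})
      fun i a ha => by
        split_ifs at ha
        · exact Finset.mem_range.1 (Finset.mem_filter.1 ha).1
        · rw [Finset.mem_singleton.1 ha]
          exact vecCode_lt v
    rw [Finset.prod_range_succ, if_neg (lt_irrefl k), Finset.card_singleton, mul_one,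
      Finset.prod_congr rfl (g := fun _ => ((Finset.range 64).filter fun y => vec y ∈ U).card),
      Finset.prod_const, Finset.card_range] at h
    · rw [← h, Finset.bipartiteBelow, Finset.filter_filter]
      congr 1
      refine Finset.filter_congr fun x _ => ?_
      constructor
      · rintro ⟨-, h1, h2⟩ i hi
        split_ifs with hik
        · exact Finset.mem_filter.2 ⟨Finset.mem_range.2 (slot_lt x i), h2 i hik⟩
        · obtain rfl : i = k := by omega
          rw [Finset.mem_singleton]
          simp only at h1
          rw [← h1, vecCode_vec (slot_lt x i)]
      · intro h
        have h1 : vec (slot x k) = v := by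
          have := h k (by omega)
          rw [if_neg (lt_irrefl k), Finset.mem_singleton] at this
          rw [this, vec_vecCode]
        have h2 : ∀ i < k, lift σ x i ∈ H := fun i hi => by
          have := h i (by omega)
          rw [if_pos hi] at this
          exact (Finset.mem_filter.1 this).2
        exact ⟨Good.solves hR hw hnw (h1 ▸ hg) hU h2, h1, h2⟩
    · intro i hi
      rw [if_pos (Finset.mem_range.1 hi)]
      refine card_lifts hU ?_
      rw [hg.1]
      exact Subgroup.subset_closure ⟨i, Finset.mem_range.1 hi, rfl⟩
  · intro x hx
    have hx' := (Finset.mem_filter.1 hx).2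
    have hgood := hx'.good hR hn hs hw
    rw [Finset.card_eq_one]
    refine ⟨(vec (slot x k), extend (U.map SemidirectProduct.inl) (lift σ x) k), ?_⟩
    ext ⟨v, H⟩
    simp only [Finset.bipartiteAbove, Finset.mem_filter, Finset.mem_univ, true_and,
      Finset.mem_singleton, Prod.mk.injEq]
    constructor
    · rintro ⟨⟨h1, h2⟩, h3, h4⟩
      refine ⟨h3.symm, eq_extend (π := SemidirectProduct.rightHom) ?_ h1.1 h4⟩
      rw [inf_ker_eq, h2]
    · rintro ⟨rfl, rfl⟩
      exact ⟨hgood, rfl, fun i hi => mem_extend _ _ hi⟩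

/-! ### Certified computation of the numbers of normalized subgroups over a given group -/

/-- The `i`-th element of a list of permutation codes, by default the identity. -/
noncomputable def nth (gs : List ℕ) : ℕ → ℕ :=
  @List.rec ℕ (fun _ => ℕ → ℕ) (fun _ => 181896)
    (fun g _ ih i => @Nat.rec (fun _ => ℕ) g (fun j _ => ih j) i) gs

/-- Auxiliary function for `word`, with a bound on the length. -/
noncomputable def wordAux (n : ℕ) : ℕ → List ℕ :=
  @Nat.rec (fun _ => ℕ → List ℕ) (fun _ => []) (fun _ ih m =>
    @Bool.rec (fun _ => List ℕ) (List.cons (Nat.land m 3) (ih (Nat.shiftRight m 2))) []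
      (Nat.ble m 1)) n

/-- The word encoded by a number, whose base `4` digits are a leading `1` followed by the reversed
word. -/
noncomputable def word (n : ℕ) : List ℕ := wordAux n n

/-- The left component of the product of lifts along a word. -/
noncomputable def evalVec (gs : List ℕ) (x : ℕ) (w : List ℕ) : ℕ :=
  @List.rec ℕ (fun _ => ℕ) 0 (fun i _ ih => Nat.xor (slot x i) (act (nth gs i) ih)) w

/-- The code of the product of permutations along a word. -/
noncomputable def evalPerm (gs : List ℕ) (w : List ℕ) : ℕ :=
  @List.rec ℕ (fun _ => ℕ) 181896 (fun i _ ih => mulc (nth gs i) ih) w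

/-- The permutations with given codes. -/
noncomputable def perms (gs : List ℕ) (i : ℕ) : Equiv.Perm (Fin 5) := dec (nth gs i)

/-- Generators of a group of permutations, and a list of words representing its elements, each
with the list of the words representing its products with the generators. -/
structure GroupData where
  gs : List ℕ
  nodes : List (ℕ × List ℕ)

/-- The relations for the products of a word with the generators. -/
noncomputable def edgesOf (ts : List ℕ) : ℕ → List (List ℕ × List ℕ) :=
  @List.rec ℕ (fun _ => ℕ → List (List ℕ × List ℕ)) (fun _ => []) (fun t _ ih m =>
    @Bool.rec (fun _ => List (List ℕ × List ℕ)) (List.cons (word m, word t) (ih (Nat.succ m)))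
      (ih (Nat.succ m)) (Nat.beq m t)) ts

/-- The defining relations given by the multiplication table. -/
noncomputable def edges (d : GroupData) : List (List ℕ × List ℕ) :=
  d.nodes.flatMap fun n => edgesOf n.2 (4 * n.1)

/-- A permutation normalizing a group, with words for the conjugates of the generators, and the
matrix of the linear system describing the normalized subgroups over the group. -/
structure EntryData where
  b : Bool
  s : ℕ
  norms : List ℕ
  ones : ℕ
  cols : List ℕ

/-- The relations expressing that the generators are mapped to given words. -/
noncomputable def normRels (k : ℕ) (ns : List ℕ) : ℕ → List (List ℕ × List ℕ) :=
  @List.rec ℕ (fun _ => ℕ → List (List ℕ × List ℕ)) (fun _ => []) (fun n _ ih i =>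
    List.cons ([k, i], word n ++ [k]) (ih (Nat.succ i))) ns

/-- All relations to be satisfied by the lifts of the generators. -/
noncomputable def relations (d : GroupData) (e : EntryData) : List (List ℕ × List ℕ) :=
  edges d ++ @Bool.rec (fun _ => List (List ℕ × List ℕ)) [] (normRels d.gs.length e.norms 0) e.b

/-- The linear system. -/
noncomputable def system (d : GroupData) (e : EntryData) (x : ℕ) : ℕ :=
  pack ((relations d e).map fun r =>
    Nat.xor (evalVec (d.gs ++ [e.s]) x r.1) (evalVec (d.gs ++ [e.s]) x r.2))

/-- Membership in a list of numbers. -/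
def elemOf (l : List ℕ) (a : ℕ) : Bool := l.any (Nat.beq a)

/-- Validity of group data. -/
noncomputable def GroupData.check (d : GroupData) : Bool :=
  Nat.ble d.gs.length 4 && d.gs.all (elemOf codes) && elemOf (d.nodes.map Prod.fst) 1 &&
  d.nodes.all (fun n => Nat.ble 1 n.1 && Nat.beq n.2.length d.gs.length &&
    n.2.all (elemOf (d.nodes.map Prod.fst)) &&
    (word n.1).all (fun i => Nat.blt i d.gs.length) &&
    (Nat.beq n.1 1 || !Nat.beq (evalPerm d.gs (word n.1)) 181896)) &&
  (edges d).all fun r => Nat.beq (evalPerm d.gs r.1) (evalPerm d.gs r.2)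

/-- Equality of lists of numbers. -/
def eqLists : List ℕ → List ℕ → Bool
  | [], [] => true
  | a :: l, b :: m => Nat.beq a b && eqLists l m
  | _, _ => false

/-- Validity of an entry. -/
noncomputable def EntryData.check (d : GroupData) (e : EntryData) : Bool :=
  elemOf codes e.s && Nat.beq e.norms.length d.gs.length &&
  e.norms.all (fun n => (word n).all fun i => Nat.blt i d.gs.length) &&
  (normRels d.gs.length e.norms 0).all (fun r =>
    Nat.beq (evalPerm (d.gs ++ [e.s]) r.1) (evalPerm (d.gs ++ [e.s]) r.2)) &&
  Nat.beq e.ones (pack ((relations d e).map fun _ => 1)) &&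
  eqLists e.cols (columns (system d e) (6 * (d.gs.length + 1)))

/-- Whether the subgroup with a given basis is invariant under a permutation. -/
noncomputable def invariant (c : ℕ) (B : List (ℕ × ℕ)) : Bool :=
  @List.rec (ℕ × ℕ) (fun _ => Bool) true (fun b _ ih =>
    @Bool.rec (fun _ => Bool) false ih (Nat.beq (red B (act c b.2)) 0)) B

/-- Simultaneous reduction of the columns. -/
noncomputable def reduceCols (M : ℕ) (B : List (ℕ × ℕ)) (cs : List ℕ) : List ℕ :=
  @List.rec ℕ (fun _ => List ℕ) [] (fun c _ ih => List.cons (redPacked M B c) ih) cs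

/-- Whether the subgroup with a given basis is invariant under the permutation of an entry. -/
noncomputable def EntryData.accepts (e : EntryData) (B : List (ℕ × ℕ)) : Bool :=
  @Bool.rec (fun _ => Bool) true (invariant e.s B) e.b

/-- The number of normalized subgroups meeting `Z₂⁶` in the subgroup with a given basis. -/
noncomputable def leafEntry (d : GroupData) (e : EntryData) (B : List (ℕ × ℕ)) : ℕ :=
  @Bool.rec (fun _ => ℕ) 0
    (Nat.div (ker (Nat.mul 6 (Nat.succ d.gs.length)) (reduceCols e.ones B e.cols))
      (Nat.pow 2 (Nat.mul B.length d.gs.length)))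
    (e.accepts B)

/-- An entry for a representative of a conjugacy class of the normalizer, with conjugating elements
that yield all members of the class. -/
structure ClassData where
  size : ℕ
  conjs : List ℕ
  entry : EntryData

/-- Weighted sum of the numbers for several entries. -/
noncomputable def leafEntries (d : GroupData) (cs : List ClassData) (B : List (ℕ × ℕ)) : ℕ :=
  @List.rec ClassData (fun _ => ℕ) 0 (fun c _ ih =>
    Nat.add (Nat.mul c.size (leafEntry d c.entry B)) ih) cs

/-- The summand for the subgroup with a given basis, which is zero unless the subgroup is invariant
under the given permutations. -/
noncomputable def leafGroup (d : GroupData) (cs : List ClassData) (B : List (ℕ × ℕ)) : ℕ :=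
  @List.rec ℕ (fun _ => ℕ) (leafEntries d cs B) (fun g _ ih =>
    @Bool.rec (fun _ => ℕ) 0 ih (invariant g B)) d.gs

theorem beq_eq_true {a b : ℕ} : Nat.beq a b = true ↔ a = b :=
  ⟨Nat.eq_of_beq_eq_true, fun h => h ▸ Nat.beq_refl a⟩

theorem nth_mem {gs : List ℕ} (h : ∀ g ∈ gs, g ∈ codes) (i : ℕ) : nth gs i ∈ codes := by
  induction gs generalizing i with
  | nil => exact List.mem_cons_self
  | cons g gs ih =>
    rcases i with _ | i
    · exact h _ List.mem_cons_self
    · exact ih (fun g hg => h g (List.mem_cons_of_mem _ hg)) i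

theorem nth_append_left (gs l : List ℕ) {i : ℕ} (hi : i < gs.length) :
    nth (gs ++ l) i = nth gs i := by
  induction gs generalizing i with
  | nil => cases hi
  | cons g gs ih =>
    rcases i with _ | i
    · rfl
    · exact ih (Nat.lt_of_succ_lt_succ hi)

theorem nth_append_length (gs : List ℕ) (s : ℕ) : nth (gs ++ [s]) gs.length = s := by
  induction gs with
  | nil => rfl
  | cons g gs ih => exact ih

theorem nth_eq_getElem (gs : List ℕ) {i : ℕ} (hi : i < gs.length) : nth gs i = gs[i] := by
  induction gs generalizing i with
  | nil => cases hi
  | cons g gs ih =>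
    rcases i with _ | i
    · rfl
    · exact ih (Nat.lt_of_succ_lt_succ hi)

theorem wordAux_succ (n m : ℕ) :
    wordAux (n + 1) m = if m ≤ 1 then [] else (m % 4) :: wordAux n (m / 4) := by
  change @Bool.rec (fun _ => List ℕ) ((m &&& 3) :: wordAux n (m >>> 2)) [] (Nat.ble m 1) = _
  rw [show m &&& 3 = m % 4 from Nat.and_two_pow_sub_one_eq_mod m 2,
    show m >>> 2 = m / 4 from Nat.shiftRight_eq_div_pow m 2]
  by_cases h : m ≤ 1
  · rw [if_pos h, Nat.ble_eq_true_of_le h]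
  · rw [if_neg h, Bool.eq_false_iff.2 fun h' => h (Nat.le_of_ble_eq_true h')]

theorem wordAux_eq {n n' m : ℕ} (h : m ≤ n) (h' : m ≤ n') : wordAux n m = wordAux n' m := by
  induction m using Nat.strong_induction_on generalizing n n' with
  | _ m ih =>
    have h0 (n : ℕ) (hm : m ≤ 1) : wordAux n m = [] := by
      rcases n with _ | n
      · rfl
      · rw [wordAux_succ, if_pos hm]
    by_cases hm : m ≤ 1
    · rw [h0 n hm, h0 n' hm]
    · obtain ⟨n, rfl⟩ := Nat.exists_eq_add_of_le' (show 1 ≤ n by omega)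
      obtain ⟨n', rfl⟩ := Nat.exists_eq_add_of_le' (show 1 ≤ n' by omega)
      rw [wordAux_succ, wordAux_succ, if_neg hm, if_neg hm,
        ih (m / 4) (by omega) (n' := n') (by omega) (by omega)]

theorem word_one : word 1 = [] := rfl

theorem word_four_mul_add {n i : ℕ} (hn : 1 ≤ n) (hi : i < 4) : word (4 * n + i) = i :: word n := by
  obtain ⟨m, hm⟩ := Nat.exists_eq_add_of_le' (show 1 ≤ 4 * n + i by omega)
  rw [word, hm, wordAux_succ, ← hm, if_neg (by omega), word,
    show (4 * n + i) % 4 = i by omega, show (4 * n + i) / 4 = n by omega,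
    wordAux_eq (n' := n) (by omega) le_rfl]

theorem evalVec_cons (gs : List ℕ) (x i : ℕ) (w : List ℕ) :
    evalVec gs x (i :: w) = slot x i ^^^ act (nth gs i) (evalVec gs x w) := rfl

theorem evalPerm_cons (gs : List ℕ) (i : ℕ) (w : List ℕ) :
    evalPerm gs (i :: w) = mulc (nth gs i) (evalPerm gs w) := rfl

theorem enc_perms {gs : List ℕ} (h : ∀ g ∈ gs, g ∈ codes) (i : ℕ) : enc (perms gs i) = nth gs i :=
  enc_dec (nth_mem h i)

theorem evalVec_lt {gs : List ℕ} (h : ∀ g ∈ gs, g ∈ codes) (x : ℕ) (w : List ℕ) :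
    evalVec gs x w < 64 := by
  rcases w with _ | ⟨i, w⟩
  · exact Nat.zero_lt_succ 63
  · rw [evalVec_cons, ← enc_perms h]
    exact Nat.xor_lt_two_pow (n := 6) (slot_lt x i) (act_lt _ _)

theorem evalVec_xor {gs : List ℕ} (h : ∀ g ∈ gs, g ∈ codes) (x y : ℕ) (w : List ℕ) :
    evalVec gs (x ^^^ y) w = evalVec gs x w ^^^ evalVec gs y w := by
  induction w with
  | nil => exact (Nat.xor_self 0).symm
  | cons i w ih =>
    simp only [evalVec_cons]
    rw [ih, ← enc_perms h, act_xor, slot_xor]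
    simp only [Nat.xor_assoc, Nat.xor_left_comm]

theorem left_wordProd_lift {gs : List ℕ} (h : ∀ g ∈ gs, g ∈ codes) (x : ℕ) (w : List ℕ) :
    (wordProd (lift (perms gs) x) w).left = vec (evalVec gs x w) := by
  induction w with
  | nil => exact vec_zero.symm
  | cons i w ih =>
    rw [wordProd_cons, SemidirectProduct.mul_left, ih, evalVec_cons, vec_xor,
      ← enc_perms h, vec_act]
    rfl

theorem enc_one : enc 1 = 181896 := by decide

theorem enc_wordProd {gs : List ℕ} (h : ∀ g ∈ gs, g ∈ codes) (w : List ℕ) :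
    enc (wordProd (perms gs) w) = evalPerm gs w := by
  induction w with
  | nil => exact enc_one
  | cons i w ih => rw [wordProd_cons, enc_mul, ih, enc_perms h, evalPerm_cons]

theorem wordProd_congr {G : Type*} [Group G] {g g' : ℕ → G} {w : List ℕ}
    (h : ∀ i ∈ w, g i = g' i) : wordProd g w = wordProd g' w := by
  rw [wordProd, wordProd, List.map_congr_left h]

theorem edgesOf_cons (t : ℕ) (ts : List ℕ) (m : ℕ) : edgesOf (t :: ts) m =
    if m = t then edgesOf ts (m + 1) else (word m, word t) :: edgesOf ts (m + 1) := by
  change @Bool.rec (fun _ => List (List ℕ × List ℕ)) ((word m, word t) :: edgesOf ts (m + 1))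
    (edgesOf ts (m + 1)) (Nat.beq m t) = _
  by_cases h : m = t
  · rw [if_pos h, beq_eq_true.2 h]
  · rw [if_neg h, Bool.eq_false_iff.2 fun h' => h (Nat.eq_of_beq_eq_true h')]

theorem mem_edgesOf (ts : List ℕ) (m i : ℕ) (hi : i < ts.length) :
    m + i = ts[i] ∨ (word (m + i), word ts[i]) ∈ edgesOf ts m := by
  induction ts generalizing m i with
  | nil => cases hi
  | cons t ts ih =>
    rw [edgesOf_cons]
    rcases i with _ | i
    · by_cases h : m = t
      · exact .inl h
      · rw [if_neg h]
        exact .inr List.mem_cons_self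
    · have := ih (m + 1) i (Nat.lt_of_succ_lt_succ hi)
      rw [Nat.succ_add_eq_add_succ] at this
      refine this.imp_right fun h => ?_
      split_ifs
      · exact h
      · exact List.mem_cons_of_mem _ h

theorem exists_of_mem_edgesOf (ts : List ℕ) (m : ℕ) {r : List ℕ × List ℕ} (hr : r ∈ edgesOf ts m) :
    ∃ i, ∃ hi : i < ts.length, r = (word (m + i), word ts[i]) := by
  induction ts generalizing m with
  | nil => cases hr
  | cons t ts ih =>
    rw [edgesOf_cons] at hr
    have h' : r = (word m, word t) ∨ r ∈ edgesOf ts (m + 1) := by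
      split_ifs at hr
      · exact .inr hr
      · exact List.mem_cons.1 hr
    rcases h' with rfl | hr
    · exact ⟨0, Nat.succ_pos _, rfl⟩
    · obtain ⟨i, hi, h⟩ := ih _ hr
      rw [Nat.succ_add_eq_add_succ] at h
      exact ⟨i + 1, Nat.succ_lt_succ hi, h⟩

theorem elemOf_eq_true {l : List ℕ} {a : ℕ} : elemOf l a = true ↔ a ∈ l := by
  rw [elemOf, List.any_eq_true]
  constructor
  · rintro ⟨x, hx, h⟩
    rwa [Nat.eq_of_beq_eq_true h]
  · exact fun h => ⟨a, h, Nat.beq_refl a⟩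

/-- The propositional content of `GroupData.check`. -/
structure GroupData.Valid (d : GroupData) : Prop where
  length_le : d.gs.length ≤ 4
  gs_mem : ∀ g ∈ d.gs, g ∈ codes
  one_mem : 1 ∈ d.nodes.map Prod.fst
  pos : ∀ n ∈ d.nodes, 1 ≤ n.1
  length_eq : ∀ n ∈ d.nodes, n.2.length = d.gs.length
  target : ∀ n ∈ d.nodes, ∀ t ∈ n.2, t ∈ d.nodes.map Prod.fst
  word_lt : ∀ n ∈ d.nodes, ∀ i ∈ word n.1, i < d.gs.length
  ne : ∀ n ∈ d.nodes, n.1 = 1 ∨ evalPerm d.gs (word n.1) ≠ 181896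
  eq : ∀ r ∈ edges d, evalPerm d.gs r.1 = evalPerm d.gs r.2

theorem GroupData.valid {d : GroupData} (h : d.check = true) : d.Valid := by
  simp only [check, Bool.and_eq_true, List.all_eq_true, elemOf_eq_true, Nat.ble_eq, Bool.or_eq_true,
    Bool.not_eq_true', ← Bool.not_eq_true, beq_eq_true, Nat.blt_eq] at h
  obtain ⟨⟨⟨⟨h1, h2⟩, h3⟩, h4⟩, h5⟩ := h
  exact ⟨h1, h2, h3, fun n hn => (h4 n hn).1.1.1.1, fun n hn => (h4 n hn).1.1.1.2,
    fun n hn => (h4 n hn).1.1.2, fun n hn => (h4 n hn).1.2, fun n hn => (h4 n hn).2, h5⟩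

variable {d : GroupData} {e : EntryData}

theorem GroupData.Valid.word_lt_of_mem (hd : d.Valid) {t : ℕ} (ht : t ∈ d.nodes.map Prod.fst) :
    ∀ i ∈ word t, i < d.gs.length := by
  obtain ⟨n, hn, rfl⟩ := List.mem_map.1 ht
  exact hd.word_lt n hn

theorem GroupData.Valid.edges_lt (hd : d.Valid) {r : List ℕ × List ℕ} (hr : r ∈ edges d) :
    (∀ i ∈ r.1, i < d.gs.length) ∧ ∀ i ∈ r.2, i < d.gs.length := by
  obtain ⟨n, hn, hr⟩ := List.mem_flatMap.1 hr
  obtain ⟨i, hi, rfl⟩ := exists_of_mem_edgesOf _ _ hr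
  have hi' : i < d.gs.length := hd.length_eq n hn ▸ hi
  refine ⟨?_, hd.word_lt_of_mem (hd.target n hn _ (List.getElem_mem hi))⟩
  rw [word_four_mul_add (hd.pos n hn) (hi'.trans_le hd.length_le)]
  intro j hj
  rcases List.mem_cons.1 hj with rfl | hj
  · exact hi'
  · exact hd.word_lt n hn j hj

theorem perms_append (gs l : List ℕ) {i : ℕ} (hi : i < gs.length) :
    perms (gs ++ l) i = perms gs i := by
  rw [perms, perms, nth_append_left gs l hi]

theorem wordProd_perms_append (gs l : List ℕ) {w : List ℕ} (hw : ∀ i ∈ w, i < gs.length) :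
    wordProd (perms (gs ++ l)) w = wordProd (perms gs) w :=
  wordProd_congr fun i hi => perms_append gs l (hw i hi)

theorem GroupData.Valid.rewrites (hd : d.Valid) (l : List ℕ) :
    Rewrites d.gs.length (perms (d.gs ++ l)) {w | ∃ n ∈ d.nodes, word n.1 = w}
      {r | r ∈ edges d} where
  nil_mem := by
    obtain ⟨n, hn, h⟩ := List.mem_map.1 hd.one_mem
    exact ⟨n, hn, by rw [h, word_one]⟩
  lt := by
    rintro _ ⟨n, hn, rfl⟩
    exact hd.word_lt n hn
  closed := by
    rintro _ ⟨n, hn, rfl⟩ i hi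
    have hi' : i < n.2.length := (hd.length_eq n hn).symm ▸ hi
    obtain ⟨m, hm, hmt⟩ := List.mem_map.1 (hd.target n hn _ (List.getElem_mem hi'))
    refine ⟨_, ⟨m, hm, rfl⟩, ?_⟩
    rw [← word_four_mul_add (hd.pos n hn) (hi.trans_le hd.length_le), hmt]
    exact (mem_edgesOf n.2 (4 * n.1) i hi').imp (congrArg word) fun h =>
      List.mem_flatMap.2 ⟨n, hn, h⟩
  faithful := by
    rintro _ ⟨n, hn, rfl⟩ h
    rw [wordProd_perms_append d.gs l (hd.word_lt n hn)] at h
    rcases hd.ne n hn with h1 | h1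
    · rw [h1, word_one]
    · rw [← enc_wordProd hd.gs_mem, h, enc_one] at h1
      exact absurd rfl h1
  lt_left := fun r hr => (hd.edges_lt hr).1
  lt_right := fun r hr => (hd.edges_lt hr).2
  eq := by
    intro r hr
    rw [wordProd_perms_append d.gs l (hd.edges_lt hr).1,
      wordProd_perms_append d.gs l (hd.edges_lt hr).2]
    apply enc_injective
    rw [enc_wordProd hd.gs_mem, enc_wordProd hd.gs_mem, hd.eq r hr]

theorem eqLists_eq_true {l m : List ℕ} (h : eqLists l m = true) : l = m := by
  induction l generalizing m with
  | nil =>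
    rcases m with _ | ⟨b, m⟩
    · rfl
    · cases h
  | cons a l ih =>
    rcases m with _ | ⟨b, m⟩
    · cases h
    · rw [eqLists, Bool.and_eq_true] at h
      rw [Nat.eq_of_beq_eq_true h.1, ih h.2]

theorem mem_normRels (k : ℕ) (ns : List ℕ) (i : ℕ) (r : List ℕ × List ℕ) :
    r ∈ normRels k ns i ↔ ∃ j < ns.length, r = ([k, i + j], word (nth ns j) ++ [k]) := by
  induction ns generalizing i with
  | nil => exact iff_of_false (by rintro ⟨⟩) (by rintro ⟨j, hj, -⟩; cases hj)
  | cons n ns ih =>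
    change r ∈ ([k, i], word n ++ [k]) :: normRels k ns (i + 1) ↔ _
    rw [List.mem_cons, ih]
    constructor
    · rintro (rfl | ⟨j, hj, rfl⟩)
      · exact ⟨0, Nat.succ_pos _, rfl⟩
      · exact ⟨j + 1, Nat.succ_lt_succ hj, by rw [Nat.succ_add_eq_add_succ]; rfl⟩
    · rintro ⟨j, hj, rfl⟩
      rcases j with _ | j
      · exact .inl rfl
      · exact .inr ⟨j, Nat.lt_of_succ_lt_succ hj, by rw [Nat.succ_add_eq_add_succ]; rfl⟩

/-- The propositional content of `EntryData.check`. -/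
structure EntryData.Valid (d : GroupData) (e : EntryData) : Prop where
  s_mem : e.s ∈ codes
  length_eq : e.norms.length = d.gs.length
  word_lt : ∀ i < d.gs.length, ∀ j ∈ word (nth e.norms i), j < d.gs.length
  eq : ∀ r ∈ normRels d.gs.length e.norms 0,
    evalPerm (d.gs ++ [e.s]) r.1 = evalPerm (d.gs ++ [e.s]) r.2
  ones_eq : e.ones = pack ((relations d e).map fun _ => 1)
  cols_eq : e.cols = columns (system d e) (6 * (d.gs.length + 1))

theorem EntryData.valid (h : e.check d = true) : e.Valid d := by
  simp only [check, Bool.and_eq_true, List.all_eq_true, elemOf_eq_true, beq_eq_true,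
    Nat.blt_eq] at h
  obtain ⟨⟨⟨⟨⟨h1, h2⟩, h3⟩, h4⟩, h5⟩, h6⟩ := h
  refine ⟨h1, h2, fun i hi => ?_, h4, h5, eqLists_eq_true h6⟩
  rw [nth_eq_getElem _ (h2.symm ▸ hi)]
  exact h3 _ (List.getElem_mem _)

theorem mem_relations {r : List ℕ × List ℕ} : r ∈ relations d e ↔
    r ∈ edges d ∨ e.b = true ∧ r ∈ normRels d.gs.length e.norms 0 := by
  rw [relations, List.mem_append]
  cases e.b <;> simp

theorem reduceCols_eq (M : ℕ) (B : List (ℕ × ℕ)) (cs : List ℕ) :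
    reduceCols M B cs = cs.map (redPacked M B) := by
  induction cs with
  | nil => rfl
  | cons c cs ih => exact congrArg _ ih

section Leaf

variable {m : ℕ} {B : List (ℕ × ℕ)} {U : Subgroup Vec}

theorem Echelon.red_eq_zero {c : ℕ} (h : Echelon c m B) : ∀ b ∈ B, red B b.2 = 0 := by
  induction h with
  | nil => simp
  | skip _ ih => exact ih
  | step hB hx hm ih =>
    intro b hb
    rcases List.mem_cons.1 hb with rfl | hb
    · rw [red_step hB hx hm hx, hB.red_of_land hm, Nat.xor_self]
    · rw [red_step_low (hB.mem_lt b hb).2, ih b hb]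

theorem apply_red {f : ℕ → ℕ} (hf : ∀ x y, f (x ^^^ y) = f x ^^^ f y) {B : List (ℕ × ℕ)}
    (hB : ∀ b ∈ B, f b.2 = 0) (x : ℕ) : f (red B x) = f x := by
  induction B generalizing x with
  | nil => rfl
  | cons b B ih =>
    rw [red_cons, ih fun b hb => hB b (List.mem_cons_of_mem _ hb)]
    split_ifs
    · rw [hf, hB b List.mem_cons_self, Nat.xor_zero]
    · rfl

theorem invariant_eq_true {c : ℕ} :
    invariant c B = true ↔ ∀ b ∈ B, red B (act c b.2) = 0 := by
  have h (B' : List (ℕ × ℕ)) : @List.rec (ℕ × ℕ) (fun _ => Bool) true (fun b _ ih =>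
      @Bool.rec (fun _ => Bool) false ih (Nat.beq (red B (act c b.2)) 0)) B' = true ↔
      ∀ b ∈ B', red B (act c b.2) = 0 := by
    induction B' with
    | nil => simp
    | cons b B' ih =>
      rw [List.forall_mem_cons, ← ih, ← beq_eq_true]
      change @Bool.rec (fun _ => Bool) false _ (Nat.beq (red B (act c b.2)) 0) = true ↔ _
      cases Nat.beq (red B (act c b.2)) 0
      · exact iff_of_false Bool.false_ne_true fun h => Bool.false_ne_true h.1
      · exact ⟨fun h => ⟨rfl, h⟩, fun h => h.2⟩
  exact h B

theorem invariant_iff (hB : Echelon 6 m B) (hU : Describes 6 B U) (p : Equiv.Perm (Fin 5)) :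
    invariant (enc p) B = true ↔ ∀ u ∈ U, whittenHom 5 p u ∈ U := by
  rw [invariant_eq_true]
  constructor
  · intro h u hu
    obtain ⟨x, hx, rfl⟩ := exists_vec u
    rw [← vec_act, hU _ (act_lt _ _)]
    rw [hU _ hx] at hu
    have hf (x y : ℕ) : red B (act (enc p) (x ^^^ y)) =
        red B (act (enc p) x) ^^^ red B (act (enc p) y) := by rw [act_xor, red_xor]
    have h0 := hf 0 0
    rw [Nat.xor_self, Nat.xor_self] at h0
    rw [← apply_red (f := fun x => red B (act (enc p) x)) hf h, hu, h0]
  · intro h b hb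
    rw [← hU _ (act_lt _ _), vec_act]
    exact h _ ((hU _ (hB.mem_lt b hb).2).2 (hB.red_eq_zero b hb))

/-- The group generated by the permutations in the data. -/
noncomputable def GroupData.group (d : GroupData) : Subgroup (Equiv.Perm (Fin 5)) :=
  Subgroup.closure (perms d.gs '' Set.Iio d.gs.length)

theorem closure_perms_append (d : GroupData) (l : List ℕ) :
    Subgroup.closure (perms (d.gs ++ l) '' Set.Iio d.gs.length) = d.group := by
  rw [GroupData.group]
  congr 1
  exact Set.image_congr fun i hi => perms_append d.gs l hi

theorem perms_append_length (gs : List ℕ) (s : ℕ) : perms (gs ++ [s]) gs.length = dec s := by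
  rw [perms, nth_append_length]

theorem accepts_iff (he : e.Valid d) (hB : Echelon 6 m B) (hU : Describes 6 B U) :
    e.accepts B = true ↔ (e.b = true → ∀ u ∈ U, whittenHom 5 (dec e.s) u ∈ U) := by
  rw [← invariant_iff hB hU, enc_dec he.s_mem, EntryData.accepts]
  cases e.b
  · exact iff_of_true rfl fun h => absurd h Bool.false_ne_true
  · exact ⟨fun h _ => h, fun h => h rfl⟩

open Classical in
theorem leafEntry_eq (hd : d.Valid) (he : e.Valid d) (hB : Echelon 6 m B) (hU : Describes 6 B U)
    (hn : ∀ i < d.gs.length, ∀ u ∈ U, whittenHom 5 (perms d.gs i) u ∈ U) :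
    leafEntry d e B = (Finset.univ.filter fun p => Good e.b d.group (dec e.s) p ∧
        p.2.comap SemidirectProduct.inl = U).card := by
  have ha := accepts_iff he hB hU
  by_cases hs : e.b = true → ∀ u ∈ U, whittenHom 5 (dec e.s) u ∈ U
  swap
  · rw [← ha, Bool.not_eq_true] at hs
    rw [Finset.filter_false_of_mem, Finset.card_empty, leafEntry, hs]
    rintro p - ⟨hp, hpU⟩
    rw [← Bool.not_eq_true, ha] at hs
    exact hs fun hb => invariant_of_mem (g := ⟨p.1, dec e.s⟩) hpU (hp.2 hb)
  have hg : ∀ g ∈ d.gs ++ [e.s], g ∈ codes := by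
    intro g hg
    rcases List.mem_append.1 hg with hg | hg
    · exact hd.gs_mem g hg
    · rw [List.mem_singleton.1 hg]
      exact he.s_mem
  have hR := hd.rewrites [e.s]
  have hnw : e.b = true → ∀ i < d.gs.length, wordProd (perms (d.gs ++ [e.s])) [d.gs.length, i] =
      wordProd (perms (d.gs ++ [e.s])) (word (nth e.norms i) ++ [d.gs.length]) := by
    intro _ i hi
    apply enc_injective
    rw [enc_wordProd hg, enc_wordProd hg]
    exact he.eq _ ((mem_normRels _ _ _ _).2 ⟨i, he.length_eq.symm ▸ hi, by rw [Nat.zero_add]⟩)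
  have hc := card_solves (U := U) hR (b := e.b) (nw := fun i => word (nth e.norms i))
    (fun i hi => perms_append d.gs [e.s] hi ▸ hn i hi)
    (fun hb => (perms_append_length d.gs e.s).symm ▸ hs hb) (fun _ => he.word_lt) hnw
  rw [closure_perms_append, perms_append_length] at hc
  have hlen : ((Finset.range 64).filter fun y => vec y ∈ U).card = 2 ^ B.length := by
    rw [← hB.card_span]
    congr 1
    exact Finset.filter_congr fun y hy => hU y (Finset.mem_range.1 hy)
  have hmem (x : ℕ) (r : List ℕ × List ℕ) (hr : wordProd (perms (d.gs ++ [e.s])) r.1 =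
      wordProd (perms (d.gs ++ [e.s])) r.2) :
      wordProd (lift (perms (d.gs ++ [e.s])) x) r.1 *
        (wordProd (lift (perms (d.gs ++ [e.s])) x) r.2)⁻¹ ∈ U.map SemidirectProduct.inl ↔
      red B (evalVec (d.gs ++ [e.s]) x r.1 ^^^ evalVec (d.gs ++ [e.s]) x r.2) = 0 := by
    rw [mul_inv_mem_map_inl, left_wordProd_lift hg, left_wordProd_lift hg, vec_inv, ← vec_xor, hU]
    · exact Nat.xor_lt_two_pow (n := 6) (evalVec_lt hg _ _) (evalVec_lt hg _ _)
    · rw [← SemidirectProduct.rightHom_eq_right]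
      rw [rightHom_wordProd_lift, rightHom_wordProd_lift, hr]
  have hlt (x : ℕ) (r : List ℕ × List ℕ) :
      evalVec (d.gs ++ [e.s]) x r.1 ^^^ evalVec (d.gs ++ [e.s]) x r.2 < 64 :=
    Nat.xor_lt_two_pow (n := 6) (evalVec_lt hg _ _) (evalVec_lt hg _ _)
  have hval (x : ℕ) : redPacked e.ones B (system d e x) = pack ((relations d e).map fun r =>
      red B (evalVec (d.gs ++ [e.s]) x r.1 ^^^ evalVec (d.gs ++ [e.s]) x r.2)) := by
    rw [he.ones_eq, system]
    have h1 : (relations d e).map (fun _ => 1) = ((relations d e).map fun r =>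
        Nat.xor (evalVec (d.gs ++ [e.s]) x r.1) (evalVec (d.gs ++ [e.s]) x r.2)).map
          fun _ => 1 := by
      rw [List.map_map]; rfl
    rw [h1, redPacked_pack B hB.mem_lt, List.map_map]
    · rfl
    · intro l hl
      obtain ⟨r, -, rfl⟩ := List.mem_map.1 hl
      exact hlt x r
  have hsol (x : ℕ) : Solves e.b d.gs.length (perms (d.gs ++ [e.s])) {r | r ∈ edges d}
      (fun i => word (nth e.norms i)) U x ↔ redPacked e.ones B (system d e x) = 0 := by
    rw [hval, pack_eq_zero, List.forall_mem_map]
    constructor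
    · rintro ⟨ha, hb⟩ r hr
      rcases mem_relations.1 hr with hr | ⟨hb', hr⟩
      · exact (hmem x r (hR.eq r hr)).1 (ha r hr)
      · obtain ⟨j, hj, rfl⟩ := (mem_normRels _ _ _ _).1 hr
        rw [he.length_eq] at hj
        rw [Nat.zero_add]
        exact (hmem x _ (hnw hb' j hj)).1 (hb hb' j hj)
    · intro h
      refine ⟨fun r hr => (hmem x r (hR.eq r hr)).2 (h r (mem_relations.2 (.inl hr))),
        fun hb i hi => (hmem x (_, _) (hnw hb i hi)).2 (h (_, _) (mem_relations.2 (.inr ⟨hb, ?_⟩)))⟩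
      exact (mem_normRels _ _ _ _).2 ⟨i, he.length_eq.symm ▸ hi, by rw [Nat.zero_add]⟩
  have hadd (x y : ℕ) : redPacked e.ones B (system d e (x ^^^ y)) =
      redPacked e.ones B (system d e x) ^^^ redPacked e.ones B (system d e y) := by
    rw [hval, hval, hval]
    refine pack_xor _ _ _ (fun r => hB.red_lt (hlt x r)) (fun r => hB.red_lt (hlt y r)) ?_ _
    intro r
    rw [evalVec_xor hg, evalVec_xor hg, ← red_xor]
    congr 1
    simp only [Nat.xor_assoc, Nat.xor_left_comm]
  have hk : ker (6 * (d.gs.length + 1)) (reduceCols e.ones B e.cols) =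
      ((Finset.range (64 ^ (d.gs.length + 1))).filter fun x => Solves e.b d.gs.length
        (perms (d.gs ++ [e.s])) {r | r ∈ edges d} (fun i => word (nth e.norms i)) U x).card := by
    rw [reduceCols_eq, he.cols_eq, map_columns, ker_eq _ _ (length_columns _ _).le,
      ← card_fiber hadd, pow_mul]
    congr 1
    exact Finset.filter_congr fun x _ => (hsol x).symm
  rw [leafEntry, ha.2 hs]
  change ker (6 * (d.gs.length + 1)) _ / 2 ^ (B.length * d.gs.length) = _
  rw [hk, hc, hlen, ← pow_mul]
  exact Nat.mul_div_cancel _ (by positivity)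

end Leaf

/-! ### Summation over all subgroups of `Z₂⁶` -/

open Classical in
/-- The number of pairs of a vector and a subgroup over `P` satisfying `Good`. -/
noncomputable def numGood (b : Bool) (P : Subgroup (Equiv.Perm (Fin 5)))
    (s : Equiv.Perm (Fin 5)) : ℕ :=
  (Finset.univ.filter fun p => Good b P s p).card

variable {d : GroupData} {cs : List ClassData}

theorem leafGroup_eq (d : GroupData) (cs : List ClassData) (B : List (ℕ × ℕ)) :
    leafGroup d cs B = if ∀ g ∈ d.gs, invariant g B = true then leafEntries d cs B else 0 := by
  obtain ⟨gs, nodes⟩ := d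
  rw [leafGroup]
  generalize leafEntries ⟨gs, nodes⟩ cs B = a
  change @List.rec ℕ (fun _ => ℕ) a (fun g _ ih =>
    @Bool.rec (fun _ => ℕ) 0 ih (invariant g B)) gs = _
  induction gs with
  | nil => rfl
  | cons g gs ih =>
    simp only [List.forall_mem_cons] at ih ⊢
    rw [ih]
    cases invariant g B <;> simp

open Classical in
theorem leafEntries_eq (hd : d.Valid) (hcs : ∀ c ∈ cs, c.entry.Valid d) {m : ℕ}
    {B : List (ℕ × ℕ)} {U : Subgroup Vec} (hB : Echelon 6 m B) (hU : Describes 6 B U)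
    (hn : ∀ i < d.gs.length, ∀ u ∈ U, whittenHom 5 (perms d.gs i) u ∈ U) :
    leafEntries d cs B = (cs.map fun c => c.size * (Finset.univ.filter fun p =>
      Good c.entry.b d.group (dec c.entry.s) p ∧
        p.2.comap SemidirectProduct.inl = U).card).sum := by
  induction cs with
  | nil => rfl
  | cons c cs ih =>
    rw [List.map_cons, List.sum_cons, ← ih fun c hc => hcs c (List.mem_cons_of_mem _ hc),
      ← leafEntry_eq hd (hcs c List.mem_cons_self) hB hU hn]
    rfl

open Classical in
theorem sumBases_leafGroup (hd : d.Valid) (hcs : ∀ c ∈ cs, c.entry.Valid d) :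
    sumBases (leafGroup d cs) 6 0 0 [] =
      (cs.map fun c => c.size * numGood c.entry.b d.group (dec c.entry.s)).sum := by
  rw [sumBases_eq (leafGroup d cs) fun U => (cs.map fun c => c.size * (Finset.univ.filter fun p =>
    Good c.entry.b d.group (dec c.entry.s) p ∧ p.2.comap SemidirectProduct.inl = U).card).sum]
  · clear hcs
    induction cs with
    | nil => simp
    | cons c cs ih =>
      simp only [List.map_cons, List.sum_cons]
      rw [Finset.sum_add_distrib, ih, ← Finset.mul_sum, numGood,
        Finset.card_eq_sum_card_fiberwise (f := fun p => p.2.comap SemidirectProduct.inl)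
          (t := Finset.univ) (by simp)]
      simp only [Finset.filter_filter]
  · intro m B U hB hU
    rw [leafGroup_eq]
    split_ifs with h
    · apply leafEntries_eq hd hcs hB hU
      intro i hi
      rw [← invariant_iff hB hU, enc_perms hd.gs_mem, nth_eq_getElem _ hi]
      exact h _ (List.getElem_mem hi)
    · symm
      apply List.sum_eq_zero
      intro x hx
      obtain ⟨c, -, rfl⟩ := List.mem_map.1 hx
      rw [Finset.filter_false_of_mem, Finset.card_empty, mul_zero]
      rintro ⟨v, H⟩ - ⟨⟨hp, -⟩, hpU⟩
      apply h
      intro g hg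
      obtain ⟨i, hi, rfl⟩ := List.getElem_of_mem hg
      rw [← nth_eq_getElem _ hi, ← enc_perms hd.gs_mem, invariant_iff hB hU]
      have hm : perms d.gs i ∈ d.group := Subgroup.subset_closure ⟨i, hi, rfl⟩
      rw [← hp] at hm
      obtain ⟨γ, hγ, hr⟩ := hm
      rw [← hr]
      exact invariant_of_mem hpU (map_conj_eq_of_mem hγ)

/-! ### The conjugation action on subgroups -/

section Conjugation

variable {G : Type*} [Group G]

/-- The action of a group on its subgroups by conjugation. -/
@[reducible]
def conjugation : MulAction G (Subgroup G) where
  smul g H := H.map (MulAut.conj g).toMonoidHom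
  one_smul H := by
    change H.map (MulAut.conj 1).toMonoidHom = H
    rw [map_one]
    exact H.map_id
  mul_smul g h H := by
    change H.map (MulAut.conj (g * h)).toMonoidHom =
      (H.map (MulAut.conj h).toMonoidHom).map (MulAut.conj g).toMonoidHom
    rw [map_mul, Subgroup.map_map]
    rfl

attribute [local instance] conjugation

theorem smul_def (g : G) (H : Subgroup G) : g • H = H.map (MulAut.conj g).toMonoidHom := rfl

theorem conj_mem_smul (g : G) {H : Subgroup G} {x : G} (hx : x ∈ H) : g * x * g⁻¹ ∈ g • H :=
  ⟨x, hx, rfl⟩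

theorem smul_le_iff {g : G} {s : Set G} {K : Subgroup G} :
    g • Subgroup.closure s ≤ K ↔ ∀ x ∈ s, g * x * g⁻¹ ∈ K := by
  rw [smul_def, Subgroup.map_le_iff_le_comap, Subgroup.closure_le]
  rfl

theorem smul_le_smul {g : G} {H K : Subgroup G} (h : H ≤ K) : g • H ≤ g • K :=
  Subgroup.map_mono h

theorem map_smul_eq {S : Type*} [Group S] (π : G →* S) (g : G) (H : Subgroup G) :
    (g • H).map π = π g • H.map π := by
  rw [smul_def, smul_def, Subgroup.map_map, Subgroup.map_map]
  congr 1
  ext x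
  simp

theorem smul_smul_conj (g h : G) (H : Subgroup G) : (g * h * g⁻¹) • g • H = g • h • H := by
  rw [smul_smul, smul_smul, inv_mul_cancel_right]

end Conjugation

section

attribute [local instance] conjugation

theorem good_iff (b : Bool) (P : Subgroup (Equiv.Perm (Fin 5))) (s : Equiv.Perm (Fin 5))
    (p : Vec × Subgroup (WhittenGroup 5)) : Good b P s p ↔
      p.2.map SemidirectProduct.rightHom = P ∧
        (b = true → (⟨p.1, s⟩ : WhittenGroup 5) • p.2 = p.2) :=
  Iff.rfl

theorem inr_mul_mul_inr (t s : Equiv.Perm (Fin 5)) (v : Vec) :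
    (⟨whittenHom 5 t v, t * s * t⁻¹⟩ : WhittenGroup 5) =
      SemidirectProduct.inr t * ⟨v, s⟩ * (SemidirectProduct.inr t)⁻¹ := by
  ext1 <;> simp

theorem Good.smul {b : Bool} {P : Subgroup (Equiv.Perm (Fin 5))} {s : Equiv.Perm (Fin 5)}
    {p : Vec × Subgroup (WhittenGroup 5)} (hp : Good b P s p) (t : Equiv.Perm (Fin 5)) :
    Good b (t • P) (t * s * t⁻¹)
      (whittenHom 5 t p.1, (SemidirectProduct.inr t : WhittenGroup 5) • p.2) := by
  rw [good_iff] at hp ⊢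
  refine ⟨by rw [map_smul_eq, hp.1, SemidirectProduct.rightHom_inr], fun hb => ?_⟩
  rw [inr_mul_mul_inr, smul_smul_conj, hp.2 hb]

theorem numGood_le_smul (b : Bool) (P : Subgroup (Equiv.Perm (Fin 5))) (s t : Equiv.Perm (Fin 5)) :
    numGood b P s ≤ numGood b (t • P) (t * s * t⁻¹) := by
  classical
  refine Finset.card_le_card_of_injOn (fun p => (whittenHom 5 t p.1,
    (SemidirectProduct.inr t : WhittenGroup 5) • p.2)) ?_ ?_
  · intro p hp
    exact Finset.mem_coe.2 (Finset.mem_filter.2 ⟨Finset.mem_univ _,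
      (Finset.mem_filter.1 (Finset.mem_coe.1 hp)).2.smul t⟩)
  · rintro ⟨v, H⟩ - ⟨w, K⟩ - h
    rw [Prod.mk.injEq] at h
    exact Prod.ext ((whittenHom 5 t).injective h.1) (MulAction.injective _ h.2)

theorem numGood_smul (b : Bool) (P : Subgroup (Equiv.Perm (Fin 5))) (s t : Equiv.Perm (Fin 5)) :
    numGood b (t • P) (t * s * t⁻¹) = numGood b P s := by
  refine le_antisymm ?_ (numGood_le_smul b P s t)
  refine (numGood_le_smul b _ _ t⁻¹).trans_eq ?_
  rw [inv_smul_smul]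
  congr 1
  group

theorem numGood_eq_zero {P : Subgroup (Equiv.Perm (Fin 5))} {s : Equiv.Perm (Fin 5)}
    (h : s • P ≠ P) : numGood true P s = 0 := by
  classical
  rw [numGood, Finset.filter_false_of_mem, Finset.card_empty]
  rintro p - ⟨rfl, hp⟩
  apply h
  have := map_smul_eq SemidirectProduct.rightHom (⟨p.1, s⟩ : WhittenGroup 5) p.2
  rw [smul_def, hp rfl] at this
  exact this.symm

/-- The number of pairs of an element of the Whitten group and a subgroup over `P` normalized by
it. -/
noncomputable def numNormalized (P : Subgroup (Equiv.Perm (Fin 5))) : ℕ := ∑ s, numGood true P s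

theorem numNormalized_smul (t : Equiv.Perm (Fin 5)) (P : Subgroup (Equiv.Perm (Fin 5))) :
    numNormalized (t • P) = numNormalized P := by
  rw [numNormalized, ← (MulAut.conj t).toEquiv.sum_comp]
  exact Finset.sum_congr rfl fun s _ => numGood_smul true P s t

theorem numGood_false_smul (t : Equiv.Perm (Fin 5)) (P : Subgroup (Equiv.Perm (Fin 5))) :
    numGood false (t • P) 1 = numGood false P 1 := by
  have := numGood_smul false P 1 t
  rwa [mul_one, mul_inv_cancel] at this

end

/-! ### A list of representatives of the conjugacy classes of subgroups of the symmetric group -/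

/-- Conjugation of permutation codes. -/
def conjc (t g : ℕ) : ℕ := mulc (mulc t g) (invc t)

/-- For the overgroups of a group that contain a further permutation `r`, the position of another
group in a list, a permutation `t`, and words for the conjugates of its generators by `t`. -/
structure StepData where
  r : ℕ
  k : ℕ
  t : ℕ
  words : List ℕ

/-- A group of permutations with its elements, its normalizer, the number of its conjugates, steps
to larger groups, the classes of its normalizer, and the numbers of subgroups over it. -/
structure RepData where
  data : GroupData
  elems : List ℕ
  norm : List ℕ
  size : ℕ
  steps : List StepData
  free : EntryData
  classes : List ClassData
  numFree : ℕ
  numNorm : ℕ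

/-- Whether the entries of a list are distinct. -/
def distinct : List ℕ → Bool
  | [] => true
  | a :: l => !elemOf l a && distinct l

/-- Validity of the lists of elements of the group and of its normalizer. -/
noncomputable def RepData.checkGroup (ρ : RepData) : Bool :=
  ρ.data.check && eqLists ρ.elems (ρ.data.nodes.map fun n => evalPerm ρ.data.gs (word n.1)) &&
  codes.all (fun c => @Bool.rec (fun _ => Bool) (!elemOf ρ.norm c) (elemOf ρ.norm c)
    (ρ.data.gs.all fun g => elemOf ρ.elems (conjc c g))) &&
  ρ.norm.all (elemOf codes) && distinct ρ.norm && Nat.beq (ρ.size * ρ.norm.length) 120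

/-- Validity of the entries. -/
noncomputable def RepData.checkClasses (ρ : RepData) : Bool :=
  ρ.free.check ρ.data && !ρ.free.b && Nat.beq ρ.free.s 181896 &&
  ρ.classes.all (fun c => c.entry.check ρ.data && c.entry.b && Nat.beq c.conjs.length c.size &&
    c.conjs.all (elemOf ρ.norm)) &&
  eqLists ρ.norm (ρ.classes.flatMap fun c => c.conjs.map fun t => conjc t c.entry.s)

/-- Validity of the numbers of subgroups. -/
noncomputable def RepData.checkSums (ρ : RepData) : Bool :=
  Nat.beq (sumBases (leafGroup ρ.data [⟨1, [], ρ.free⟩]) 6 0 0 []) ρ.numFree &&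
  Nat.beq (sumBases (leafGroup ρ.data ρ.classes) 6 0 0 []) ρ.numNorm

/-- Validity of the data of a representative. -/
noncomputable def RepData.check (ρ : RepData) : Bool :=
  ρ.checkGroup && ρ.checkClasses && ρ.checkSums

/-- Validity of a step. -/
noncomputable def StepData.check (ρ : RepData) (rest : List RepData) (σ : StepData) : Bool :=
  elemOf codes σ.r && elemOf codes σ.t &&
  (rest.drop σ.k).head?.any fun ρ' => eqLists (ρ'.data.gs.map (conjc σ.t))
    (σ.words.map fun w => evalPerm (ρ.data.gs ++ [σ.r]) (word w))

/-- Every overgroup of a member of the list contains a conjugate of a later member. -/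
noncomputable def checkSteps : List RepData → Bool
  | [] => true
  | ρ :: rest => codes.all (fun c => elemOf ρ.elems c ||
      ρ.steps.any fun σ => elemOf ρ.elems (mulc c (invc σ.r))) &&
    ρ.steps.all (StepData.check ρ rest) && checkSteps rest

/-- No member of the list contains a conjugate of a later member. -/
noncomputable def checkDistinct : List RepData → Bool
  | [] => true
  | ρ :: rest => rest.all (fun ρ' => codes.all fun t =>
      ρ'.data.gs.any fun g => !elemOf ρ.elems (conjc t g)) && checkDistinct rest

theorem nth_of_length_le (gs : List ℕ) {i : ℕ} (hi : gs.length ≤ i) : nth gs i = 181896 := by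
  induction gs generalizing i with
  | nil => rfl
  | cons g gs ih =>
    obtain ⟨i, rfl⟩ := Nat.exists_eq_add_of_le' (Nat.one_le_of_lt hi)
    exact ih (Nat.le_of_succ_le_succ hi)

theorem distinct_nodup {l : List ℕ} (h : distinct l = true) : l.Nodup := by
  induction l with
  | nil => exact List.nodup_nil
  | cons a l ih =>
    rw [distinct, Bool.and_eq_true, Bool.not_eq_true', ← Bool.not_eq_true, elemOf_eq_true] at h
    exact List.nodup_cons.2 ⟨h.1, ih h.2⟩

theorem enc_conj (t g : Equiv.Perm (Fin 5)) : enc (t * g * t⁻¹) = conjc (enc t) (enc g) := by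
  rw [enc_mul, enc_mul, enc_inv, conjc]

theorem GroupData.Valid.mem_group {d : GroupData} (hd : d.Valid) {p : Equiv.Perm (Fin 5)} :
    p ∈ d.group ↔ enc p ∈ d.nodes.map fun n => evalPerm d.gs (word n.1) := by
  have hR := hd.rewrites []
  rw [List.append_nil] at hR
  constructor
  · intro hp
    rw [GroupData.group, ← Subgroup.mem_toSubmonoid, Subgroup.closure_toSubmonoid_of_finite] at hp
    obtain ⟨n, hn, h⟩ : ∃ n ∈ d.nodes, wordProd (perms d.gs) (word n.1) = p := by
      induction hp using Submonoid.closure_induction_left with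
      | one =>
        obtain ⟨n, hn, h⟩ := hR.nil_mem
        exact ⟨n, hn, by rw [h]; rfl⟩
      | mul_left x hx y _ ih =>
        obtain ⟨n, hn, rfl⟩ := ih
        obtain ⟨i, hi, rfl⟩ := hx
        obtain ⟨_, ⟨m, hm, rfl⟩, h⟩ := hR.closed _ ⟨n, hn, rfl⟩ i hi
        refine ⟨m, hm, ?_⟩
        rw [← wordProd_cons]
        rcases h with h | h
        · rw [h]
        · exact (hR.eq _ h).symm
    rw [← h, enc_wordProd hd.gs_mem]
    exact List.mem_map.2 ⟨n, hn, rfl⟩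
  · intro hp
    obtain ⟨n, hn, h⟩ := List.mem_map.1 hp
    rw [← enc_wordProd hd.gs_mem] at h
    rw [← enc_injective h]
    exact wordProd_mem fun i hi => Subgroup.subset_closure ⟨i, hd.word_lt n hn i hi, rfl⟩

/-- The subgroup of the symmetric group given by the data. -/
noncomputable def RepData.group (ρ : RepData) : Subgroup (Equiv.Perm (Fin 5)) := ρ.data.group

section

attribute [local instance] conjugation

/-- The propositional content of `RepData.checkGroup`. -/
structure RepData.Valid (ρ : RepData) : Prop where
  data : ρ.data.Valid
  elems : ∀ p, p ∈ ρ.group ↔ enc p ∈ ρ.elems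
  norm_mem : ∀ c ∈ ρ.norm, c ∈ codes
  norm : ∀ c ∈ codes, (∀ g ∈ ρ.data.gs, conjc c g ∈ ρ.elems) ↔ c ∈ ρ.norm
  nodup : ρ.norm.Nodup
  card : ρ.size * ρ.norm.length = 120

variable {ρ ρ' : RepData}

theorem RepData.valid (h : ρ.checkGroup = true) : ρ.Valid := by
  simp only [checkGroup, Bool.and_eq_true, List.all_eq_true, elemOf_eq_true, beq_eq_true] at h
  obtain ⟨⟨⟨⟨⟨h1, h2⟩, h3⟩, h4⟩, h5⟩, h6⟩ := h
  have hd := GroupData.valid h1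
  refine ⟨hd, fun p => ?_, h4, fun c hc => ?_, distinct_nodup h5, h6⟩
  · rw [eqLists_eq_true h2]
    exact hd.mem_group
  · have h := h3 c hc
    have h' : (ρ.data.gs.all fun g => elemOf ρ.elems (conjc c g)) = true ↔
        ∀ g ∈ ρ.data.gs, conjc c g ∈ ρ.elems := by
      simp only [List.all_eq_true, elemOf_eq_true]
    rw [← h', ← elemOf_eq_true]
    cases hb : (ρ.data.gs.all fun g => elemOf ρ.elems (conjc c g))
    · rw [hb] at h
      exact iff_of_false Bool.false_ne_true (by simpa using h)
    · rw [hb] at h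
      exact iff_of_true rfl h

theorem GroupData.smul_group_le_iff {d : GroupData} {t : Equiv.Perm (Fin 5)}
    {K : Subgroup (Equiv.Perm (Fin 5))} :
    t • d.group ≤ K ↔ ∀ g ∈ d.gs, t * dec g * t⁻¹ ∈ K := by
  rw [GroupData.group, smul_le_iff, Set.forall_mem_image]
  constructor
  · intro h g hg
    obtain ⟨i, hi, rfl⟩ := List.getElem_of_mem hg
    rw [← nth_eq_getElem _ hi]
    exact h (Set.mem_Iio.2 hi)
  · intro h i hi
    rw [perms, nth_eq_getElem _ (Set.mem_Iio.1 hi)]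
    exact h _ (List.getElem_mem _)

theorem RepData.Valid.smul_group_le_iff (h : ρ.Valid) (hd : ρ'.data.Valid)
    {t : Equiv.Perm (Fin 5)} :
    t • ρ'.group ≤ ρ.group ↔ ∀ g ∈ ρ'.data.gs, conjc (enc t) g ∈ ρ.elems := by
  rw [RepData.group, GroupData.smul_group_le_iff]
  refine forall₂_congr fun g hg => ?_
  rw [h.elems, enc_conj, enc_dec (hd.gs_mem g hg)]

theorem RepData.Valid.smul_eq_iff (h : ρ.Valid) {t : Equiv.Perm (Fin 5)} :
    t • ρ.group = ρ.group ↔ enc t ∈ ρ.norm := by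
  rw [← h.norm _ (enc_mem_codes t), ← h.smul_group_le_iff h.data]
  exact ⟨fun h => h.le, map_conj_eq_of_le⟩

theorem RepData.Valid.card_toFinset (h : ρ.Valid) :
    (ρ.norm.map dec).toFinset.card = ρ.norm.length := by
  rw [List.toFinset_card_of_nodup, List.length_map]
  refine h.nodup.map_on fun x hx y hy hxy => ?_
  rw [← enc_dec (h.norm_mem x hx), hxy, enc_dec (h.norm_mem y hy)]

theorem RepData.Valid.mem_toFinset (h : ρ.Valid) {t : Equiv.Perm (Fin 5)} :
    t ∈ (ρ.norm.map dec).toFinset ↔ t • ρ.group = ρ.group := by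
  rw [h.smul_eq_iff, List.mem_toFinset, List.mem_map]
  constructor
  · rintro ⟨c, hc, rfl⟩
    rwa [enc_dec (h.norm_mem c hc)]
  · exact fun ht => ⟨_, ht, dec_enc t⟩

theorem RepData.Valid.card_orbit (h : ρ.Valid) :
    Nat.card (MulAction.orbit (Equiv.Perm (Fin 5)) ρ.group) = ρ.size := by
  have h1 : Nat.card (MulAction.stabilizer (Equiv.Perm (Fin 5)) ρ.group) = ρ.norm.length := by
    rw [← h.card_toFinset, ← Nat.card_eq_finsetCard]
    exact Nat.card_congr (Equiv.subtypeEquivRight fun t => h.mem_toFinset.symm)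
  have h2 : Nat.card (MulAction.orbit (Equiv.Perm (Fin 5)) ρ.group) * ρ.norm.length = 120 := by
    rw [← h1, ← Nat.card_prod,
      Nat.card_congr (MulAction.orbitProdStabilizerEquivGroup (Equiv.Perm (Fin 5)) ρ.group),
      Nat.card_eq_fintype_card, Fintype.card_perm]
    rfl
  have h3 := h.card
  rw [← h2] at h3
  exact (Nat.eq_of_mul_eq_mul_right (Nat.pos_of_ne_zero fun h => by simp [h] at h2) h3).symm

theorem RepData.numFree_eq (h : ρ.Valid) (hc : ρ.checkClasses = true) (hs : ρ.checkSums = true) :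
    numGood false ρ.group 1 = ρ.numFree := by
  simp only [checkClasses, Bool.and_eq_true, Bool.not_eq_true', beq_eq_true] at hc
  simp only [checkSums, Bool.and_eq_true, beq_eq_true] at hs
  obtain ⟨⟨⟨⟨h1, h2⟩, h3⟩, -⟩, -⟩ := hc
  rw [← hs.1, sumBases_leafGroup h.data (by simpa using EntryData.valid h1)]
  rw [List.map_cons, List.map_nil, List.sum_singleton, h2, h3, one_mul, ← enc_one, dec_enc]
  rfl

theorem RepData.numNorm_eq (h : ρ.Valid) (hc : ρ.checkClasses = true) (hs : ρ.checkSums = true) :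
    numNormalized ρ.group = ρ.numNorm := by
  simp only [checkClasses, Bool.and_eq_true, List.all_eq_true, elemOf_eq_true, beq_eq_true] at hc
  simp only [checkSums, Bool.and_eq_true, beq_eq_true] at hs
  obtain ⟨⟨-, h4⟩, h5⟩ := hc
  rw [← hs.2, sumBases_leafGroup h.data fun c hc => EntryData.valid (h4 c hc).1.1.1]
  have h6 : numNormalized ρ.group = (ρ.norm.map fun c => numGood true ρ.group (dec c)).sum := by
    rw [numNormalized, ← Finset.sum_subset (Finset.subset_univ (ρ.norm.map dec).toFinset)
      fun s _ hs => numGood_eq_zero fun h' => hs (h.mem_toFinset.2 h'), List.sum_toFinset,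
      List.map_map]
    · rfl
    · refine h.nodup.map_on fun x hx y hy hxy => ?_
      rw [← enc_dec (h.norm_mem x hx), hxy, enc_dec (h.norm_mem y hy)]
  rw [h6, eqLists_eq_true h5, List.map_flatMap, List.flatMap_def, List.sum_flatten, List.map_map]
  refine congrArg List.sum (List.map_congr_left fun c hc => ?_)
  rw [Function.comp_apply]
  obtain ⟨⟨⟨hv, hb⟩, hl⟩, ht⟩ := h4 c hc
  rw [← hl, hb, List.map_map,
    List.map_congr_left (g := fun _ => numGood true ρ.group (dec c.entry.s)),
    List.map_const', List.sum_replicate, smul_eq_mul]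
  · rfl
  · intro t htc
    have hs := (EntryData.valid hv).s_mem
    have ht := ht t htc
    have htc := h.norm_mem t ht
    have ht' := h.smul_eq_iff.2 ((enc_dec htc).symm ▸ ht)
    rw [Function.comp_apply, ← numGood_smul true ρ.group (dec c.entry.s) (dec t), ht',
      ← dec_enc (dec t * dec c.entry.s * (dec t)⁻¹), enc_conj, enc_dec htc, enc_dec hs]

theorem exists_conjugate (l : List RepData) (hl : ∀ ρ ∈ l, ρ.Valid) (h : checkSteps l = true)
    {P : Subgroup (Equiv.Perm (Fin 5))}
    (hP : ∃ ρ ∈ l, ∃ t : Equiv.Perm (Fin 5), t • ρ.group ≤ P) :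
    ∃ ρ ∈ l, ∃ t : Equiv.Perm (Fin 5), t • ρ.group = P := by
  induction l with
  | nil => simp at hP
  | cons ρ rest ih =>
    simp only [checkSteps, Bool.and_eq_true, List.all_eq_true, Bool.or_eq_true, List.any_eq_true,
      elemOf_eq_true] at h
    obtain ⟨⟨h1, h2⟩, h3⟩ := h
    have hrest : (∃ ρ ∈ rest, ∃ t : Equiv.Perm (Fin 5), t • ρ.group ≤ P) →
        ∃ ρ' ∈ ρ :: rest, ∃ t : Equiv.Perm (Fin 5), t • ρ'.group = P := fun hP => by
      obtain ⟨ρ', hρ', ht⟩ := ih (fun ρ hρ => hl ρ (List.mem_cons_of_mem _ hρ)) h3 hP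
      exact ⟨ρ', List.mem_cons_of_mem _ hρ', ht⟩
    obtain ⟨ρ', hρ', t, ht⟩ := hP
    rcases List.mem_cons.1 hρ' with rfl | hρ'
    swap
    · exact hrest ⟨ρ', hρ', t, ht⟩
    have hv := hl _ List.mem_cons_self
    by_cases hPt : P ≤ t • ρ'.group
    · exact ⟨ρ', List.mem_cons_self, t, ht.antisymm hPt⟩
    obtain ⟨x, hx, hxt⟩ := SetLike.not_le_iff_exists.1 hPt
    have hQ : ρ'.group ≤ t⁻¹ • P := by
      have := smul_le_smul (g := t⁻¹) ht
      rwa [inv_smul_smul] at this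
    have hy : t⁻¹ * x * t ∈ t⁻¹ • P := by
      have := conj_mem_smul t⁻¹ hx
      rwa [inv_inv] at this
    rcases h1 _ (enc_mem_codes (t⁻¹ * x * t)) with h1 | ⟨σ, hσ, h1⟩
    · rw [← hv.elems] at h1
      refine absurd ?_ hxt
      have := conj_mem_smul t h1
      rwa [show t * (t⁻¹ * x * t) * t⁻¹ = x by group] at this
    have h2 := h2 σ hσ
    simp only [StepData.check, Bool.and_eq_true, elemOf_eq_true, Option.any_eq_true] at h2
    obtain ⟨⟨hr, hu⟩, ρ'', hρ'', h4⟩ := h2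
    have hm : ρ'' ∈ rest := List.mem_of_mem_drop (List.mem_of_mem_head? hρ'')
    have hd := (hl _ (List.mem_cons_of_mem _ hm)).data
    have hrQ : dec σ.r ∈ t⁻¹ • P := by
      rw [← enc_dec hr, ← enc_inv, ← enc_mul, ← hv.elems] at h1
      have := Subgroup.mul_mem _ (Subgroup.inv_mem _ (hQ h1)) hy
      rwa [show (t⁻¹ * x * t * (dec σ.r)⁻¹)⁻¹ * (t⁻¹ * x * t) = dec σ.r by group] at this
    have hg : ∀ g ∈ ρ'.data.gs ++ [σ.r], g ∈ codes := by
      intro g hg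
      rcases List.mem_append.1 hg with hg | hg
      · exact hv.data.gs_mem g hg
      · rwa [List.mem_singleton.1 hg]
    have hgQ (i : ℕ) : perms (ρ'.data.gs ++ [σ.r]) i ∈ t⁻¹ • P := by
      rcases lt_trichotomy i ρ'.data.gs.length with hi | rfl | hi
      · rw [perms_append _ _ hi]
        exact hQ (Subgroup.subset_closure ⟨i, hi, rfl⟩)
      · rwa [perms_append_length]
      · rw [perms, nth_of_length_le, ← enc_one, dec_enc]
        · exact Subgroup.one_mem _
        · rw [List.length_append]
          exact hi
    refine hrest ⟨ρ'', hm, t * dec σ.t, ?_⟩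
    rw [mul_smul, ← smul_inv_smul t P]
    apply smul_le_smul
    rw [RepData.group, GroupData.smul_group_le_iff]
    intro g hg'
    have h5 : conjc σ.t g ∈ ρ''.data.gs.map (conjc σ.t) := List.mem_map_of_mem hg'
    rw [eqLists_eq_true h4] at h5
    obtain ⟨w, -, h5⟩ := List.mem_map.1 h5
    rw [← enc_wordProd hg] at h5
    have h6 : enc (dec σ.t * dec g * (dec σ.t)⁻¹) = conjc σ.t g := by
      rw [enc_conj, enc_dec hu, enc_dec (hd.gs_mem g hg')]
    rw [← h5] at h6
    rw [enc_injective h6]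
    exact wordProd_mem fun i _ => hgQ i

theorem pairwise_of_checkDistinct (l : List RepData) (hl : ∀ ρ ∈ l, ρ.Valid)
    (h : checkDistinct l = true) :
    l.Pairwise fun ρ ρ' => ∀ t : Equiv.Perm (Fin 5), t • ρ'.group ≠ ρ.group := by
  induction l with
  | nil => exact List.Pairwise.nil
  | cons ρ rest ih =>
    simp only [checkDistinct, Bool.and_eq_true, List.all_eq_true, List.any_eq_true] at h
    rw [List.pairwise_cons]
    refine ⟨fun ρ' hρ' t ht => ?_, ih (fun ρ hρ => hl ρ (List.mem_cons_of_mem _ hρ)) h.2⟩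
    obtain ⟨g, hg, h1⟩ := h.1 ρ' hρ' _ (enc_mem_codes t)
    rw [Bool.not_eq_true', ← Bool.not_eq_true, elemOf_eq_true] at h1
    exact h1 (((hl ρ List.mem_cons_self).smul_group_le_iff
      (hl ρ' (List.mem_cons_of_mem _ hρ')).data).1 ht.le g hg)

end

open Classical in
theorem sum_eq_sum_card_orbit {G X : Type*} [Group G] [MulAction G X] [Fintype X] {f : X → ℕ}
    (hf : ∀ (g : G) x, f (g • x) = f x) {l : List X}
    (hl : l.Pairwise fun x y => ∀ g : G, g • y ≠ x) :
    ∑ x with ∃ y ∈ l, x ∈ MulAction.orbit G y, f x =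
      (l.map fun y => Nat.card (MulAction.orbit G y) * f y).sum := by
  induction l with
  | nil => simp
  | cons y l ih =>
    rw [List.pairwise_cons] at hl
    rw [List.map_cons, List.sum_cons, ← ih hl.2]
    simp only [List.exists_mem_cons_iff]
    rw [Finset.filter_or, Finset.sum_union]
    · congr 1
      rw [Finset.sum_congr rfl (g := fun _ => f y), Finset.sum_const, smul_eq_mul,
        ← Nat.card_eq_finsetCard]
      · congr 1
        exact Nat.card_congr (Equiv.subtypeEquivRight fun x => by simp)
      · intro x hx
        obtain ⟨g, rfl⟩ := (Finset.mem_filter.1 hx).2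
        exact hf g y
    · rw [Finset.disjoint_filter]
      rintro x - ⟨g, rfl⟩ ⟨z, hz, h, hh⟩
      apply hl.1 z hz (g⁻¹ * h)
      change h • z = g • y at hh
      rw [mul_smul, hh, inv_smul_smul]

section

attribute [local instance] conjugation

theorem sum_subgroups (l : List RepData) (hl : ∀ ρ ∈ l, ρ.Valid) (h1 : checkSteps l = true)
    (h2 : checkDistinct l = true) (h3 : ∃ ρ ∈ l, ρ.data.gs = [])
    {f : Subgroup (Equiv.Perm (Fin 5)) → ℕ}
    (hf : ∀ (t : Equiv.Perm (Fin 5)) P, f (t • P) = f P) :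
    ∑ P, f P = (l.map fun ρ => ρ.size * f ρ.group).sum := by
  classical
  have h := sum_eq_sum_card_orbit hf (l := l.map RepData.group)
    (List.pairwise_map.2 (pairwise_of_checkDistinct l hl h2))
  rw [List.map_map] at h
  rw [← List.map_congr_left (f := (fun P => Nat.card (MulAction.orbit (Equiv.Perm (Fin 5)) P) *
    f P) ∘ RepData.group), ← h, Finset.filter_true_of_mem]
  · intro P _
    obtain ⟨ρ, hρ, h⟩ := h3
    obtain ⟨ρ', hρ', t, rfl⟩ := exists_conjugate l hl h1 (P := P) ⟨ρ, hρ, 1, by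
      rw [one_smul, RepData.group, GroupData.group, h]
      simp⟩
    exact ⟨_, List.mem_map_of_mem hρ', t, rfl⟩
  · intro ρ hρ
    rw [Function.comp_apply, (hl ρ hρ).card_orbit]

end

/-! ### Counting subgroups and conjugacy classes -/

theorem card_whittenGroup : Nat.card (WhittenGroup 5) = 7680 := by
  rw [SemidirectProduct.card, Nat.card_eq_fintype_card, Nat.card_eq_fintype_card, card_vectors,
    Fintype.card_perm]
  rfl

theorem sum_numGood_false :
    ∑ P, numGood false P 1 = 64 * Nat.card (Subgroup (WhittenGroup 5)) := by
  classical
  rw [← card_vectors, Nat.card_eq_fintype_card, ← Fintype.card_prod, ← Finset.card_univ,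
    Finset.card_eq_sum_card_fiberwise (f := fun p => p.2.map SemidirectProduct.rightHom)
      (t := Finset.univ) (by simp)]
  refine Finset.sum_congr rfl fun P _ => ?_
  rw [numGood]
  congr 1
  exact Finset.filter_congr fun p _ => by simp [Good]

section

attribute [local instance] conjugation

theorem sum_numGood_true (s : Equiv.Perm (Fin 5)) :
    ∑ P, numGood true P s =
      ∑ v : Vec, Nat.card
        (MulAction.fixedBy (Subgroup (WhittenGroup 5)) (⟨v, s⟩ : WhittenGroup 5)) := by
  classical
  have h (v : Vec) :
      Nat.card (MulAction.fixedBy (Subgroup (WhittenGroup 5)) (⟨v, s⟩ : WhittenGroup 5)) =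
      ∑ H : Subgroup (WhittenGroup 5), if (⟨v, s⟩ : WhittenGroup 5) • H = H then 1 else 0 := by
    rw [← Finset.card_filter, ← Nat.card_eq_finsetCard]
    exact Nat.card_congr (Equiv.subtypeEquivRight fun x => by simp)
  simp only [h]
  rw [← Fintype.sum_prod_type fun p : Vec × Subgroup (WhittenGroup 5) =>
      if (⟨p.1, s⟩ : WhittenGroup 5) • p.2 = p.2 then 1 else 0, ← Finset.card_filter,
    Finset.card_eq_sum_card_fiberwise (f := fun p => p.2.map SemidirectProduct.rightHom)
      (t := Finset.univ) (by simp)]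
  refine Finset.sum_congr rfl fun P _ => ?_
  rw [numGood, Finset.filter_filter]
  congr 1
  exact Finset.filter_congr fun p _ => by rw [good_iff]; simp [and_comm]

theorem sum_numNormalized : ∑ P, numNormalized P =
    7680 * Nat.card (Quot (subgroupConj (G := WhittenGroup 5))) := by
  classical
  have hQ : Nat.card (Quot (subgroupConj (G := WhittenGroup 5))) =
      Nat.card (MulAction.orbitRel.Quotient (WhittenGroup 5) (Subgroup (WhittenGroup 5))) := by
    refine Nat.card_congr (Quot.congrRight fun H K => ?_)
    change _ ↔ H ∈ MulAction.orbit (WhittenGroup 5) K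
    rw [MulAction.mem_orbit_symm]
    rfl
  have : Fintype (WhittenGroup 5) := Fintype.ofFinite _
  rw [hQ, ← card_whittenGroup, mul_comm, Nat.card_eq_fintype_card, Nat.card_eq_fintype_card,
    ← MulAction.sum_card_fixedBy_eq_card_orbits_mul_card_group]
  simp only [numNormalized]
  rw [Finset.sum_comm]
  simp only [sum_numGood_true]
  rw [Finset.sum_comm, ← Fintype.sum_prod_type fun p : Vec × Equiv.Perm (Fin 5) =>
      Nat.card (MulAction.fixedBy (Subgroup (WhittenGroup 5)) (⟨p.1, p.2⟩ : WhittenGroup 5)),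
    ← (SemidirectProduct.equivProd (φ := whittenHom 5)).sum_comp]
  refine Finset.sum_congr rfl fun γ _ => ?_
  rw [← Nat.card_eq_fintype_card]
  rfl

theorem card_eq_sum (l : List RepData) (hl : ∀ ρ ∈ l, ρ.check = true) (h1 : checkSteps l = true)
    (h2 : checkDistinct l = true) (h3 : ∃ ρ ∈ l, ρ.data.gs = []) :
    64 * Nat.card (Subgroup (WhittenGroup 5)) = (l.map fun ρ => ρ.size * ρ.numFree).sum ∧
    7680 * Nat.card (Quot (subgroupConj (G := WhittenGroup 5))) =
      (l.map fun ρ => ρ.size * ρ.numNorm).sum := by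
  simp only [RepData.check, Bool.and_eq_true] at hl
  have hv (ρ) (hρ : ρ ∈ l) := RepData.valid (hl ρ hρ).1.1
  rw [← sum_numGood_false, ← sum_numNormalized,
    sum_subgroups l hv h1 h2 h3 numGood_false_smul, sum_subgroups l hv h1 h2 h3 numNormalized_smul]
  constructor
  · refine congrArg List.sum (List.map_congr_left fun ρ hρ => ?_)
    rw [RepData.numFree_eq (hv ρ hρ) (hl ρ hρ).1.2 (hl ρ hρ).2]
  · refine congrArg List.sum (List.map_congr_left fun ρ hρ => ?_)
    rw [RepData.numNorm_eq (hv ρ hρ) (hl ρ hρ).1.2 (hl ρ hρ).2]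

end

/-! ### The representatives -/

/-- The trivial group. -/
noncomputable def trivialGroup : RepData where
  data := ⟨[], [(1, [])]⟩
  elems := [181896]
  norm := [181896, 153224, 117384, 178312, 83784, 173832, 181448, 50856, 169632, 180888, 181840,
    120968, 146056, 87816, 141128, 84680, 116040, 174280, 177416, 54944, 136872, 51864, 115368,
    170136, 176800, 51024, 83560, 169744, 173664, 180944, 181336, 152776, 109320, 80200, 152216,
    105120, 47272, 153168, 71520, 42792, 117328, 82776, 50408, 178256, 172824, 169184, 88264,
    142024, 80648, 120072, 108872, 144712, 55448, 137880, 47776, 119456, 104616, 144040, 55056,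
    137040, 42848, 87648, 71464, 140904, 51920, 115536, 50520, 84568, 82664, 115816, 170192, 176912,
    169240, 174168, 172768, 177248, 120912, 146000, 86808, 140120, 72416, 103776, 43240, 46376,
    54496, 136424, 43800, 107304, 72024, 78688, 47440, 79976, 105232, 109152, 152272, 152664, 55504,
    137936, 47888, 119568, 104784, 144208, 54552, 136536, 43352, 88152, 72472, 141912, 43744,
    107360, 46432, 80480, 86752, 119904, 71912, 78632, 103720, 108648, 140008, 144488]
  size := 1
  steps := [⟨153224, 0, 181896, [4]⟩, ⟨178312, 0, 146056, [4]⟩, ⟨120968, 2, 181896, [4]⟩, ⟨146056,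
    2, 153224, [4]⟩, ⟨117384, 0, 178312, [4]⟩, ⟨181448, 0, 109320, [4]⟩, ⟨152776, 1, 181896, [4]⟩,
    ⟨174280, 2, 144712, [4]⟩, ⟨88264, 5, 178312, [4]⟩, ⟨142024, 5, 146056, [4]⟩, ⟨84680, 2, 177416,
    [4]⟩, ⟨177416, 2, 116040, [4]⟩, ⟨120072, 5, 117384, [4]⟩, ⟨173832, 0, 142024, [4]⟩, ⟨87816, 2,
    181448, [4]⟩, ⟨109320, 1, 178312, [4]⟩, ⟨80648, 5, 181896, [4]⟩, ⟨144712, 5, 120968, [4]⟩,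
    ⟨116040, 2, 120072, [4]⟩, ⟨141128, 2, 152776, [4]⟩, ⟨83784, 0, 174280, [4]⟩, ⟨108872, 5, 153224,
    [4]⟩, ⟨80200, 1, 146056, [4]⟩, ⟨181840, 0, 72472, [4]⟩, ⟨153168, 1, 181336, [4]⟩, ⟨178256, 1,
    144488, [4]⟩, ⟨120912, 8, 72472, [4]⟩, ⟨146000, 8, 72024, [4]⟩, ⟨117328, 1, 177248, [4]⟩,
    ⟨180944, 2, 107360, [4]⟩, ⟨152272, 8, 181896, [4]⟩, ⟨170192, 5, 140904, [4]⟩, ⟨55504, 6, 181896,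
    [4]⟩, ⟨137936, 6, 153224, [4]⟩, ⟨51920, 5, 173664, [4]⟩, ⟨176912, 5, 108648, [4]⟩, ⟨119568, 6,
    120968, [4]⟩, ⟨169744, 2, 140120, [4]⟩, ⟨55056, 5, 174168, [4]⟩, ⟨105232, 8, 178312, [4]⟩,
    ⟨47888, 6, 178312, [4]⟩, ⟨144208, 6, 117384, [4]⟩, ⟨115536, 5, 109152, [4]⟩, ⟨137040, 5, 141912,
    [4]⟩, ⟨51024, 2, 172824, [4]⟩, ⟨104784, 6, 146056, [4]⟩, ⟨47440, 8, 146056, [4]⟩, ⟨181336, 2,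
    78688, [4]⟩, ⟨152664, 8, 181448, [4]⟩, ⟨174168, 5, 79976, [4]⟩, ⟨88152, 6, 88264, [4]⟩, ⟨141912,
    6, 84680, [4]⟩, ⟨84568, 5, 80480, [4]⟩, ⟨180888, 0, 105232, [4]⟩, ⟨152216, 1, 181840, [4]⟩,
    ⟨170136, 2, 144208, [4]⟩, ⟨55448, 5, 178256, [4]⟩, ⟨137880, 5, 146000, [4]⟩, ⟨51864, 2, 176912,
    [4]⟩, ⟨172824, 1, 140904, [4]⟩, ⟨86808, 8, 105232, [4]⟩, ⟨169240, 5, 144488, [4]⟩, ⟨54552, 6,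
    181448, [4]⟩, ⟨72472, 6, 142024, [4]⟩, ⟨43800, 8, 142024, [4]⟩, ⟨140120, 8, 104784, [4]⟩,
    ⟨82776, 1, 173664, [4]⟩, ⟨136536, 6, 152776, [4]⟩, ⟨50520, 5, 177248, [4]⟩, ⟨72024, 8, 174280,
    [4]⟩, ⟨43352, 6, 174280, [4]⟩, ⟨177248, 5, 83560, [4]⟩, ⟨119904, 6, 80648, [4]⟩, ⟨173664, 2,
    82776, [4]⟩, ⟨87648, 5, 84568, [4]⟩, ⟨109152, 8, 177416, [4]⟩, ⟨80480, 6, 87816, [4]⟩, ⟨176800,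
    2, 115536, [4]⟩, ⟨119456, 5, 117328, [4]⟩, ⟨169632, 0, 137936, [4]⟩, ⟨54944, 2, 180944, [4]⟩,
    ⟨105120, 1, 178256, [4]⟩, ⟨47776, 5, 181840, [4]⟩, ⟨172768, 5, 115816, [4]⟩, ⟨86752, 6, 109320,
    [4]⟩, ⟨169184, 1, 108648, [4]⟩, ⟨54496, 8, 109320, [4]⟩, ⟨72416, 8, 137936, [4]⟩, ⟨43744, 6,
    177416, [4]⟩, ⟨107360, 6, 120072, [4]⟩, ⟨78688, 8, 173832, [4]⟩, ⟨103776, 8, 137040, [4]⟩,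
    ⟨46432, 6, 173832, [4]⟩, ⟨71520, 1, 174168, [4]⟩, ⟨42848, 5, 181336, [4]⟩, ⟨144488, 6, 80200,
    [4]⟩, ⟨115816, 5, 87648, [4]⟩, ⟨140904, 5, 88152, [4]⟩, ⟨83560, 2, 86808, [4]⟩, ⟨108648, 6,
    83784, [4]⟩, ⟨79976, 8, 144712, [4]⟩, ⟨144040, 5, 120912, [4]⟩, ⟨115368, 2, 119568, [4]⟩,
    ⟨136872, 2, 152272, [4]⟩, ⟨50856, 0, 170192, [4]⟩, ⟨104616, 5, 153168, [4]⟩, ⟨47272, 1, 146000,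
    [4]⟩, ⟨140008, 6, 108872, [4]⟩, ⟨82664, 5, 119904, [4]⟩, ⟨136424, 8, 108872, [4]⟩, ⟨50408, 1,
    109152, [4]⟩, ⟨71912, 6, 144712, [4]⟩, ⟨43240, 8, 170192, [4]⟩, ⟨107304, 8, 141128, [4]⟩,
    ⟨78632, 6, 116040, [4]⟩, ⟨103720, 6, 141128, [4]⟩, ⟨46376, 8, 169744, [4]⟩, ⟨71464, 5, 152664,
    [4]⟩, ⟨42792, 1, 141912, [4]⟩]
  free := ⟨false, 181896, [], 0, [0, 0, 0, 0, 0, 0]⟩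
  classes := [⟨1, [181896], ⟨true, 181896, [], 0, [0, 0, 0, 0, 0, 0]⟩⟩, ⟨10, [181896, 178312,
    146056, 174280, 142024, 109320, 170192, 137936, 105232, 72472], ⟨true, 153224, [], 0, [0, 0, 0,
    0, 0, 0]⟩⟩, ⟨20, [181896, 153224, 181448, 152776, 177416, 120072, 144712, 116040, 180944,
    152272, 176912, 119568, 144208, 115536, 172824, 86808, 140120, 82776, 107360, 78688], ⟨true,
    120968, [], 0, [0, 0, 0, 0, 0, 0]⟩⟩, ⟨15, [181896, 178312, 146056, 181840, 178256, 146000,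
    181336, 174168, 141912, 177248, 173664, 109152, 144488, 140904, 108648], ⟨true, 152776, [], 0,
    [0, 0, 0, 0, 0, 0]⟩⟩, ⟨30, [181896, 153224, 178312, 120968, 146056, 117384, 181840, 153168,
    178256, 120912, 146000, 117328, 181336, 152664, 174168, 88152, 141912, 84568, 177248, 119904,
    173664, 87648, 109152, 80480, 144488, 115816, 140904, 83560, 108648, 79976], ⟨true, 88264, [],
    0, [0, 0, 0, 0, 0, 0]⟩⟩, ⟨20, [181896, 153224, 181448, 152776, 177416, 120072, 144712, 116040,
    180944, 152272, 176912, 119568, 144208, 115536, 172824, 86808, 140120, 82776, 107360, 78688],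
    ⟨true, 120912, [], 0, [0, 0, 0, 0, 0, 0]⟩⟩, ⟨24, [181896, 153224, 178312, 120968, 146056,
    117384, 181448, 152776, 174280, 88264, 142024, 84680, 177416, 120072, 173832, 87816, 109320,
    80648, 144712, 116040, 141128, 83784, 108872, 80200], ⟨true, 55504, [], 0, [0, 0, 0, 0, 0, 0]⟩⟩]
  numFree := 180800
  numNorm := 1205760

/-- The group generated by a transposition. -/
noncomputable def transposition : RepData where
  data := ⟨[153224], [(1, [4]), (4, [1])]⟩
  elems := [181896, 153224]
  norm := [181896, 153224, 181448, 180888, 181840, 152776, 152216, 153168, 180944, 181336, 152272,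
    152664]
  size := 10
  steps := [⟨178312, 1, 181896, [17]⟩, ⟨120968, 1, 181896, [5]⟩, ⟨181448, 2, 181896, [4, 5]⟩,
    ⟨174280, 1, 144712, [5]⟩, ⟨88264, 4, 178312, [5]⟩, ⟨177416, 1, 116040, [5]⟩, ⟨120072, 4, 117384,
    [5]⟩, ⟨173832, 1, 181448, [17]⟩, ⟨87816, 1, 181448, [5]⟩, ⟨109320, 0, 178312, [5]⟩, ⟨80648, 4,
    181896, [5]⟩, ⟨181840, 2, 181336, [4, 5]⟩, ⟨178256, 0, 144488, [5]⟩, ⟨120912, 7, 72472, [5]⟩,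
    ⟨180944, 1, 107360, [5]⟩, ⟨170192, 4, 140904, [5]⟩, ⟨55504, 5, 181896, [5]⟩, ⟨176912, 4, 108648,
    [5]⟩, ⟨119568, 5, 120968, [5]⟩, ⟨169744, 1, 140120, [5]⟩, ⟨55056, 4, 174168, [5]⟩, ⟨105232, 7,
    178312, [5]⟩, ⟨47888, 5, 178312, [5]⟩, ⟨181336, 1, 78688, [5]⟩, ⟨174168, 4, 79976, [5]⟩, ⟨88152,
    5, 88264, [5]⟩, ⟨180888, 2, 181840, [4, 5]⟩, ⟨170136, 1, 144208, [5]⟩, ⟨55448, 4, 178256, [5]⟩,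
    ⟨172824, 0, 140904, [5]⟩, ⟨86808, 7, 105232, [5]⟩, ⟨169240, 4, 144488, [5]⟩, ⟨54552, 5, 181448,
    [5]⟩, ⟨72472, 5, 142024, [5]⟩, ⟨43800, 7, 142024, [5]⟩, ⟨177248, 4, 83560, [5]⟩, ⟨119904, 5,
    80648, [5]⟩, ⟨173664, 1, 82776, [5]⟩, ⟨87648, 4, 84568, [5]⟩, ⟨109152, 7, 177416, [5]⟩, ⟨80480,
    5, 87816, [5]⟩, ⟨176800, 1, 115536, [5]⟩, ⟨119456, 4, 117328, [5]⟩, ⟨169632, 1, 180944, [17]⟩,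
    ⟨54944, 1, 180944, [5]⟩, ⟨105120, 0, 178256, [5]⟩, ⟨47776, 4, 181840, [5]⟩, ⟨172768, 4, 115816,
    [5]⟩, ⟨86752, 5, 109320, [5]⟩, ⟨169184, 0, 108648, [5]⟩, ⟨54496, 7, 109320, [5]⟩, ⟨72416, 7,
    137936, [5]⟩, ⟨43744, 5, 177416, [5]⟩, ⟨107360, 5, 120072, [5]⟩, ⟨78688, 7, 173832, [5]⟩,
    ⟨103776, 7, 137040, [5]⟩, ⟨46432, 5, 173832, [5]⟩, ⟨71520, 0, 174168, [5]⟩, ⟨42848, 4, 181336,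
    [5]⟩]
  free := ⟨false, 181896, [4], 1, [0, 0, 0, 0, 0, 0, 48, 48, 0, 0, 0, 0]⟩
  classes := [⟨1, [181896], ⟨true, 181896, [4], 65, [3072, 3072, 0, 0, 0, 0, 48, 48, 0, 0, 0, 0]⟩⟩,
    ⟨1, [181896], ⟨true, 153224, [4], 65, [3072, 3072, 0, 0, 0, 0, 3120, 3120, 0, 0, 0, 0]⟩⟩, ⟨3,
    [181896, 181840, 181336], ⟨true, 181448, [4], 65, [3072, 3072, 0, 0, 0, 0, 48, 48, 768, 768, 0,
    0]⟩⟩, ⟨3, [181896, 181840, 181336], ⟨true, 152776, [4], 65, [3072, 3072, 0, 0, 0, 0, 3120, 3120,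
    768, 768, 0, 0]⟩⟩, ⟨2, [181896, 181448], ⟨true, 180944, [4], 65, [3072, 3072, 0, 0, 0, 0, 48,
    48, 640, 768, 384, 0]⟩⟩, ⟨2, [181896, 181448], ⟨true, 152272, [4], 65, [3072, 3072, 0, 0, 0, 0,
    3120, 3120, 640, 768, 384, 0]⟩⟩]
  numFree := 294080
  numNorm := 801792

/-- The group generated by a product of two transpositions. -/
noncomputable def doubleTransposition : RepData where
  data := ⟨[152776], [(1, [4]), (4, [1])]⟩
  elems := [181896, 152776]
  norm := [181896, 153224, 181448, 152776, 109320, 80200, 80648, 108872]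
  size := 15
  steps := [⟨153224, 1, 181896, [5, 17]⟩, ⟨178312, 3, 117384, [17]⟩, ⟨120968, 0, 181896, [5]⟩,
    ⟨146056, 0, 153224, [5]⟩, ⟨117384, 3, 120968, [17]⟩, ⟨177416, 0, 116040, [5]⟩, ⟨120072, 3,
    117384, [5]⟩, ⟨173832, 3, 178312, [17]⟩, ⟨87816, 0, 181448, [5]⟩, ⟨109320, 2, 181896, [4, 5]⟩,
    ⟨80648, 3, 181896, [5]⟩, ⟨181840, 6, 181896, [17]⟩, ⟨153168, 0, 107360, [17]⟩, ⟨178256, 4,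
    120968, [17]⟩, ⟨120912, 6, 72472, [5]⟩, ⟨146000, 6, 72024, [5]⟩, ⟨117328, 4, 117384, [17]⟩,
    ⟨180944, 0, 107360, [5]⟩, ⟨152272, 6, 181896, [5]⟩, ⟨170192, 3, 140904, [5]⟩, ⟨55504, 4, 181896,
    [5]⟩, ⟨137936, 4, 153224, [5]⟩, ⟨51920, 3, 173664, [5]⟩, ⟨176912, 3, 108648, [5]⟩, ⟨119568, 4,
    120968, [5]⟩, ⟨169744, 0, 140120, [5]⟩, ⟨55056, 3, 174168, [5]⟩, ⟨105232, 6, 178312, [5]⟩,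
    ⟨47888, 4, 178312, [5]⟩, ⟨144208, 4, 117384, [5]⟩, ⟨115536, 3, 109152, [5]⟩, ⟨137040, 3, 141912,
    [5]⟩, ⟨51024, 0, 172824, [5]⟩, ⟨104784, 4, 146056, [5]⟩, ⟨47440, 6, 146056, [5]⟩, ⟨177248, 3,
    83560, [5]⟩, ⟨119904, 4, 80648, [5]⟩, ⟨173664, 0, 82776, [5]⟩, ⟨87648, 3, 84568, [5]⟩, ⟨109152,
    6, 177416, [5]⟩, ⟨80480, 4, 87816, [5]⟩, ⟨176800, 0, 115536, [5]⟩, ⟨119456, 3, 117328, [5]⟩,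
    ⟨169632, 6, 109320, [17]⟩, ⟨54944, 0, 180944, [5]⟩, ⟨105120, 4, 173832, [17]⟩, ⟨47776, 3,
    181840, [5]⟩, ⟨172768, 3, 115816, [5]⟩, ⟨86752, 4, 109320, [5]⟩, ⟨169184, 0, 180944, [17]⟩,
    ⟨54496, 6, 109320, [5]⟩, ⟨72416, 6, 137936, [5]⟩, ⟨43744, 4, 177416, [5]⟩, ⟨107360, 4, 120072,
    [5]⟩, ⟨78688, 6, 173832, [5]⟩, ⟨103776, 6, 137040, [5]⟩, ⟨46432, 4, 173832, [5]⟩, ⟨71520, 4,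
    177416, [17]⟩, ⟨42848, 3, 181336, [5]⟩]
  free := ⟨false, 181896, [4], 1, [0, 0, 0, 0, 0, 0, 48, 48, 12, 12, 0, 0]⟩
  classes := [⟨1, [181896], ⟨true, 181896, [4], 65, [3072, 3072, 768, 768, 0, 0, 48, 48, 12, 12, 0,
    0]⟩⟩, ⟨2, [181896, 109320], ⟨true, 153224, [4], 65, [3072, 3072, 768, 768, 0, 0, 3120, 3120, 12,
    12, 0, 0]⟩⟩, ⟨1, [181896], ⟨true, 152776, [4], 65, [3072, 3072, 768, 768, 0, 0, 3120, 3120, 780,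
    780, 0, 0]⟩⟩, ⟨2, [181896, 153224], ⟨true, 109320, [4], 65, [3072, 3072, 768, 768, 0, 0, 2608,
    1328, 2572, 1292, 0, 0]⟩⟩, ⟨2, [181896, 153224], ⟨true, 80648, [4], 65, [3072, 3072, 768, 768,
    0, 0, 2352, 1584, 2572, 1292, 0, 0]⟩⟩]
  numFree := 80064
  numNorm := 226816

/-- The group generated by a cycle of length `3`. -/
noncomputable def cyclicThree : RepData where
  data := ⟨[120968], [(1, [4]), (4, [16]), (16, [1])]⟩
  elems := [181896, 120968, 146056]
  norm := [181896, 153224, 117384, 178312, 120968, 146056, 181840, 153168, 117328, 178256, 120912,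
    146000]
  size := 10
  steps := [⟨153224, 4, 181896, [5, 4]⟩, ⟨181448, 2, 178312, [17]⟩, ⟨152776, 10, 153224, [16, 17]⟩,
    ⟨174280, 10, 181896, [4, 5]⟩, ⟨88264, 2, 178312, [5]⟩, ⟨142024, 2, 146056, [5]⟩, ⟨84680, 10,
    153224, [16, 5]⟩, ⟨181840, 5, 72472, [17]⟩, ⟨153168, 6, 181896, [4, 5]⟩, ⟨180944, 3, 181896,
    [17]⟩, ⟨152272, 5, 181896, [5]⟩, ⟨170192, 2, 140904, [5]⟩, ⟨55504, 3, 181896, [5]⟩, ⟨137936, 3,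
    153224, [5]⟩, ⟨51920, 2, 173664, [5]⟩, ⟨181336, 3, 88264, [17]⟩, ⟨152664, 5, 181448, [5]⟩,
    ⟨174168, 2, 79976, [5]⟩, ⟨88152, 3, 88264, [5]⟩, ⟨141912, 3, 84680, [5]⟩, ⟨84568, 2, 80480,
    [5]⟩, ⟨180888, 2, 178256, [17]⟩, ⟨152216, 10, 153168, [16, 17]⟩, ⟨170136, 10, 181840, [4, 5]⟩,
    ⟨55448, 2, 178256, [5]⟩, ⟨137880, 2, 146000, [5]⟩, ⟨51864, 10, 153168, [16, 5]⟩, ⟨172824, 3,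
    181448, [17]⟩, ⟨86808, 5, 105232, [5]⟩, ⟨169240, 2, 144488, [5]⟩, ⟨54552, 3, 181448, [5]⟩,
    ⟨72472, 3, 142024, [5]⟩, ⟨43800, 5, 142024, [5]⟩, ⟨140120, 5, 104784, [5]⟩, ⟨82776, 3, 174280,
    [17]⟩, ⟨136536, 3, 152776, [5]⟩, ⟨50520, 2, 177248, [5]⟩, ⟨72024, 5, 174280, [5]⟩, ⟨43352, 3,
    174280, [5]⟩]
  free := ⟨false, 181896, [4], 1, [0, 0, 0, 0, 0, 0, 56, 56, 56, 4, 2, 1]⟩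
  classes := [⟨1, [181896], ⟨true, 181896, [4], 65, [2560, 3072, 1536, 0, 0, 0, 56, 56, 56, 4, 2,
    1]⟩⟩, ⟨3, [181896, 178312, 146056], ⟨true, 153224, [16], 65, [3072, 1536, 2560, 0, 0, 0, 3640,
    1080, 1080, 260, 130, 65]⟩⟩, ⟨2, [181896, 153224], ⟨true, 120968, [4], 65, [2560, 3072, 1536, 0,
    0, 0, 2616, 3128, 1592, 4, 2, 1]⟩⟩, ⟨1, [181896], ⟨true, 181840, [4], 65, [2560, 3072, 1536, 0,
    0, 0, 56, 56, 56, 388, 386, 1]⟩⟩, ⟨3, [181896, 178312, 146056], ⟨true, 153168, [16], 65, [3072,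
    1536, 2560, 0, 0, 0, 3640, 1080, 1080, 132, 258, 65]⟩⟩, ⟨2, [181896, 153224], ⟨true, 120912,
    [4], 65, [2560, 3072, 1536, 0, 0, 0, 2616, 3128, 1592, 388, 386, 1]⟩⟩]
  numFree := 21440
  numNorm := 72192

/-- The Klein four-group generated by two transpositions. -/
noncomputable def kleinOdd : RepData where
  data := ⟨[153224, 181448], [(1, [4, 5]), (4, [1, 17]), (5, [17, 1]), (17, [5, 4])]⟩
  elems := [181896, 153224, 181448, 152776]
  norm := [181896, 153224, 181448, 152776, 109320, 80200, 80648, 108872]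
  size := 15
  steps := [⟨178312, 3, 181896, [4, 18]⟩, ⟨120968, 3, 181896, [4, 6]⟩, ⟨177416, 3, 80200, [5, 6]⟩,
    ⟨120072, 1, 117384, [6]⟩, ⟨109320, 0, 181896, [17, 6]⟩, ⟨181840, 3, 107360, [5, 22]⟩, ⟨178256,
    4, 72472, [18]⟩, ⟨120912, 4, 72472, [6]⟩, ⟨180944, 3, 107360, [5, 6]⟩, ⟨170192, 1, 140904, [6]⟩,
    ⟨55504, 2, 181896, [6]⟩, ⟨176912, 1, 108648, [6]⟩, ⟨119568, 2, 120968, [6]⟩, ⟨169744, 1, 174168,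
    [18]⟩, ⟨55056, 1, 174168, [6]⟩, ⟨105232, 4, 178312, [6]⟩, ⟨47888, 2, 178312, [6]⟩, ⟨177248, 1,
    83560, [6]⟩, ⟨119904, 2, 80648, [6]⟩, ⟨109152, 4, 177416, [6]⟩, ⟨176800, 1, 117328, [18]⟩,
    ⟨119456, 1, 117328, [6]⟩, ⟨169632, 3, 180944, [4, 18]⟩, ⟨54944, 3, 180944, [4, 6]⟩, ⟨105120, 1,
    181840, [18]⟩, ⟨47776, 1, 181840, [6]⟩, ⟨107360, 2, 120072, [6]⟩, ⟨103776, 4, 137040, [6]⟩,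
    ⟨46432, 2, 173832, [6]⟩]
  free := ⟨false, 181896, [4, 5], 17043521, [0, 0, 0, 0, 0, 0, 12585984, 12585984, 201375744,
    201375744, 0, 0, 12582960, 12582960, 3146496, 3146496, 0, 0]⟩
  classes := [⟨1, [181896], ⟨true, 181896, [4, 5], 69810262081, [51539607552, 51539607552,
    824633720832, 824633720832, 0, 0, 12585984, 12585984, 201375744, 201375744, 0, 0, 12582960,
    12582960, 3146496, 3146496, 0, 0]⟩⟩, ⟨2, [181896, 109320], ⟨true, 153224, [4, 5], 69810262081,
    [51539607552, 51539607552, 824633720832, 824633720832, 0, 0, 3298547469312, 3298547469312,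
    201375744, 201375744, 0, 0, 51552190512, 51552190512, 3146496, 3146496, 0, 0]⟩⟩, ⟨1, [181896],
    ⟨true, 152776, [4, 5], 69810262081, [51539607552, 51539607552, 824633720832, 824633720832, 0, 0,
    3298547469312, 3298547469312, 824835096576, 824835096576, 0, 0, 51552190512, 51552190512,
    12888048384, 12888048384, 0, 0]⟩⟩, ⟨2, [181896, 153224], ⟨true, 109320, [5, 4], 69810262081,
    [3298534883328, 3298534883328, 12884901888, 12884901888, 0, 0, 584128138240, 292070362112,
    2207814565888, 1104007970816, 139586437120, 69793218560, 2207625773104, 1103819178032,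
    584118698752, 292060922624, 139586437120, 69793218560]⟩⟩, ⟨2, [181896, 153224], ⟨true, 80648,
    [5, 4], 69810262081, [3298534883328, 3298534883328, 12884901888, 12884901888, 0, 0,
    309250231296, 566948269056, 2207814565888, 1104007970816, 139586437120, 69793218560,
    2203330805808, 1108114145328, 584118698752, 292060922624, 139586437120, 69793218560]⟩⟩]
  numFree := 430912
  numNorm := 1046528

/-- The transitive Klein four-group on four letters. -/
noncomputable def kleinEven : RepData where
  data := ⟨[152776, 109320], [(1, [4, 5]), (4, [1, 17]), (5, [17, 1]), (17, [5, 4])]⟩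
  elems := [181896, 152776, 109320, 80200]
  norm := [181896, 153224, 117384, 178312, 83784, 173832, 181448, 120968, 146056, 87816, 141128,
    84680, 116040, 174280, 177416, 152776, 109320, 80200, 88264, 142024, 80648, 120072, 108872,
    144712]
  size := 5
  steps := [⟨153224, 0, 153224, [22]⟩, ⟨178312, 0, 117384, [18]⟩, ⟨120968, 8, 153224, [26, 24]⟩,
    ⟨146056, 8, 181896, [26, 22]⟩, ⟨117384, 0, 120968, [18]⟩, ⟨181840, 3, 181896, [18]⟩, ⟨153168, 4,
    107360, [18, 4]⟩, ⟨178256, 1, 120968, [18]⟩, ⟨120912, 3, 72472, [6]⟩, ⟨146000, 3, 72024, [6]⟩,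
    ⟨117328, 1, 117384, [18]⟩, ⟨180944, 4, 107360, [6, 4]⟩, ⟨152272, 3, 181896, [6]⟩, ⟨170192, 0,
    140904, [6]⟩, ⟨55504, 1, 181896, [6]⟩, ⟨137936, 1, 153224, [6]⟩, ⟨51920, 0, 173664, [6]⟩,
    ⟨176912, 0, 108648, [6]⟩, ⟨119568, 1, 120968, [6]⟩, ⟨169744, 4, 140120, [6, 5]⟩, ⟨55056, 0,
    174168, [6]⟩, ⟨105232, 3, 178312, [6]⟩, ⟨47888, 1, 178312, [6]⟩, ⟨144208, 1, 117384, [6]⟩,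
    ⟨115536, 0, 109152, [6]⟩, ⟨137040, 0, 141912, [6]⟩, ⟨51024, 4, 172824, [6, 17]⟩, ⟨104784, 1,
    146056, [6]⟩, ⟨47440, 3, 146056, [6]⟩]
  free := ⟨false, 181896, [4, 5], 17043521, [0, 0, 0, 0, 0, 0, 683838464, 348212224, 674398976,
    338772736, 0, 0, 9439792, 6292784, 6294028, 9438476, 0, 0]⟩
  classes := [⟨1, [181896], ⟨true, 181896, [4, 5], 69810262081, [2800318676992, 1425929142272,
    2761663971328, 1387274436608, 0, 0, 683838464, 348212224, 674398976, 338772736, 0, 0, 9439792,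
    6292784, 6294028, 9438476, 0, 0]⟩⟩, ⟨6, [181896, 178312, 146056, 174280, 142024, 109320], ⟨true,
    153224, [4, 17], 69810262081, [2525440770048, 1700807049216, 1662152343552, 2486786064384, 0, 0,
    3299218721792, 3298883095552, 674398976, 338772736, 0, 0, 601304861232, 326423807280,
    2199029549580, 1099521066252, 137438953472, 68719476736]⟩⟩, ⟨8, [181896, 153224, 181448, 152776,
    177416, 120072, 144712, 116040], ⟨true, 120968, [5, 17], 69810262081, [2516850835456,
    1670742278144, 1692217114624, 2495375998976, 0, 0, 2783822646272, 3316062964736, 1658531775232,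
    4633740032, 2147483648, 1073741824, 558355188272, 309243938096, 2216209418764, 1103816033548,
    139586437120, 69793218560]⟩⟩, ⟨3, [181896, 178312, 146056], ⟨true, 152776, [4, 5], 69810262081,
    [2800318676992, 1425929142272, 2761663971328, 1387274436608, 0, 0, 3299218721792, 3298883095552,
    825308119808, 824972493568, 0, 0, 51549047344, 51545900336, 12891195916, 12894340364, 0, 0]⟩⟩,
    ⟨6, [181896, 153224, 178312, 120968, 146056, 117384], ⟨true, 88264, [17, 5], 69810262081,
    [2787433775104, 1400159338496, 2774548873216, 1413044240384, 0, 0, 2508944739328, 3316062964736,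
    1658531775232, 829267460864, 2147483648, 1073741824, 12894341680, 38660998448, 51545901580,
    25779242252, 0, 0]⟩⟩]
  numFree := 151360
  numNorm := 460800

/-- The group generated by a cycle of length `4`. -/
noncomputable def cyclicFour : RepData where
  data := ⟨[80648], [(1, [4]), (4, [16]), (16, [64]), (64, [1])]⟩
  elems := [181896, 80648, 152776, 108872]
  norm := [181896, 153224, 181448, 152776, 109320, 80200, 80648, 108872]
  size := 15
  steps := [⟨153224, 4, 181896, [5, 4]⟩, ⟨178312, 9, 87816, [17, 4]⟩, ⟨120968, 9, 178312, [21, 4]⟩,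
    ⟨146056, 9, 178312, [5, 4]⟩, ⟨117384, 9, 142024, [17, 4]⟩, ⟨181840, 0, 178312, [17]⟩, ⟨153168,
    2, 146056, [17]⟩, ⟨178256, 8, 181896, [4, 17]⟩, ⟨120912, 2, 72472, [5]⟩, ⟨146000, 2, 72024,
    [5]⟩, ⟨117328, 8, 136536, [17, 4]⟩, ⟨180944, 3, 107360, [5, 16]⟩, ⟨152272, 2, 181896, [5]⟩,
    ⟨170192, 8, 153224, [64, 5]⟩, ⟨55504, 0, 181896, [5]⟩, ⟨137936, 0, 153224, [5]⟩, ⟨51920, 8,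
    181896, [4, 5]⟩, ⟨176912, 0, 153224, [17]⟩, ⟨119568, 0, 120968, [5]⟩, ⟨169744, 2, 72024, [17]⟩,
    ⟨55056, 8, 136536, [5, 4]⟩, ⟨105232, 2, 178312, [5]⟩, ⟨47888, 0, 178312, [5]⟩, ⟨144208, 0,
    117384, [5]⟩, ⟨115536, 2, 72024, [65]⟩, ⟨137040, 8, 169240, [5, 64]⟩, ⟨51024, 8, 108648, [17,
    20]⟩, ⟨104784, 0, 146056, [5]⟩, ⟨47440, 2, 146056, [5]⟩]
  free := ⟨false, 181896, [4], 1, [0, 0, 0, 0, 0, 0, 60, 60, 60, 60, 0, 0]⟩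
  classes := [⟨1, [181896], ⟨true, 181896, [4], 65, [2304, 1536, 2560, 1280, 0, 0, 60, 60, 60, 60,
    0, 0]⟩⟩, ⟨2, [181896, 109320], ⟨true, 153224, [64], 65, [2560, 1280, 1536, 2304, 0, 0, 2364,
    1596, 2364, 1596, 0, 0]⟩⟩, ⟨1, [181896], ⟨true, 152776, [4], 65, [2304, 1536, 2560, 1280, 0, 0,
    3132, 3132, 828, 828, 0, 0]⟩⟩, ⟨2, [181896, 153224], ⟨true, 109320, [64], 65, [2560, 1280, 1536,
    2304, 0, 0, 3900, 3900, 828, 828, 0, 0]⟩⟩, ⟨2, [181896, 153224], ⟨true, 80648, [4], 65, [2304,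
    1536, 2560, 1280, 0, 0, 2364, 1596, 2620, 1340, 0, 0]⟩⟩]
  numFree := 28864
  numNorm := 77312

/-- The group generated by a cycle of length `5`. -/
noncomputable def cyclicFive : RepData where
  data := ⟨[55504], [(1, [4]), (4, [16]), (16, [64]), (64, [256]), (256, [1])]⟩
  elems := [181896, 55504, 72472, 107360, 144488]
  norm := [181896, 142024, 104616, 87648, 50520, 176912, 120072, 47776, 137040, 82664, 174168,
    80200, 152216, 42792, 117328, 169184, 55504, 72472, 107360, 144488]
  size := 6
  steps := [⟨153224, 1, 174280, [65]⟩, ⟨178312, 1, 137936, [65]⟩, ⟨120968, 4, 50520, [65, 20]⟩,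
    ⟨146056, 6, 172768, [17, 20]⟩, ⟨117384, 1, 146056, [17]⟩, ⟨181448, 1, 178312, [65]⟩, ⟨152776, 9,
    119904, [65, 16]⟩, ⟨174280, 4, 176912, [65, 20]⟩, ⟨88264, 1, 142024, [17]⟩, ⟨142024, 4, 146056,
    [21, 4]⟩, ⟨84680, 9, 174280, [17, 16]⟩, ⟨177416, 6, 137880, [17, 20]⟩, ⟨120072, 4, 146056, [21,
    4]⟩, ⟨173832, 1, 109320, [17]⟩, ⟨87816, 9, 82776, [17, 16]⟩, ⟨109320, 9, 144488, [4, 17]⟩,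
    ⟨80648, 7, 181336, [17, 20]⟩, ⟨144712, 9, 144488, [4, 69]⟩, ⟨116040, 9, 174280, [69, 16]⟩,
    ⟨141128, 9, 82776, [69, 16]⟩, ⟨83784, 1, 170192, [17]⟩, ⟨108872, 1, 169744, [17]⟩, ⟨80200, 4,
    146056, [5, 4]⟩]
  free := ⟨false, 181896, [4], 1, [0, 0, 0, 0, 0, 0, 62, 62, 62, 62, 62, 1]⟩
  classes := [⟨1, [181896], ⟨true, 181896, [4], 65, [2176, 3072, 1536, 768, 384, 0, 62, 62, 62, 62,
    62, 1]⟩⟩, ⟨5, [181896, 117328, 174168, 87648, 144488], ⟨true, 142024, [16], 65, [2304, 1152,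
    2560, 1280, 640, 0, 3262, 3390, 3646, 318, 318, 65]⟩⟩, ⟨5, [181896, 117328, 174168, 87648,
    144488], ⟨true, 120072, [64], 65, [2560, 1280, 640, 2304, 1152, 0, 3006, 1214, 3902, 830, 830,
    1]⟩⟩, ⟨5, [181896, 117328, 174168, 87648, 144488], ⟨true, 80200, [256], 65, [3072, 1536, 768,
    384, 2176, 0, 2750, 4030, 2750, 1854, 1854, 65]⟩⟩, ⟨4, [181896, 142024, 120072, 80200], ⟨true,
    55504, [4], 65, [2176, 3072, 1536, 768, 384, 0, 2238, 3134, 1598, 830, 446, 1]⟩⟩]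
  numFree := 5440
  numNorm := 12800

/-- The symmetric group on three letters. -/
noncomputable def symmetricThree : RepData where
  data := ⟨[153224, 120968], [(1, [4, 5]), (4, [1, 17]), (5, [20, 21]), (17, [21, 20]), (20, [5,
    4]), (21, [17, 1])]⟩
  elems := [181896, 153224, 120968, 178312, 117384, 146056]
  norm := [181896, 153224, 117384, 178312, 120968, 146056, 181840, 153168, 117328, 178256, 120912,
    146000]
  size := 10
  steps := [⟨181448, 2, 178312, [20, 22]⟩, ⟨174280, 5, 181896, [5, 6]⟩, ⟨88264, 7, 181896, [5, 6]⟩,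
    ⟨181840, 1, 181896, [5, 18]⟩, ⟨180944, 0, 181896, [18]⟩, ⟨170192, 0, 181896, [22]⟩, ⟨55504, 0,
    178312, [73]⟩, ⟨181336, 0, 181448, [18]⟩, ⟨174168, 0, 181448, [22]⟩, ⟨88152, 0, 177416, [73]⟩,
    ⟨180888, 2, 178256, [20, 22]⟩, ⟨170136, 5, 181840, [5, 6]⟩, ⟨55448, 7, 181840, [5, 6]⟩, ⟨172824,
    0, 105232, [18]⟩, ⟨86808, 0, 105232, [6]⟩, ⟨169240, 2, 144488, [17, 6]⟩, ⟨54552, 2, 144488, [17,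
    18]⟩, ⟨72472, 0, 142024, [18]⟩, ⟨43800, 0, 142024, [6]⟩]
  free := ⟨false, 181896, [4, 5], 69810262081, [0, 0, 0, 0, 0, 0, 3908420472320, 3883053155328,
    3883053155328, 279172890880, 139586445440, 69793222720, 43633543728, 52357595184, 26172623360,
    0, 0, 0]⟩
  classes := [⟨1, [181896], ⟨true, 181896, [4, 5], 285942833483841, [11470105300959232,
    13721905114644480, 6755399441055744, 0, 0, 0, 3908420472320, 3883053155328, 3883053155328,
    279172890880, 139586445440, 69793222720, 43633543728, 52357595184, 26172623360, 0, 0, 0]⟩⟩, ⟨3,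
    [181896, 178312, 146056], ⟨true, 153224, [4, 21], 285942833483841, [13721905114644480,
    6966505673588736, 11258999068426240, 0, 0, 0, 15766507116269056, 4507482680525824,
    4507482680525824, 1126179079733504, 563089539866752, 281544769933376, 211149866076720,
    211158590128176, 26172623360, 0, 0, 0]⟩⟩, ⟨2, [181896, 153224], ⟨true, 120968, [20, 5],
    285942833483841, [11434920928870400, 13510798882111488, 6931321301499904, 0, 0, 0,
    11333276233076224, 13655419423622144, 6794466866299904, 17871358935296, 8935679467648,
    4467839733824, 175965493987888, 211158590128176, 105579288889856, 0, 0, 0]⟩⟩, ⟨1, [181896],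
    ⟨true, 181840, [4, 5], 285942833483841, [11470105300959232, 13721905114644480, 6755399441055744,
    0, 0, 0, 3908420472320, 3883053155328, 3883053155328, 1689129033154816, 1688989446709376,
    69793222720, 43633543728, 52357595184, 26172623360, 26388279066624, 26388279066624, 0]⟩⟩, ⟨3,
    [181896, 178312, 146056], ⟨true, 153168, [4, 21], 285942833483841, [13721905114644480,
    6966505673588736, 11258999068426240, 0, 0, 0, 15766507116269056, 4507482680525824,
    4507482680525824, 563229126312192, 1126039493288064, 281544769933376, 211149866076720,
    211158590128176, 26172623360, 26388279066624, 26388279066624, 0]⟩⟩, ⟨2, [181896, 153224], ⟨true,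
    120912, [20, 5], 285942833483841, [11434920928870400, 13510798882111488, 6931321301499904, 0, 0,
    0, 11333276233076224, 13655419423622144, 6794466866299904, 1706721219199232, 1697785539731584,
    4467839733824, 175965493987888, 211158590128176, 105579288889856, 26388279066624,
    26388279066624, 0]⟩⟩]
  numFree := 98240
  numNorm := 305664

/-- The cyclic group of order `6`. -/
noncomputable def cyclicSix : RepData where
  data := ⟨[152272], [(1, [4]), (4, [16]), (16, [64]), (64, [256]), (256, [1024]), (1024, [1])]⟩
  elems := [181896, 152272, 181336, 153224, 180944, 152664]
  norm := [181896, 153224, 181448, 180888, 181840, 152776, 152216, 153168, 180944, 181336, 152272,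
    152664]
  size := 10
  steps := [⟨178312, 8, 71520, [4, 17]⟩, ⟨120968, 5, 86752, [20, 17]⟩, ⟨181448, 3, 107360, [5, 4]⟩,
    ⟨174280, 4, 140904, [21, 16]⟩, ⟨88264, 5, 178256, [80, 65]⟩, ⟨177416, 4, 140904, [5, 16]⟩,
    ⟨120072, 0, 115536, [17, 21]⟩, ⟨173832, 8, 46432, [4, 17]⟩, ⟨87816, 5, 54944, [20, 17]⟩,
    ⟨109320, 3, 180944, [64, 81]⟩, ⟨80648, 0, 78688, [16, 21]⟩, ⟨177248, 6, 42792, [16, 5]⟩,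
    ⟨119904, 8, 71520, [4, 65]⟩, ⟨173664, 4, 136424, [5, 16]⟩, ⟨87648, 0, 83784, [17, 21]⟩, ⟨109152,
    3, 180944, [64, 69]⟩, ⟨80480, 1, 153224, [64, 17]⟩, ⟨107360, 8, 107360, [4, 21]⟩, ⟨78688, 4,
    144040, [21, 16]⟩]
  free := ⟨false, 181896, [4], 1, [0, 0, 0, 0, 0, 0, 48, 48, 0, 0, 0, 0]⟩
  classes := [⟨1, [181896], ⟨true, 181896, [4], 65, [3072, 3072, 640, 768, 384, 0, 48, 48, 0, 0, 0,
    0]⟩⟩, ⟨1, [181896], ⟨true, 153224, [4], 65, [3072, 3072, 640, 768, 384, 0, 3120, 3120, 0, 0, 0,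
    0]⟩⟩, ⟨3, [181896, 181840, 181336], ⟨true, 181448, [1024], 65, [3072, 3072, 768, 384, 640, 0,
    48, 48, 0, 640, 640, 0]⟩⟩, ⟨3, [181896, 181840, 181336], ⟨true, 152776, [1024], 65, [3072, 3072,
    768, 384, 640, 0, 3120, 3120, 0, 640, 640, 0]⟩⟩, ⟨2, [181896, 181448], ⟨true, 180944, [4], 65,
    [3072, 3072, 640, 768, 384, 0, 48, 48, 640, 768, 384, 0]⟩⟩, ⟨2, [181896, 181448], ⟨true, 152272,
    [4], 65, [3072, 3072, 640, 768, 384, 0, 3120, 3120, 640, 768, 384, 0]⟩⟩]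
  numFree := 29120
  numNorm := 109056

/-- The symmetric group on three letters, with even permutations. -/
noncomputable def twistedSymmetricThree : RepData where
  data := ⟨[120968, 153168], [(1, [4, 5]), (4, [16, 17]), (5, [20, 1]), (16, [1, 20]), (17, [5, 4]),
    (20, [17, 16])]⟩
  elems := [181896, 120968, 153168, 146056, 117328, 178256]
  norm := [181896, 153224, 117384, 178312, 120968, 146056, 181840, 153168, 117328, 178256, 120912,
    146000]
  size := 10
  steps := [⟨153224, 2, 181896, [6, 70]⟩, ⟨181448, 5, 181896, [4, 18]⟩, ⟨152776, 3, 153224, [16,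
    18]⟩, ⟨174280, 3, 181896, [4, 6]⟩, ⟨88264, 5, 181896, [4, 6]⟩, ⟨142024, 5, 153224, [16, 6]⟩,
    ⟨84680, 3, 153224, [16, 6]⟩, ⟨181336, 1, 42848, [17, 18]⟩, ⟨152664, 0, 80480, [22, 18]⟩,
    ⟨174168, 4, 136872, [6, 22]⟩, ⟨88152, 1, 42848, [17, 6]⟩, ⟨141912, 1, 42792, [20, 6]⟩, ⟨84568,
    4, 88264, [22, 18]⟩, ⟨172824, 1, 180888, [5, 18]⟩, ⟨86808, 3, 117384, [16, 26]⟩, ⟨169240, 5,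
    54496, [102, 73]⟩, ⟨54552, 1, 180888, [5, 6]⟩, ⟨72472, 1, 177248, [17, 6]⟩, ⟨43800, 3, 146000,
    [4, 26]⟩]
  free := ⟨false, 181896, [4, 5], 69810262081, [0, 0, 0, 0, 0, 0, 2801134633008, 26587889712,
    2791735132160, 412417523718, 412417523718, 0, 3908420472320, 1116697923072, 1116697923072,
    139588026624, 279174455424, 69793222720]⟩
  classes := [⟨1, [181896], ⟨true, 181896, [4, 5], 285942833483841, [13686720742555648,
    13721905114644480, 105553116266496, 1688849860263936, 1688849860263936, 0, 2801134633008,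
    26587889712, 2791735132160, 412417523718, 412417523718, 0, 3908420472320, 1116697923072,
    1116697923072, 139588026624, 279174455424, 69793222720]⟩⟩, ⟨3, [181896, 178312, 146056], ⟨true,
    153224, [16, 5], 285942833483841, [13721905114644480, 13616351998377984, 175921860444160,
    1688849860263936, 1688849860263936, 0, 13513600016744496, 13510825470001200, 2791735132160,
    412417523718, 412417523718, 0, 250199025094144, 71485442100736, 71485442100736, 17731774071040,
    9075267477632, 4467839733824]⟩⟩, ⟨2, [181896, 153224], ⟨true, 120968, [4, 17], 285942833483841,
    [11434920928870400, 211106232532992, 11364552184692736, 1688849860263936, 1688849860263936, 0,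
    11261800203059248, 13510825470001200, 6758191176187904, 412417523718, 412417523718, 0,
    4683429908286976, 9219422185197056, 2358469627874816, 563089541447936, 1126179081298048,
    281544769933376]⟩⟩, ⟨1, [181896], ⟨true, 181840, [4, 5], 285942833483841, [13686720742555648,
    13721905114644480, 105553116266496, 1688849860263936, 1688849860263936, 0, 2801134633008,
    26587889712, 2791735132160, 1689262277787654, 1689262277787654, 0, 3908420472320, 1116697923072,
    1116697923072, 26527867093248, 26667453522048, 69793222720]⟩⟩, ⟨3, [181896, 178312, 146056],
    ⟨true, 153168, [16, 5], 285942833483841, [13721905114644480, 13616351998377984, 175921860444160,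
    1688849860263936, 1688849860263936, 0, 13513600016744496, 13510825470001200, 2791735132160,
    1689262277787654, 1689262277787654, 0, 250199025094144, 71485442100736, 71485442100736,
    8935681048832, 17871360499840, 4467839733824]⟩⟩, ⟨2, [181896, 153224], ⟨true, 120912, [4, 17],
    285942833483841, [11434920928870400, 211106232532992, 11364552184692736, 1688849860263936,
    1688849860263936, 0, 11261800203059248, 13510825470001200, 6758191176187904, 1689262277787654,
    1689262277787654, 0, 4683429908286976, 9219422185197056, 2358469627874816, 589477820514560,
    1152567360364672, 281544769933376]⟩⟩]
  numFree := 29120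
  numNorm := 109056

/-- The dihedral group of order `8`. -/
noncomputable def dihedralFour : RepData where
  data := ⟨[153224, 80648], [(1, [4, 5]), (4, [1, 17]), (5, [20, 21]), (17, [68, 69]), (20, [5, 4]),
    (21, [69, 68]), (68, [17, 1]), (69, [21, 20])]⟩
  elems := [181896, 153224, 80648, 109320, 80200, 152776, 108872, 181448]
  norm := [181896, 153224, 181448, 152776, 109320, 80200, 80648, 108872]
  size := 15
  steps := [⟨178312, 4, 87816, [22, 5]⟩, ⟨120968, 4, 178312, [26, 5]⟩, ⟨181840, 0, 117384, [20,
    22]⟩, ⟨178256, 1, 181896, [4, 18]⟩, ⟨120912, 1, 181896, [4, 6]⟩, ⟨180944, 1, 107360, [69, 18]⟩,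
    ⟨170192, 0, 146056, [20, 18]⟩, ⟨55504, 0, 146056, [20, 6]⟩, ⟨176912, 0, 181896, [21, 18]⟩,
    ⟨119568, 0, 181896, [21, 6]⟩, ⟨169744, 3, 136536, [18, 5]⟩, ⟨55056, 3, 136536, [6, 5]⟩, ⟨105232,
    6, 140120, [6, 18]⟩, ⟨47888, 6, 140120, [18, 6]⟩]
  free := ⟨false, 181896, [4, 5], 285942833483841, [0, 0, 0, 0, 0, 0, 10346954789912576,
    6967880478441472, 10346954789912576, 6967880478441472, 0, 0, 11260425614281776,
    5632300268227632, 6810925184221184, 10187250716459008, 0, 0]⟩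
  classes := [⟨1, [181896], ⟨true, 181896, [4, 5], 1171221845949812801, [42369865294301626368,
    28534807239019462656, 46116860184273879040, 23058430092136939520, 0, 0, 10346954789912576,
    6967880478441472, 10346954789912576, 6967880478441472, 0, 0, 11260425614281776,
    5632300268227632, 6810925184221184, 10187250716459008, 0, 0]⟩⟩, ⟨2, [181896, 109320], ⟨true,
    153224, [4, 68], 1171221845949812801, [46981551312729014272, 23923121220592074752,
    27670116110564327424, 41505174165846491136, 0, 0, 10346954789912576, 6967880478441472,
    10346954789912576, 6967880478441472, 0, 0, 42381125719915908144, 28540439539287690288,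
    27676927035748548608, 41515361416562950144, 0, 0]⟩⟩, ⟨1, [181896], ⟨true, 152776, [4, 5],
    1171221845949812801, [42369865294301626368, 28534807239019462656, 46116860184273879040,
    23058430092136939520, 0, 0, 55350579175918567424, 55347200101607096320, 13845405010072076288,
    13842025935760605184, 0, 0, 875951554069417008, 870323428723362864, 222983707298004992,
    226360032830242816, 0, 0]⟩⟩, ⟨2, [181896, 153224], ⟨true, 109320, [69, 68], 1171221845949812801,
    [46116860184273879040, 23058430092136939520, 27886288892678111232, 41721346947960274944, 0, 0,
    28328981411695591424, 41944487610552500224, 46847783079443070976, 23425685942805020672, 0, 0,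
    41948780155688340528, 28324266757173906480, 28325445382089900032, 41947706980790517760, 0, 0]⟩⟩,
    ⟨2, [181896, 153224], ⟨true, 80648, [69, 5], 1171221845949812801, [41505174165846491136,
    27670116110564327424, 46333032966387662848, 23274602874250723328, 0, 0, 42164039466977755136,
    28109429555270336512, 46847783079443070976, 23425685942805020672, 0, 0, 371548395803921456,
    726208240647506992, 655329271525572608, 442532814944026624, 0, 0]⟩⟩]
  numFree := 125760
  numNorm := 330240

/-- The dihedral group of order `10`. -/
noncomputable def dihedralFive : RepData where
  data := ⟨[152776, 119568], [(1, [4, 5]), (4, [1, 17]), (5, [20, 21]), (17, [68, 69]), (20, [5,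
    4]), (21, [84, 85]), (68, [17, 1]), (69, [85, 84]), (84, [21, 20]), (85, [69, 68])]⟩
  elems := [181896, 152776, 119568, 178256, 82776, 46432, 141912, 105120, 42792, 71912]
  norm := [181896, 152776, 105120, 42792, 82776, 178256, 80648, 55448, 137040, 115816, 172768,
    108872, 144040, 87648, 51920, 169240, 119568, 141912, 46432, 71912]
  size := 6
  steps := [⟨153224, 0, 153224, [6, 70]⟩, ⟨178312, 5, 71520, [22, 5]⟩, ⟨120968, 1, 153224, [26,
    24]⟩, ⟨146056, 1, 144488, [24, 22]⟩, ⟨117384, 2, 120968, [18, 22]⟩, ⟨177416, 4, 173832, [21,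
    22]⟩, ⟨120072, 0, 115536, [18, 22]⟩, ⟨173832, 2, 170192, [22, 18]⟩, ⟨87816, 1, 152776, [26,
    24]⟩, ⟨109320, 4, 153168, [68, 70]⟩, ⟨80648, 2, 71912, [22, 18]⟩]
  free := ⟨false, 181896, [4, 5], 1171221845949812801, [0, 0, 0, 0, 0, 0, 72598030320391946240,
    30054772672005505024, 30054772672005505024, 60746242578144321536, 60746242578144321536,
    1170935972909547520, 42129136331293625392, 446068727780412464, 11748257003878785804,
    42159375634794627852, 11855165442169528320, 0]⟩
  classes := [⟨1, [181896], ⟨true, 181896, [4, 5], 4797324681010433232961,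
    [192436434176938042458112, 230215366039895204167680, 48109108544234510614528,
    95332773372930962751488, 28334198897217871282176, 0, 72598030320391946240, 30054772672005505024,
    30054772672005505024, 60746242578144321536, 60746242578144321536, 1170935972909547520,
    42129136331293625392, 446068727780412464, 11748257003878785804, 42159375634794627852,
    11855165442169528320, 0]⟩⟩, ⟨5, [181896, 178256, 141912, 87648, 115816], ⟨true, 152776, [4, 68],
    4797324681010433232961, [230215366039895204167680, 97989104519545138184192,
    189780103030323867025408, 29219642612755929759744, 47223664828696452136960, 0,
    72598030320391946240, 30054772672005505024, 30054772672005505024, 60746242578144321536,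
    60746242578144321536, 1170935972909547520, 173589097381790755228720, 3542220930880014322736,
    48120856801238389400332, 170932796474480080798476, 47235519994138621665280, 0]⟩⟩, ⟨5, [181896,
    178256, 141912, 87648, 115816], ⟨true, 80648, [4, 21], 4797324681010433232961,
    [164102235279720171175936, 116878570451023719038976, 57553841509973801041920,
    170890637098845286170624, 85002596691653613846528, 0, 207856723276584781348864,
    264482577813372137472000, 198369447053197104480256, 18950212174056725176320,
    18950212174056725176320, 4723537418842554761216, 2698460282945469058096, 1771333499803897367600,
    2963227308797407044364, 1517898901531558757132, 11855165442169528320, 0]⟩⟩, ⟨5, [181896, 178256,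
    141912, 87648, 115816], ⟨true, 108872, [4, 85], 4797324681010433232961,
    [173546968245459461603328, 88544371553805847756800, 114222239304409543606272,
    57553841509973801041920, 160560460417567937265664, 0, 160633058447888329211904,
    283372043744850718326784, 141701049258761361915904, 94508075899971048595456,
    94508075899971048595456, 1170935972909547520, 2993608188124821883952, 1476185594624544541744,
    1782635688079995740940, 2698490522248970060556, 11855165442169528320, 0]⟩⟩, ⟨4, [181896, 152776,
    80648, 108872], ⟨true, 119568, [69, 5], 4797324681010433232961, [191846138366579336806400,
    228001756751050057973760, 50175143880489980395520, 94447329657392904273920,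
    29662364470524958998528, 0, 191918736396899728752640, 230245420812567209672704,
    47991589364316839706624, 95983815425867812724736, 28837666997565044842496, 1170935972909547520,
    779998899279675690032, 2951925120521308671024, 454470114772908024588, 3583934237787028538124,
    1487594691338933657600, 0]⟩⟩]
  numFree := 11968
  numNorm := 28160

/-- The stabilizer of a set of two letters. -/
noncomputable def symmetricThreeTwo : RepData where
  data := ⟨[153224, 120912], [(1, [4, 5]), (4, [1, 17]), (5, [20, 21]), (17, [68, 69]), (20, [5,
    4]), (21, [84, 85]), (68, [17, 1]), (69, [276, 277]), (84, [21, 20]), (85, [277, 276]), (276,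
    [69, 68]), (277, [85, 84])]⟩
  elems := [181896, 153224, 120912, 178256, 117328, 146056, 146000, 117384, 178312, 181840, 120968,
    153168]
  norm := [181896, 153224, 117384, 178312, 120968, 146056, 181840, 153168, 117328, 178256, 120912,
    146000]
  size := 10
  steps := [⟨181448, 4, 181840, [5, 22]⟩, ⟨174280, 2, 144712, [6, 18]⟩, ⟨88264, 2, 144712, [18, 6]⟩,
    ⟨181336, 1, 170192, [25, 22]⟩, ⟨174168, 4, 181840, [5, 18]⟩, ⟨88152, 4, 181840, [5, 6]⟩,
    ⟨172824, 4, 173832, [25, 73]⟩, ⟨86808, 0, 117384, [21, 26]⟩, ⟨72472, 4, 176912, [18, 6]⟩]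
  free := ⟨false, 181896, [4, 5], 4797324681010433232961, [0, 0, 0, 0, 0, 0, 0,
    113364472462031160705024, 113364472462031160705024, 28341118115507790176256,
    28341118115507790176256, 0, 192483415731051505552432, 230271577721994316287024,
    113364472462031160705024, 449639413597366935552, 449639413597366935552, 0]⟩
  classes := [⟨1, [181896], ⟨true, 181896, [4, 5], 19649841893418734522208321,
    [788219634388738221908426752, 942962139299410756270817280, 464227514732017603087171584,
    116056878683004400771792896, 116056878683004400771792896, 0, 0, 113364472462031160705024,
    113364472462031160705024, 28341118115507790176256, 28341118115507790176256, 0,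
    192483415731051505552432, 230271577721994316287024, 113364472462031160705024,
    449639413597366935552, 449639413597366935552, 0]⟩⟩, ⟨3, [181896, 178312, 146056], ⟨true, 153224,
    [4, 68], 19649841893418734522208321, [942962139299410756270817280, 478734624567393153183645696,
    773712524553362671811952640, 116056878683004400771792896, 116056878683004400771792896, 0, 0,
    113364472462031160705024, 113364472462031160705024, 28341118115507790176256,
    28341118115507790176256, 0, 788412117804469273413979184, 14737381413097544412761136,
    773825889025824702972657664, 116057328322417998138728448, 116057328322417998138728448, 0]⟩⟩, ⟨2,
    [181896, 153224], ⟨true, 120968, [69, 5], 19649841893418734522208321,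
    [785801782749508963559014400, 928455029464035206174343168, 476316772928163894834233344,
    116056878683004400771792896, 116056878683004400771792896, 0, 785801782749508963559014400,
    943075503771872787431522304, 471594434122167409296113664, 1841729847537451552235520,
    1841729847537451552235520, 0, 7446038333418826553789488, 12319529773868286063348784,
    14620474307837581257179136, 449639413597366935552, 449639413597366935552, 0]⟩⟩, ⟨1, [181896],
    ⟨true, 181840, [4, 5], 19649841893418734522208321, [788219634388738221908426752,
    942962139299410756270817280, 464227514732017603087171584, 116056878683004400771792896,
    116056878683004400771792896, 0, 0, 113364472462031160705024, 113364472462031160705024,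
    116085219801119908561969152, 116085219801119908561969152, 0, 192483415731051505552432,
    230271577721994316287024, 113364472462031160705024, 1813838368835541128994816,
    1813838368835541128994816, 0]⟩⟩, ⟨3, [181896, 178312, 146056], ⟨true, 153168, [4, 68],
    19649841893418734522208321, [942962139299410756270817280, 478734624567393153183645696,
    773712524553362671811952640, 116056878683004400771792896, 116056878683004400771792896, 0, 0,
    113364472462031160705024, 113364472462031160705024, 116085219801119908561969152,
    116085219801119908561969152, 0, 788412117804469273413979184, 14737381413097544412761136,
    773825889025824702972657664, 117870717051839941900787712, 117870717051839941900787712, 0]⟩⟩, ⟨2,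
    [181896, 153224], ⟨true, 120912, [69, 5], 19649841893418734522208321,
    [785801782749508963559014400, 928455029464035206174343168, 476316772928163894834233344,
    116056878683004400771792896, 116056878683004400771792896, 0, 785801782749508963559014400,
    943075503771872787431522304, 471594434122167409296113664, 117898608530541852324028416,
    117898608530541852324028416, 0, 7446038333418826553789488, 12319529773868286063348784,
    14620474307837581257179136, 1813838368835541128994816, 1813838368835541128994816, 0]⟩⟩]
  numFree := 121920
  numNorm := 450048

/-- The alternating group on four letters. -/
noncomputable def alternatingFour : RepData where
  data := ⟨[120968, 174280], [(1, [4, 5]), (4, [16, 17]), (5, [20, 21]), (16, [1, 65]), (17, [21,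
    69]), (20, [80, 16]), (21, [84, 1]), (65, [69, 20]), (69, [276, 4]), (80, [5, 276]), (84, [17,
    80]), (276, [65, 84])]⟩
  elems := [181896, 120968, 174280, 146056, 152776, 109320, 177416, 84680, 87816, 141128, 116040,
    80200]
  norm := [181896, 153224, 117384, 178312, 83784, 173832, 181448, 120968, 146056, 87816, 141128,
    84680, 116040, 174280, 177416, 152776, 109320, 80200, 88264, 142024, 80648, 120072, 108872,
    144712]
  size := 5
  steps := [⟨153224, 1, 153224, [16, 22]⟩, ⟨181840, 1, 144488, [5, 22]⟩, ⟨153168, 2, 172824, [82,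
    25]⟩, ⟨180944, 2, 153224, [66, 24]⟩, ⟨152272, 0, 86752, [18, 24]⟩, ⟨170192, 1, 144488, [5, 6]⟩,
    ⟨55504, 2, 181896, [6, 82]⟩, ⟨137936, 2, 174280, [26, 25]⟩, ⟨51920, 1, 144488, [5, 18]⟩]
  free := ⟨false, 181896, [4, 5], 4797324681010433232961, [0, 0, 0, 0, 0, 0,
    153532837521543819100672, 134348151627064951377152, 134601863037924792123904,
    134601863037924792123904, 9592342947265606320256, 4796171473632803160128,
    76157534025192971471416, 79455685539658190767416, 76157534025192971471416,
    208383798694544003859716, 9594648798933440012290, 4797324399466720006145]⟩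
  classes := [⟨1, [181896], ⟨true, 181896, [4, 5], 19649841893418734522208321,
    [12089258196146291747061760, 401363372112056886002450432, 471481069649705378135408640,
    232113757366008801543585792, 0, 0, 153532837521543819100672, 134348151627064951377152,
    134601863037924792123904, 134601863037924792123904, 9592342947265606320256,
    4796171473632803160128, 76157534025192971471416, 79455685539658190767416,
    76157534025192971471416, 208383798694544003859716, 9594648798933440012290,
    4797324399466720006145]⟩⟩, ⟨6, [181896, 178312, 146056, 174280, 142024, 109320], ⟨true, 153224,
    [16, 65], 19649841893418734522208321, [710848381933401954727231488, 7253554917687775048237056,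
    785801782749508963559014400, 232113757366008801543585792, 0, 0, 928608562301556749993443840,
    928589377615662271125720320, 134601863037924792123904, 134601863037924792123904,
    9592342947265606320256, 4796171473632803160128, 945456148472665207591701048,
    701256431062024579520349496, 391768123089165045576272440, 1417309618309173178565892,
    614057558606248027365378, 307028779303124013682689]⟩⟩, ⟨8, [181896, 153224, 181448, 152776,
    177416, 120072, 144712, 116040], ⟨true, 120968, [4, 69], 19649841893418734522208321,
    [708430530294172696377819136, 942962139299410756270817280, 7253554917687775048237056,
    386856262276681335905976320, 0, 0, 154896037748194078181491200, 1005960630070998538306915584,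
    154877106773710459154514432, 154877106773710459154514432, 38695218570615399196917888,
    19347609285307699598458944, 631135435372861622168095288, 169329070431587742649632056,
    84700964907049235200903736, 309693393620039612728640772, 38695220876467067030609922,
    19347610438233533515304961]⟩⟩, ⟨3, [181896, 178312, 146056], ⟨true, 152776, [80, 84],
    19649841893418734522208321, [788219634388738221908426752, 6044629098073145873530880,
    232113757366008801543585792, 707221604474558067203112960, 0, 0, 314474245937325129242706432,
    79923452246192590481984768, 1015632290339326431545311744, 542942294870006424235196928,
    39299681480422713784270976, 19649840740211356892135488, 635971138651320138866919992,
    314400168785343243614373176, 163281143182000131556805176, 79997487893260069534467332,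
    39299683786274381617963010, 19649841893137190808981505]⟩⟩, ⟨6, [181896, 153224, 178312, 120968,
    146056, 117384], ⟨true, 88264, [69, 4], 19649841893418734522208321,
    [784592856929894334384308224, 942962139299410756270817280, 464227514732017603087171584,
    6044629098073145873530880, 0, 0, 77524785292857811000295936, 625148996892390348274470144,
    316873166602070768565142016, 158503884232554346678632960, 38695218570615399196917888,
    19347609285307699598458944, 629926509553246992993389112, 321653723703031018662610232,
    160863291542770873207392824, 84833191171718586233292036, 38695220876467067030609922,
    19347610438233533515304961]⟩⟩]
  numFree := 11776
  numNorm := 56832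

/-- The Frobenius group of order `20`. -/
noncomputable def frobeniusTwenty : RepData where
  data := ⟨[80648, 51920], [(1, [4, 5]), (4, [16, 17]), (5, [20, 21]), (16, [64, 65]), (17, [68,
    69]), (20, [80, 81]), (21, [84, 85]), (64, [1, 257]), (65, [260, 261]), (68, [21, 20]), (69,
    [276, 277]), (80, [277, 276]), (81, [261, 260]), (84, [17, 16]), (85, [257, 1]), (257, [81,
    80]), (260, [69, 68]), (261, [85, 84]), (276, [65, 64]), (277, [5, 4])]⟩
  elems := [181896, 80648, 51920, 152776, 119568, 46432, 82776, 108872, 137040, 172768, 169240,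
    55448, 87648, 144040, 115816, 178256, 105120, 141912, 71912, 42792]
  norm := [181896, 152776, 105120, 42792, 82776, 178256, 80648, 55448, 137040, 115816, 172768,
    108872, 144040, 87648, 51920, 169240, 119568, 141912, 46432, 71912]
  size := 6
  steps := [⟨153224, 1, 144488, [22, 20]⟩, ⟨178312, 0, 87816, [18, 4]⟩, ⟨120968, 0, 178312, [26,
    4]⟩, ⟨146056, 0, 178312, [6, 4]⟩, ⟨117384, 0, 142024, [18, 4]⟩]
  free := ⟨false, 181896, [4, 5], 1350326852860866918505454791395905601, [0, 0, 0, 0, 0, 0,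
    62280558849812385825512196186956287104, 503735213466957932611309174535718912,
    62100662569402423873906101046991301376, 62148591029073980665769254086434111744,
    62148591029073980665769254086434111744, 329669641811733916589772872093760,
    12527780632550391256009147860281788, 501097561402871375851778930049683004,
    501097561402871375851778930049683004, 133845374173409900296692303308317756,
    125933642589277471259874981820588544, 329669641811733916589772872093760]⟩
  classes := [⟨1, [181896], ⟨true, 181896, [4, 5], 5530938789318110898198342825557629341761,
    [188176148907278970295246157909767820935168, 2041694201525630780780247644590609268736,
    221183538498610001251193494830649337446400, 67035626283424877302284797664058337656832,
    32667107224410092492483962313449748299776, 0, 62280558849812385825512196186956287104,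
    503735213466957932611309174535718912, 62100662569402423873906101046991301376,
    62148591029073980665769254086434111744, 62148591029073980665769254086434111744,
    329669641811733916589772872093760, 12527780632550391256009147860281788,
    501097561402871375851778930049683004, 501097561402871375851778930049683004,
    133845374173409900296692303308317756, 125933642589277471259874981820588544,
    329669641811733916589772872093760]⟩⟩, ⟨5, [181896, 178256, 141912, 87648, 115816], ⟨true,
    152776, [4, 69], 5530938789318110898198342825557629341761,
    [3062541302288446171170371466885913903104, 100043015874755908258232134584939854168064,
    68737038118029569619601670701217178714112, 110591769249305000625596747415324668723200,
    54445178707350154154139937189082913832960, 0, 272288174095600583156525198141601525451904,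
    174225075598733960251180410314239859984384, 239620886974910080702089629733011812166400,
    21840220073969135642321744129719599644928, 21840220073969135642321744129719599644928,
    5444518200404657227147910308681163477056, 25861472413771955773607726173962244352444,
    91196175432372911079560246570643930353212, 11910383939794249092593963039041937083964,
    175245552809657482093538219519663937217596, 43556268899522712600783209626248151654912,
    5444518200404657227147910308681163477056]⟩⟩, ⟨5, [181896, 178256, 141912, 87648, 115816], ⟨true,
    80648, [4, 81], 5530938789318110898198342825557629341761,
    [199065184648749001126074145347584403701760, 263378551996806370720651946152188595666944,
    3402823669209384634633746074317682114560, 34368519059014784809800835350608589357056,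
    98001321673230277477451886940349244899328, 0, 239621066871190490664041235828151777152128,
    304893504496374330221116259568038853183488, 228731851233440049871261642295195229399808,
    21840220073969135642321744129719599644928, 21840220073969135642321744129719599644928,
    5444518200404657227147910308681163477056, 13951589571539109552389614913850356951484,
    89154481230847280298779998926053321084476, 177627896630291280799257396858313056063036,
    45257688645858989050529119480728480441404, 21778197416582650939127234750614986121728,
    5444518200404657227147910308681163477056]⟩⟩, ⟨5, [181896, 178256, 141912, 87648, 115816], ⟨true,
    108872, [4, 84], 5530938789318110898198342825557629341761,
    [264399399097569186111042069974483900301312, 132710123099166000750716096898389602467840,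
    57848002376559538788773683263400595947520, 1701411834604692317316873037158841057280,
    185113607604990524124075786442881907032064, 0, 76285530749140028201621424260903035653248,
    21778575218153528619588586184807701252096, 283177029940790204025401579484278143232768,
    87174434522789320627289668756619096244480, 87174434522789320627289668756619096244480,
    5444518200404657227147910308681163477056, 177627408060510510478272801088530866661820,
    88814198863926341835316624318621552873020, 45598338264967156975468049174786990018108,
    24840746630602681242726643034822387754044, 10889161675112620108299247312798403355136,
    5444518200404657227147910308681163477056]⟩⟩, ⟨4, [181896, 152776, 80648, 108872], ⟨true, 119568,
    [80, 69], 5530938789318110898198342825557629341761, [2892400118827976939438684163170029797376,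
    102084710076281539039012382229530463436800, 67375908650345815765748172271490105868288,
    108890357414700308308279874378165827665920, 55295884624652500312798373707662334361600, 0,
    230093160597404213687066746820062267231360, 176947334534101467958887407173694005676032,
    229072133600360988334725016902626997611264, 153189213705451382539184342598382129266944,
    11121325515959574043225443995618900984064, 5529588792134891843013753960539105529920,
    25521190046851017310144351566530476140988, 91876740166214788006486995785507466776124,
    14462501691701287568569272594780198669884, 174564988075815605166611470304800400794684,
    43896551266443651064246584233679919866368, 5529588792134891843013753960539105529920]⟩⟩]
  numFree := 11968
  numNorm := 28160

/-- The symmetric group on four letters. -/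
noncomputable def symmetricFour : RepData where
  data := ⟨[120968, 88264], [(1, [4, 5]), (4, [16, 17]), (5, [20, 21]), (16, [1, 65]), (17, [68,
    69]), (20, [80, 81]), (21, [84, 85]), (65, [260, 261]), (68, [272, 273]), (69, [81, 80]), (80,
    [5, 4]), (81, [324, 325]), (84, [336, 337]), (85, [65, 1]), (260, [85, 84]), (261, [273, 272]),
    (272, [17, 16]), (273, [1092, 1093]), (324, [69, 68]), (325, [337, 336]), (336, [21, 20]), (337,
    [1093, 1092]), (1092, [261, 260]), (1093, [325, 324])]⟩
  elems := [181896, 120968, 88264, 146056, 142024, 80648, 109320, 181448, 173832, 177416, 83784,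
    116040, 141128, 144712, 120072, 87816, 108872, 80200, 152776, 153224, 174280, 178312, 84680,
    117384]
  norm := [181896, 153224, 117384, 178312, 83784, 173832, 181448, 120968, 146056, 87816, 141128,
    84680, 116040, 174280, 177416, 152776, 109320, 80200, 88264, 142024, 80648, 120072, 108872,
    144712]
  size := 5
  steps := [⟨181840, 1, 181896, [18, 22]⟩, ⟨180944, 1, 181896, [22, 18]⟩, ⟨170192, 1, 71520, [18,
    22]⟩, ⟨55504, 1, 72024, [22, 18]⟩]
  free := ⟨false, 181896, [4, 5], 22654725281046982239020412213484049783853121, [0, 0, 0, 0, 0, 0,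
    331856307583737290043752698635017729068800, 331856307583737290043752698635017729068800,
    906188973183437279161351108338111975323174400, 906188973183437279161351108338111975323174400, 0,
    0, 454598607693187549174403767391961659706936632, 454598607693187549174403767391961659706936632,
    1355101041240577689564030321913368414674601016, 1355101041223439405023666422589343625523628804,
    659339244333381037004159934013570, 329669622166690518502079967006785]⟩
  classes := [⟨1, [181896], ⟨true, 181896, [4, 5], 92793754751168439251027608426430667914662383681,
    [3345468591702769961200622312389616599681158086656,
    4453012801242594828901852224682424825514169466880,
    2226506400621297414450926112341212412757084733440,
    1096126227998177188652763624537212264741949407232, 0, 0,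
    331856307583737290043752698635017729068800, 331856307583737290043752698635017729068800,
    906188973183437279161351108338111975323174400, 906188973183437279161351108338111975323174400, 0,
    0, 454598607693187549174403767391961659706936632, 454598607693187549174403767391961659706936632,
    1355101041240577689564030321913368414674601016, 1355101041223439405023666422589343625523628804,
    659339244333381037004159934013570, 329669622166690518502079967006785]⟩⟩, ⟨6, [181896, 178312,
    146056, 174280, 142024, 109320], ⟨true, 153224, [16, 17],
    92793754751168439251027608426430667914662383681,
    [4453012801242594828901852224682424825514169466880,
    1861130991288571684900004904162141657843101597696,
    3710844001035495690751543520568687354595141222400,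
    1096126227998177188652763624537212264741949407232, 0, 0,
    4384505243849016338348344541901547693985526697728,
    4384505243849016338348344541901547693985526697728,
    906188973183437279161351108338111975323174400, 906188973183437279161351108338111975323174400, 0,
    0, 445755878731952670439359626235634444211123883320,
    2946293836352794382053476644711149923153695968568,
    1485692701455438853990181438549388310252731089976,
    737814910477498738031099226658528833999020886788,
    185542200051775443876821509409471371889691074690,
    92771100025887721938410754704735685944845537345]⟩⟩, ⟨8, [181896, 153224, 181448, 152776, 177416,
    120072, 144712, 116040], ⟨true, 120968, [4, 260],
    92793754751168439251027608426430667914662383681,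
    [3710844001035495690751543520568687354595141222400,
    4453012801242594828901852224682424825514169466880,
    1130380172623120225798162487804000148015135326208,
    1826877046663628647754606040895353774569915678720, 0, 0,
    331856307583737290043752698635017729068800, 331856307583737290043752698635017729068800,
    906188973183437279161351108338111975323174400, 906188973183437279161351108338111975323174400, 0,
    0, 422919915648657312342427050724442522028999937336,
    2626590353186659368696420587554463012603960724792,
    2958612320327989451242332559021267290999725605944,
    366730510373949168955944874601660098539506764548,
    182687704666363524114704937470572381616925581442,
    91343852333181762057352468735286190808462790721]⟩⟩, ⟨3, [181896, 178312, 146056], ⟨true, 152776,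
    [84, 85], 92793754751168439251027608426430667914662383681,
    [4453012801242594828901852224682424825514169466880,
    2220797409850473574926692968463414432211553746944,
    1096126227998177188652763624537212264741949407232,
    3339759600931946121676389168511818619135627100160, 0, 0,
    5497758444159665045573807598072153900364069064448,
    1883967286228174626734227523426032215042954612480,
    5550045218213955454833777200327975202231442048512,
    1856328189490931282654933111392681789272893785600, 0, 0,
    68962487857579261839972130300967728206078774584,
    68962487857579261839972130300967728206078774584,
    18482073353712096262263461955307310051267560504,
    18482073353694957977723098055983285262116588292, 659339244333381037004159934013570,
    329669622166690518502079967006785]⟩⟩, ⟨6, [181896, 153224, 178312, 120968, 146056, 117384],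
    ⟨true, 88264, [261, 5], 92793754751168439251027608426430667914662383681,
    [3339759600931946121676389168511818619135627100160,
    4453012801242594828901852224682424825514169466880,
    2192252455996354377305527249074424529483898814464,
    1124671181852296386273929343926202167469604339712, 0, 0,
    3339759932788253705413679212264517254153356168960,
    4453013133098902412639142268435123460531898535680,
    2227412589594480851730087463449550524732407907840,
    1114159389283832144504624407278944318353865541120, 0, 0,
    63253497086755422315738986423169747660547788088,
    63253497086755422315738986423169747660547788088,
    75571981061950491504594900733287115506577425464,
    12773082582871118453489954178185304716585601796, 2854495385412579101360905319935994432699506818,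
    1427247692706289550680452659967997216349753409]⟩⟩]
  numFree := 35008
  numNorm := 173568

/-- The alternating group. -/
noncomputable def alternatingFive : RepData where
  data := ⟨[55504, 144208], [(1, [4, 5]), (4, [16, 17]), (5, [20, 21]), (16, [64, 65]), (17, [68,
    69]), (20, [80, 81]), (21, [84, 85]), (64, [256, 257]), (65, [260, 261]), (68, [272, 273]), (69,
    [276, 277]), (80, [320, 321]), (81, [324, 325]), (84, [336, 337]), (85, [340, 341]), (256, [1,
    1025]), (257, [1028, 1029]), (260, [321, 320]), (261, [1044, 1045]), (272, [1088, 1089]), (273,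
    [341, 340]), (276, [1104, 1105]), (277, [1108, 1109]), (320, [1109, 1108]), (321, [1284, 1285]),
    (324, [257, 256]), (325, [1300, 1301]), (336, [1344, 1345]), (337, [277, 276]), (340, [1360,
    1361]), (341, [1025, 1]), (1025, [4100, 4101]), (1028, [1089, 1088]), (1029, [337, 336]), (1044,
    [85, 84]), (1045, [4180, 4181]), (1088, [4181, 4180]), (1089, [81, 80]), (1104, [325, 324]),
    (1105, [1045, 1044]), (1108, [4432, 4433]), (1109, [5, 4]), (1284, [1345, 1344]), (1285, [273,
    272]), (1300, [69, 68]), (1301, [5204, 5205]), (1344, [5205, 5204]), (1345, [65, 64]), (1360,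
    [261, 260]), (1361, [1301, 1300]), (4100, [1285, 1284]), (4101, [1105, 1104]), (4180, [16720,
    16721]), (4181, [17, 16]), (4432, [1029, 1028]), (4433, [1361, 1360]), (5204, [16721, 16720]),
    (5205, [21, 20]), (16720, [4101, 4100]), (16721, [4433, 4432])]⟩
  elems := [181896, 55504, 144208, 72472, 83560, 181336, 103720, 107360, 174280, 120968, 176800,
    54944, 146056, 141128, 43744, 144488, 54552, 47888, 153168, 137936, 51024, 50408, 136536, 71912,
    82776, 180944, 104784, 178256, 119568, 78632, 88152, 105120, 71520, 84680, 170136, 115368,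
    172824, 108648, 87816, 80480, 173664, 109320, 119904, 177416, 141912, 42792, 51864, 136872,
    116040, 169184, 140008, 43352, 152776, 46432, 47272, 152216, 80200, 86752, 169744, 117328]
  norm := [181896, 153224, 117384, 178312, 83784, 173832, 181448, 50856, 169632, 180888, 181840,
    120968, 146056, 87816, 141128, 84680, 116040, 174280, 177416, 54944, 136872, 51864, 115368,
    170136, 176800, 51024, 83560, 169744, 173664, 180944, 181336, 152776, 109320, 80200, 152216,
    105120, 47272, 153168, 71520, 42792, 117328, 82776, 50408, 178256, 172824, 169184, 88264,
    142024, 80648, 120072, 108872, 144712, 55448, 137880, 47776, 119456, 104616, 144040, 55056,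
    137040, 42848, 87648, 71464, 140904, 51920, 115536, 50520, 84568, 82664, 115816, 170192, 176912,
    169240, 174168, 172768, 177248, 120912, 146000, 86808, 140120, 72416, 103776, 43240, 46376,
    54496, 136424, 43800, 107304, 72024, 78688, 47440, 79976, 105232, 109152, 152272, 152664, 55504,
    137936, 47888, 119568, 104784, 144208, 54552, 136536, 43352, 88152, 72472, 141912, 43744,
    107360, 46432, 80480, 86752, 119904, 71912, 78632, 103720, 108648, 140008, 144488]
  size := 1
  steps := [⟨153224, 0, 104616, [66, 16]⟩]
  free := ⟨false, 181896, [4, 5],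
    2385821036468655977538519971341548726222915605240197963893120986953355200116427625105979934867066618953076801,
    [0, 0, 0, 0, 0, 0,
    141145909260134513210424543217239512767679357394848044971004213688825454393522471312044997520302786262690087168,
    96091992465567149246660835993717168902195279471662702625515714642045708146321405773175256562461695269213324672,
    85870245362754776204604418584804508065792740116763073907973815470424276757647491742024376925678765470943555072,
    72456288762810767176530053441071980555410533144515234579640493424682458845796113318536341273749427438856857344,
    109746766507340523691618810383798471822742294774182500244052137651943474112804209080466365296804022481227817472,
    582475804263342059889899896227035049239223607460952092689957835367673692644153082407877961801789173928000,
    136892177406621034589965963873647823937748267930157286332540950995425241300865068840315039321091980879869397310,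
    127294261928041479066857523256906124959071226702628804871508354885079740413783808736814320102089897074239873726,
    141145900620494150317496747777358161275513399547114478194515146304516224977270577127224376618409094188912684734,
    72456279948190346300960682397345626628328415002961332270448273244168514170628564953205351070102436280452876478,
    109746757771461128908238148361802391810581504942228535629574496956440148570859865110307244862511485025955401150,
    582333632966231163609721771610932929638992741713348756391720594238877047683435134058215302639317082701825]⟩
  classes := [⟨1, [181896], ⟨true, 181896, [4, 5],
    9772322965375614883997777802614983582609062319063850860106223562560942899676887552434093813215504871231802576961,
    [466852688774113664372782510952171571649847679802191457178678128485058638848382324825487941694917861863500162269184,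
    238085852871280117310523984980115830487237194078129835212822329530049222130018545564575949660254312038565440126976,
    99803665597556816852391367441159666315357005598407961225577037126232754731270400413433352635359130804045108740096,
    348110375789068656370690371978502691545733170129386804515717496964390150538587721923963320336583956238205529882624,
    58619622866034877368121435695861852203297036420751663972853982649443937266860626748853926999683826827677097000960,
    0,
    141145909260134513210424543217239512767679357394848044971004213688825454393522471312044997520302786262690087168,
    96091992465567149246660835993717168902195279471662702625515714642045708146321405773175256562461695269213324672,
    85870245362754776204604418584804508065792740116763073907973815470424276757647491742024376925678765470943555072,
    72456288762810767176530053441071980555410533144515234579640493424682458845796113318536341273749427438856857344,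
    109746766507340523691618810383798471822742294774182500244052137651943474112804209080466365296804022481227817472,
    582475804263342059889899896227035049239223607460952092689957835367673692644153082407877961801789173928000,
    136892177406621034589965963873647823937748267930157286332540950995425241300865068840315039321091980879869397310,
    127294261928041479066857523256906124959071226702628804871508354885079740413783808736814320102089897074239873726,
    141145900620494150317496747777358161275513399547114478194515146304516224977270577127224376618409094188912684734,
    72456279948190346300960682397345626628328415002961332270448273244168514170628564953205351070102436280452876478,
    109746757771461128908238148361802391810581504942228535629574496956440148570859865110307244862511485025955401150,
    582333632966231163609721771610932929638992741713348756391720594238877047683435134058215302639317082701825]⟩⟩,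
    ⟨10, [181896, 178312, 146056, 174280, 142024, 109320, 170192, 137936, 105232, 72472], ⟨true,
    153224, [272, 337],
    9772322965375614883997777802614983582609062319063850860106223562560942899676887552434093813215504871231802576961,
    [391999939575946051733488985371301821913329925603385486259495350640384072799929524515412927218398513760466330714112,
    464447781169353259147423682821059290533814980872109337631073862530209656806664965779381113920571858711595460853760,
    102208573202317222077750195572271947431389704528490080773181303081081736772987759459540180409705133955949810155520,
    194196289084402721947725371587316700119640438604131153469044475854055299868676742973126342778439754516304639295488,
    58619622866034877368121435695861852203297036420751663972853982649443937266860626748853926999683826827677097000960,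
    0,
    347049067895948588271221382456163790500484500021740592786886368200654484972122564872221951446931257448515869262080,
    385181922204725453859829015330347730873638111458871055262758601734835295138138438663628972623716216394009527469440,
    389680902216548401284334761658774345305363019413420129785799058501005515034969812961048123820978189374032572853760,
    60195146407772941401147233331248099881372883785197503924686289364649233501779772265989230699923828225056392242944,
    328379634816302653785171658707210170810286146250983500748226354974537992168532314002662457563526234257472971022848,
    150307307773329589926986648094413796787092922353739932677359312135896745281027584534759143774586998783217766464,
    161265701696353771133631450748396482598128576583432166975818359925877222036363921157997775920503303158494864230718,
    84299060428542224366625842112186745186103533779576812971020816774599451200521350422475786422212200213738789413566,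
    22987768145844343791226363993344028763586153235327250180435041717369845621292181515142088232905439037283576131262,
    309704310392850363111250082563103539315838315663075853086319689960050606385280605751207281298118008244010760112318,
    41594402939888451266348023410048651643374638048858790731803162218101380368195303410453086352331065855382054817214,
    9619631001375253867666476134170896075063725359321219903765820211116522405746483867862445155599315246935888363521]⟩⟩,
    ⟨20, [181896, 153224, 181448, 152776, 177416, 120072, 144712, 116040, 180944, 152272, 176912,
    119568, 144208, 115536, 172824, 86808, 140120, 82776, 107360, 78688], ⟨true, 120968, [337, 272],
    9772322965375614883997777802614983582609062319063850860106223562560942899676887552434093813215504871231802576961,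
    [467754529125898816332292071501338677068359941900972252009029728218127007114026334467778002110297613045464425299968,
    180368070357030391901912109833421083702452419756158966070319946613673653128801928458012083075950236392852606156800,
    386288284014640089323261768559910154262752265644440452333935218997617740450850796780909211254326756274692664852480,
    118441699534449957348922285457279844964610422306544387719510098276312365554579933020761267886540655231306544709632,
    58619622866034877368121435695861852203297036420751663972853982649443937266860626748853926999683826827677097000960,
    0,
    123392660653230902312850366262721646709443499524103474859689634399699155092408173584286968432752964321378637627648,
    328365980042260880410726700732820089507365599235680980950607818551528094402565831199355166454791891930260956530048,
    466637945568881368495817261854367341018409385176047955309135569056172940369925302436466612600050290234983018147328,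
    192765678120190279449052634058812596402675412305974343986371450125699368551449189682628111760747251973803057768192,
    101115866166444359988762400317099605345196097358223203499623222241309189226241884145567232887828936402478687265280,
    150307307773329589926986648094413796787092922353739932677359312135896745281027584534759143774586998783217766464,
    311572426993879097718558208942914052350172259713564638701084982103938599643698861539674511817128500152538702694718,
    160053649978494988965428928242223600341133550077163578720555194352342385514618160374840861314111299498736883999422,
    156760753660641884451811178786464665842905031221145150015922335455844471691820278454834383180901864361982592364222,
    82440541742992069314840824172992973850748266770315555837716557226821803442990175894112056622420710389016476354750,
    212643456328472272919994674235409646021200349450949543555156578256735228085342465564801211802690540034603942989246,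
    9619631001375253867666476134170896075063725359321219903765820211116522405746483867862445155599315246935888363521]⟩⟩,
    ⟨15, [181896, 178312, 146056, 181840, 178256, 146000, 181336, 174168, 141912, 177248, 173664,
    109152, 144488, 140904, 108648], ⟨true, 152776, [277, 341],
    9772322965375614883997777802614983582609062319063850860106223562560942899676887552434093813215504871231802576961,
    [353521417899779568127747735273505324056806742722071573497827095362800360132451779777703682828862463329991108067328,
    464447781169353259147423682821059290533814980872109337631073862530209656806664965779381113920571858711595460853760,
    232674810760569205553466621685113197976163621485445066230712731131639012536154487710835587167975804946779861942272,
    63128824624960637165669238441697379295858346914655638124611981314785778595080674960304229076582582737498412154880,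
    97699371443391462280202392826436420338828394034586106621423304415739895444767711248089878332806378046128495001600,
    0,
    412582800125669630662249449028973450912375545866478350459102615470289245608920598878633008297859843337918982832384,
    600421152830781721529444133064896890758564665701220754773340404693819187871842073290190058427683498489480304149888,
    406214641999276187208676705060171277978087824557734701675578386940592266571776656403032564769606961043377395084800,
    508109187794398414624228972750910457742463059512992269665980823455272138771637894603385903671866915267307030865664,
    506042184117977589808555086893129938257201779710800082327491502389006540500402213533804359393337217104432788087296,
    9769937726814950491362299172543538260917888642682218123094423131531824912150463768962070241158599606402023428160,
    2842413232762076913118647611374964079474534564272541777387340150200530038232893995710496285460345526772658489662,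
    5538336372638953236124220818259538636032643819387397786981106753295289334277841662477176812380596988859818058430,
    5552188011331405907374860042779990672349085992231883460304113544714725818841328430867586868896916185974490869438,
    72456279948190346300960682397345626628328415002961332270448273244168514170628564953205351070102436280452876478,
    2815267813126917007436919795863118647347367801284613026684373696161544945502888791980488491001765030918744493502,
    582333632966231163609721771610932929638992741713348756391720594238877047683435134058215302639317082701825]⟩⟩,
    ⟨30, [181896, 153224, 178312, 120968, 146056, 117384, 181840, 153168, 178256, 120912, 146000,
    117328, 181336, 152664, 174168, 88152, 141912, 84568, 177248, 119904, 173664, 87648, 109152,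
    80480, 144488, 115816, 140904, 83560, 108648, 79976], ⟨true, 88264, [341, 277],
    9772322965375614883997777802614983582609062319063850860106223562560942899676887552434093813215504871231802576961,
    [467153302224708715025952364468560606789351767168451722122128661729414761603596994706251295166711112257488249946112,
    180368070357030391901912109833421083702452419756158966070319946613673653128801928458012083075950236392852606156800,
    119042926435640058655261992490057915243618597039064917606411164765024611065009272782287974830127156019282720063488,
    347208535437283504411180811429335586127220908030606009685365897231321782272943712281673259921204205056241266851840,
    97699371443391462280202392826436420338828394034586106621423304415739895444767711248089878332806378046128495001600,
    0,
    586036761119013857541254927985446726406233956198651222830060297463772075367785120079087961522565320669045572419840,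
    562543858055805339230042589999878463181049657552427371898573215904947720714793668314007520981733948846981256856960,
    295588892180297546842170611029006346640583673773957202485782153017539092652778140282118487149690816055761129975296,
    586268684949111584448390887012059594013525774740661154963119466987864055127452063601857806338112017704209826866944,
    354533005018072060610948914633056227947141747115626550828422747233520671872208593629074209609539018534436598915584,
    582475804263342059889899896227035049239223607460952092689957835367673692644153082407877961801789173928000,
    19977379916679964143800298045549967031207514441107643554067735078499527085469077199221644177675617984093656074558,
    43415631147615335535525763883277966213547651968180780661748295542166756491326246638659714258330146631358865351358,
    310374226914712768221606325661261622129493675380140536119144823321823199606516587524908007267252815689895395274430,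
    78231953434661360170462874943546481897691043642671846629409091805836084869984797563425108017315204873183248877758,
    154324446913032446205043092055936828957407400396458144525753128851647413573696508696710638274799963600914933665214,
    9769937726672779194251402892365413644815769042451352375491086833294583783353818808244121891495940443929932201985]⟩⟩,
    ⟨20, [181896, 153224, 181448, 152776, 177416, 120072, 144712, 116040, 180944, 152272, 176912,
    119568, 144208, 115536, 172824, 86808, 140120, 82776, 107360, 78688], ⟨true, 120912, [1284,
    1300],
    9772322965375614883997777802614983582609062319063850860106223562560942899676887552434093813215504871231802576961,
    [467754529125898816332292071501338677068359941900972252009029728218127007114026334467778002110297613045464425299968,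
    199607331195113633704782734882319332630714011196815922451154074252465509462540800826866705270718261608090217480192,
    386588897465235139976431622076299189402256353010700717277385752241973863206065466661672564726120006668680752529408,
    58619622866034877368121435695861852203297036420751663972853982649443937266860626748853926999683826827677097000960,
    98901825245771664892881806891992560896844743499627166395225437393164386465626390771143292219979379622080845709312,
    0,
    384926362670924970570622925521182218077999508170533975661653556989525952129170969848404488892880807091014916555008,
    6108361004366580212643731163774419958983942604676961571636180601764500812439719021040244692427469575030966863232,
    7300593059643970452281088811921647856163889530363121716720771680017370401909724630062507699963688221185047801344,
    3679817695903418605214772250109493654604458928267694555986039425698155521421834682478778002792754155295908980480,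
    384894963528172176581104119788348777037054571107913310116926604913489070148890251586172910260657308327233454285312,
    582475804263342059889899896227035049239223607460952092689957835367673692644153082407877961801789173928000,
    461879152291404424303484967137431622102215942843697110426351604281999977251033801921351247713753697146582541158718,
    192519902642760459507773108012239395407574985633272192613212784742803643077802507497283036267782342049450353107646,
    1944826604190798069336617846111568998300037597108704138897714612441252756265289861707345207377911458117438746302,
    346379151365446542797972211562565826335336974346828176187284745771497582521470331204336404856894556310557456697534,
    1913427461341765047927359246696013228835105702503818196332773963093176679858879149690428075622013848954481462718,
    582333632966231163609721771610932929638992741713348756391720594238877047683435134058215302639317082701825]⟩⟩,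
    ⟨24, [181896, 153224, 178312, 120968, 146056, 117384, 181448, 152776, 174280, 88264, 142024,
    84680, 177416, 120072, 173832, 87816, 109320, 80648, 144712, 116040, 141128, 83784, 108872,
    80200], ⟨true, 55504, [4, 4100],
    9772322965375614883997777802614983582609062319063850860106223562560942899676887552434093813215504871231802576961,
    [466852688774113664372782510952171571649847679802191457178678128485058638848382324825487941694917861863500162269184,
    199607331195113633704782734882319332630714011196815922451154074252465509462540800826866705270718261608090217480192,
    99803665597556816852391367441159666315357005598407961225577037126232754731270400413433352635359130804045108740096,
    117239245732069754736242871391723704406594072841503327945707965298887874533721253497707853999367653655354194001920,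
    327969274599200262608310186380437337198959316589949053304531769592529925939204839912818637726436179841003655528448,
    0,
    141145909260134513210424543217239512767679357394848044971004213688825454393522471312044997520302786262690087168,
    96091992465567149246660835993717168902195279471662702625515714642045708146321405773175256562461695269213324672,
    85870245362754776204604418584804508065792740116763073907973815470424276757647491742024376925678765470943555072,
    72456288762810767176530053441071980555410533144515234579640493424682458845796113318536341273749427438856857344,
    109746766507340523691618810383798471822742294774182500244052137651943474112804209080466365296804022481227817472,
    582475804263342059889899896227035049239223607460952092689957835367673692644153082407877961801789173928000,
    139922146704105174758571851084774987693338373578953355990830499576592506416122359623799679423182525185340639168830,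
    411366494675957335015426467943456976966550588270745071445200986634061008874082180693004363733268628872778181911230,
    503969289097925388862991990215800251970125939251751159701288232687166253964763990736507643102106069418223859216062,
    482857657935599539337085708003187779670192638628988460513826838709177313388930457070898881051030235181149262022846,
    270361238842721998328606549382104392805985123772920412697658961173110797086559082671365078386994615680316776959422,
    9619631001375253867666476134170896075063725359321219903765820211116522405746483867862445155599315246935888363521]⟩⟩]
  numFree := 5440
  numNorm := 76800

/-- The symmetric group. -/
noncomputable def symmetricFive : RepData where
  data := ⟨[120912, 55504], [(1, [4, 5]), (4, [16, 17]), (5, [20, 21]), (16, [64, 65]), (17, [68,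
    69]), (20, [80, 81]), (21, [84, 85]), (64, [256, 257]), (65, [260, 261]), (68, [272, 273]), (69,
    [276, 277]), (80, [320, 321]), (81, [324, 325]), (84, [336, 337]), (85, [340, 341]), (256,
    [1024, 1025]), (257, [1028, 1029]), (260, [1040, 1041]), (261, [1044, 1045]), (272, [1088,
    1089]), (273, [1092, 1093]), (276, [1104, 1105]), (277, [1108, 1109]), (320, [1280, 1281]),
    (321, [1284, 1285]), (324, [1296, 1297]), (325, [1300, 1301]), (336, [1344, 1345]), (337, [1348,
    1349]), (340, [1360, 1361]), (341, [1364, 1]), (1024, [1, 1364]), (1025, [1361, 1360]), (1028,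
    [4112, 4113]), (1029, [4116, 4117]), (1040, [4160, 4161]), (1041, [4164, 4165]), (1044, [4176,
    4177]), (1045, [4180, 4181]), (1088, [1301, 1300]), (1089, [1297, 1296]), (1092, [4368, 4369]),
    (1093, [4372, 4373]), (1104, [4416, 4417]), (1105, [4420, 4421]), (1108, [4432, 4433]), (1109,
    [5, 4]), (1280, [1109, 1108]), (1281, [1105, 1104]), (1284, [5136, 5137]), (1285, [5140, 5141]),
    (1296, [5184, 5185]), (1297, [5188, 5189]), (1300, [4177, 4176]), (1301, [4181, 4180]), (1344,
    [1045, 1044]), (1345, [1041, 1040]), (1348, [5392, 5393]), (1349, [5396, 5397]), (1360, [5440,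
    5441]), (1361, [5444, 5445]), (1364, [4433, 4432]), (4112, [321, 320]), (4113, [325, 324]),
    (4116, [16464, 16465]), (4117, [16468, 16469]), (4160, [4373, 4372]), (4161, [4369, 4368]),
    (4164, [1281, 1280]), (4165, [1285, 1284]), (4176, [16704, 16705]), (4177, [16708, 16709]),
    (4180, [21, 20]), (4181, [17, 16]), (4368, [337, 336]), (4369, [341, 340]), (4372, [16465,
    16464]), (4373, [16469, 16468]), (4416, [4117, 4116]), (4417, [4113, 4112]), (4420, [1345,
    1344]), (4421, [1349, 1348]), (4432, [17728, 17729]), (4433, [17732, 17733]), (5136, [257,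
    256]), (5137, [261, 260]), (5140, [20560, 20561]), (5141, [20564, 20565]), (5184, [5397, 5396]),
    (5185, [5393, 5392]), (5188, [1025, 1024]), (5189, [1029, 1028]), (5392, [273, 272]), (5393,
    [277, 276]), (5396, [20561, 20560]), (5397, [20565, 20564]), (5440, [5141, 5140]), (5441, [5137,
    5136]), (5444, [1089, 1088]), (5445, [1093, 1092]), (16464, [65856, 65857]), (16465, [65860,
    65861]), (16468, [69, 68]), (16469, [65, 64]), (16704, [5441, 5440]), (16705, [5445, 5444]),
    (16708, [4417, 4416]), (16709, [4421, 4420]), (17728, [5185, 5184]), (17729, [5189, 5188]),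
    (17732, [4161, 4160]), (17733, [4165, 4164]), (20560, [65857, 65856]), (20561, [65861, 65860]),
    (20564, [85, 84]), (20565, [81, 80]), (65856, [17729, 17728]), (65857, [17733, 17732]), (65860,
    [16705, 16704]), (65861, [16709, 16708])]⟩
  elems := [181896, 120912, 55504, 146056, 137880, 80648, 72472, 181840, 180944, 173664, 172768,
    51024, 115536, 42848, 107360, 120968, 55448, 120072, 54552, 104616, 47272, 103720, 46376, 88264,
    88152, 152776, 152664, 71912, 79976, 136424, 144488, 146000, 137936, 80480, 72416, 144208,
    137040, 78688, 71520, 141912, 142024, 84568, 84680, 140120, 141128, 82776, 83784, 47888, 105232,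
    47776, 105120, 176912, 169744, 176800, 169632, 43800, 109320, 51864, 117384, 172824, 173832,
    180888, 50856, 115368, 42792, 107304, 181448, 181336, 174280, 174168, 50408, 115816, 43240,
    108648, 54944, 119456, 55056, 119568, 169184, 177248, 170192, 178256, 54496, 119904, 83560,
    82664, 140904, 140008, 116040, 50520, 108872, 43352, 87648, 86752, 153168, 152272, 103776,
    46432, 104784, 47440, 72024, 80200, 136536, 144712, 86808, 87816, 152216, 153224, 78632, 71464,
    144040, 136872, 170136, 178312, 169240, 177416, 43744, 109152, 51920, 117328]
  norm := [181896, 153224, 117384, 178312, 83784, 173832, 181448, 50856, 169632, 180888, 181840,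
    120968, 146056, 87816, 141128, 84680, 116040, 174280, 177416, 54944, 136872, 51864, 115368,
    170136, 176800, 51024, 83560, 169744, 173664, 180944, 181336, 152776, 109320, 80200, 152216,
    105120, 47272, 153168, 71520, 42792, 117328, 82776, 50408, 178256, 172824, 169184, 88264,
    142024, 80648, 120072, 108872, 144712, 55448, 137880, 47776, 119456, 104616, 144040, 55056,
    137040, 42848, 87648, 71464, 140904, 51920, 115536, 50520, 84568, 82664, 115816, 170192, 176912,
    169240, 174168, 172768, 177248, 120912, 146000, 86808, 140120, 72416, 103776, 43240, 46376,
    54496, 136424, 43800, 107304, 72024, 78688, 47440, 79976, 105232, 109152, 152272, 152664, 55504,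
    137936, 47888, 119568, 104784, 144208, 54552, 136536, 43352, 88152, 72472, 141912, 43744,
    107360, 46432, 80480, 86752, 119904, 71912, 78632, 103720, 108648, 140008, 144488]
  size := 1
  steps := []
  free := ⟨false, 181896, [4, 5],
    5603202299024241065375215956755214014586019666372177628340083196156138552303965277591019684514345232085114812496595231305800192194203156642116176762870924814346817641830785953517127127961713348658248729124671687233601,
    [0, 0, 0, 0, 0, 0,
    335666951976340158960160137714687372047875975663102447727722620437448759886213824755791886938976437043117994422768968477749793315014856677274267317969059694942073722064882988375894854323260575371643088704480838528786494,
    335647548587917049612309584290599149746988530479358818853706791184624837363321729625136224420169216320339114823206480072940202430691327542757628830012590370926781883386221181744033622003764643514829140524598954455457854,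
    224128078653276623947929786565200007945416946142940201123944752785717677180192482050251717282095579843608565747919932481463105205859044031514733999121924250556999572577495389510603528633955173580272037412615889347100734,
    41035738755391820561291897599963594049766553643549241473902977276029086279248949365328380370480969956967475361062928276717418748802290688451421589954667636067089923581862457010770867880542003634707914449507508805694,
    224128078653276623947929786565200007945416946142940201123944752785717677180192482050251717282095579843608565747919932481463105205859044031514733999121924250556999572577495389510603528633955173580272037412615889347100734,
    19906572266305596583120686357807367475620925802173982589738421741683427803771250889766618984990352732736011035878606038664061582293465135677857553756538877193297021086299361702033156949674490979424669697,
    335666951976338924849855961970557878966203833870450604217488742629654301047470885029975776426901719244474331761171278056323421782675206652868421645643039586008707722348429344284183791161993792557742625183100659074334720,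
    335647548587915815599181743749328317066198430950838620330638770355956483618980129172150734579872700765474071352750142421584801185872653695919762583681510018527483978663488924307921614956499961583594002887915167261130752,
    224128078653275396059901104887189662378684187478225379715007748010582427957119856910216616174288073855812773170228009414274381613862366136593832683133472800578999350327169350237373858257505580435139771851811016131256320,
    335639606557145033634992150459700338400971355582813516172075727733476002773904509533254864367610544933446594918154275818328208388646245925999203042781460645137813291469196266621231846206004455526088701882114539403657600,
    112926090411104683042880148650768552439460566030737947742655961303368823127904078905547955346488374567804907045528392897180475590273955133234308921690874177793335988569423768447762322199118284185674334740472025388179840,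
    0]⟩
  classes := [⟨1, [181896], ⟨true, 181896, [4, 5],
    22950716616803291403776884558869356603744336553460439565680980771455543510237041777012816627770758070620630271986054067428557587227456129606107860020719308039564565060938899265606152716131177876104186794494655230908829761,
    [782251866562176246654903149290681918148325033582886974337302334848966191010051984473927076115678709160938708743024667052140153231848314292492555205510884071481330517340712365398619084080478877179480788575637164911308570624,
    1101365443896204823810152448459804866707028025622115234626526753036450593840867414963290829188139698818650167544330758665468085777692572469574355704509908981508010475678259287023326508272154375812265370196745466842636615680,
    550682721948102411905076224229902433353514012811057617313263376518225296920433707481645414594069849409325083772165379332734042888846286234787177852254954490754005237839129643511663254136077187906132685098372733421318307840,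
    273223350505020042829826280483297745779243490971640125513119136810965628087445954865893301856288502206934368486958976668933428971773734324182869011311112035797179521850952784665402153013669066307273524529577240812884852736,
    137670680487025602976269056057475608338378503202764404328315844129556324230108426870411353648517462352331270943041344833183510722211571558696794463063738622688501309459782410877915813534019296976533171274593183355329576960,
    0,
    335666951976340158960160137714687372047875975663102447727722620437448759886213824755791886938976437043117994422768968477749793315014856677274267317969059694942073722064882988375894854323260575371643088704480838528786494,
    335647548587917049612309584290599149746988530479358818853706791184624837363321729625136224420169216320339114823206480072940202430691327542757628830012590370926781883386221181744033622003764643514829140524598954455457854,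
    224128078653276623947929786565200007945416946142940201123944752785717677180192482050251717282095579843608565747919932481463105205859044031514733999121924250556999572577495389510603528633955173580272037412615889347100734,
    41035738755391820561291897599963594049766553643549241473902977276029086279248949365328380370480969956967475361062928276717418748802290688451421589954667636067089923581862457010770867880542003634707914449507508805694,
    224128078653276623947929786565200007945416946142940201123944752785717677180192482050251717282095579843608565747919932481463105205859044031514733999121924250556999572577495389510603528633955173580272037412615889347100734,
    19906572266305596583120686357807367475620925802173982589738421741683427803771250889766618984990352732736011035878606038664061582293465135677857553756538877193297021086299361702033156949674490979424669697,
    335666951976338924849855961970557878966203833870450604217488742629654301047470885029975776426901719244474331761171278056323421782675206652868421645643039586008707722348429344284183791161993792557742625183100659074334720,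
    335647548587915815599181743749328317066198430950838620330638770355956483618980129172150734579872700765474071352750142421584801185872653695919762583681510018527483978663488924307921614956499961583594002887915167261130752,
    224128078653275396059901104887189662378684187478225379715007748010582427957119856910216616174288073855812773170228009414274381613862366136593832683133472800578999350327169350237373858257505580435139771851811016131256320,
    335639606557145033634992150459700338400971355582813516172075727733476002773904509533254864367610544933446594918154275818328208388646245925999203042781460645137813291469196266621231846206004455526088701882114539403657600,
    112926090411104683042880148650768552439460566030737947742655961303368823127904078905547955346488374567804907045528392897180475590273955133234308921690874177793335988569423768447762322199118284185674334740472025388179840,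
    0]⟩⟩, ⟨10, [181896, 178312, 146056, 174280, 142024, 109320, 170192, 137936, 105232, 72472],
    ⟨true, 153224, [1024, 1025],
    22950716616803291403776884558869356603744336553460439565680980771455543510237041777012816627770758070620630271986054067428557587227456129606107860020719308039564565060938899265606152716131177876104186794494655230908829761,
    [1101365443896204823810152448459804866707028025622115234626526753036450593840867414963290829188139698818650167544330758665468085777692572469574355704509908981508010475678259287023326508272154375812265370196745466842636615680,
    415130051930107972051518999804080295912649025042181896128460083836815993063096179486163466386298809554721986228247747496984124639284123469301103304007581077645327025447959269724176914656427418575392331843388675963763032064,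
    917804536580170686508460373716504055589190021351762695522105627530375494867389512469409024323449749015541806286942298887890071481410477057978629753758257484590008729731882739186105423560128646510221141830621222368863846400,
    273223350505020042829826280483297745779243490971640125513119136810965628087445954865893301856288502206934368486958976668933428971773734324182869011311112035797179521850952784665402153013669066307273524529577240812884852736,
    137670680487025602976269056057475608338378503202764404328315844129556324230108426870411353648517462352331270943041344833183510722211571558696794463063738622688501309459782410877915813534019296976533171274593183355329576960,
    0,
    1084757027095931858987417955544291786898967778126668871926154064071711879618586437788611377549107295273867898345763823654477095789812316980565870653296956364564367772851427873288266610691521415221294469128576940498970992702,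
    1084757007692543435878070104990867698676666890681485128297280048242459055696063545693480721886588488053145119466164261166072286198927993451431354014808999895240352481012749211481634749459201919289437655180397058614897664062,
    224128078653276623947929786565200007945416946142940201123944752785717677180192482050251717282095579843608565747919932481463105205859044031514733999121924250556999572577495389510603528633955173580272037412615889347100734,
    41035738755391820561291897599963594049766553643549241473902977276029086279248949365328380370480969956967475361062928276717418748802290688451421589954667636067089923581862457010770867880542003634707914449507508805694,
    224128078653276623947929786565200007945416946142940201123944752785717677180192482050251717282095579843608565747919932481463105205859044031514733999121924250556999572577495389510603528633955173580272037412615889347100734,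
    19906572266305596583120686357807367475620925802173982589738421741683427803771250889766618984990352732736011035878606038664061582293465135677857553756538877193297021086299361702033156949674490979424669697,
    1084757027095931857753307651368547657405886105984876220082643830193904085159747694848885561438595220556069254683102225964055669418279977330541464807624630344455434406851711419644174899628360148438480568665055560319516540928,
    421113727396112322861016399232238879956417931296835889798157526468897337207437556615147364962869142249429256030597065632561956034201752904892276172768236479876716101609588190889630100416369325592423440565234260191755632640,
    782475994640829522050963050395569107810703717770365199717017342596976773438009104330837292731852997234794521516194895061554427613462176658629149038194017544281909516691039534748856457938736382759915928347488975927439826944,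
    335639606557145033634992150459700338400971355582813516172075727733476002773904509533254864367610544933446594918154275818328208388646245925999203042781460645137813291469196266621231846206004455526088701882114539403657600,
    112926090411104683042880148650768552439460566030737947742655961303368823127904078905547955346488374567804907045528392897180475590273955133234308921690874177793335988569423768447762322199118284185674334740472025388179840,
    0]⟩⟩, ⟨20, [181896, 153224, 181448, 152776, 177416, 120072, 144712, 116040, 180944, 152272,
    176912, 119568, 144208, 115536, 172824, 86808, 140120, 82776, 107360, 78688], ⟨true, 120968, [4,
    4373],
    22950716616803291403776884558869356603744336553460439565680980771455543510237041777012816627770758070620630271986054067428557587227456129606107860020719308039564565060938899265606152716131177876104186794494655230908829761,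
    [917804536580170686508460373716504055589190021351762695522105627530375494867389512469409024323449749015541806286942298887890071481410477057978629753758257484590008729731882739186105423560128646510221141830621222368863846400,
    1101365443896204823810152448459804866707028025622115234626526753036450593840867414963290829188139698818650167544330758665468085777692572469574355704509908981508010475678259287023326508272154375812265370196745466842636615680,
    234393158572782052246776033902984112658162374683680934548722360261603587919979475492187535442604089748584522836357571715984233639867906448653003906344416526833756075593065438007528462016894392801071860836743266020355997696,
    453960243862345962634569246384393929033730141330141087092856860386178033230562658859869232799983222013071831878849152449933319971189951344830968408974276586608750471705846616382050605653202092081593995536222650756291887104,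
    137670680487025602976269056057475608338378503202764404328315844129556324230108426870411353648517462352331270943041344833183510722211571558696794463063738622688501309459782410877915813534019296976533171274593183355329576960,
    0,
    994388580417268899085046472593743695271724452947418391136285202284105677047028085791623412077259935370799166649818735763977150290104208470241820954465374089158582297923980957429942384371754902334134233625254235527267475518,
    587730550959897156415026948762853194726828602195607483953001308410624941552492609710046911791428008586267095138466277768322585950533396644649080671235297380508532368911791174260851504700486098410056359912122181270528319550,
    994277041543945835550034242242594207907621993917898228889681424416453945964322064448917871907603054513599657221143886727980863601995052657596061421146526953714197223774493569831077093046065596932342862573962370578085789758,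
    180736934393064675196563527192993783218080700125054605128979197478189681172202983242925296272075090287107420359365536843928167716834965822938787849084754505479207016944817413579105463410400906316324105714559859450915840062,
    994277041543945835550034242242594207907621993917898228889681424416453945964322064448917871907603054513599657221143886727980863601995052657596061421146526953714197223774493569831077093046065596932342862573962370578085789758,
    22592111669665739995499443003942619489931517652619987673088141249075533232628009740930419171733090865533801908976624705360997410805633166245074007001360704529303922488400606157878077666240989923823215825505167222350548993,
    918140203532147025433310229678474613468156225185633146126323116273005149168436983354439000099876650734786280618703470165946394903193152264631498175403900524176017437454231168530389607351290640302778884455804323027938181120,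
    152832401318831660650851059222799232938039309670936024953234343036941423323123699124089342468322292537193958808260085957640242831943305764867753629361976599765790472918730159435230053529562490458666491414744979807010816000,
    234617286651435327642835935007871302320541058871159159928437368009614170347936595349097752058778377822440335609527799725398508021481768814789597739027549999634335074943392607357765835875151898381507000608595077036487254016,
    813651659714523784154978338705392524983590897968837140624991831816189299146799072482424944110993849672552031858423945290317837705761622838842446492527021939297207087638491438991539268724104620439968208231786459284735312256,
    112926090411104683042880148650768552439460566030737947742655961303368823127904078905547955346488374567804907045528392897180475590273955133234308921690874177793335988569423768447762322199118284185674334740472025388179840,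
    0]⟩⟩, ⟨15, [181896, 178312, 146056, 181840, 178256, 146000, 181336, 174168, 141912, 177248,
    173664, 109152, 144488, 140904, 108648], ⟨true, 152776, [1104, 16468],
    22950716616803291403776884558869356603744336553460439565680980771455543510237041777012816627770758070620630271986054067428557587227456129606107860020719308039564565060938899265606152716131177876104186794494655230908829761,
    [1101365443896204823810152448459804866707028025622115234626526753036450593840867414963290829188139698818650167544330758665468085777692572469574355704509908981508010475678259287023326508272154375812265370196745466842636615680,
    413718044950753863303044445382977981980973348086256107366118382871384646147915580236210529425801194556236537295498605498695062990851184273827290027463337604592111627402217911663890598620181066811530453163649258698580164608,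
    274635357484374151578300834904400059710919167927565914275460837776396975002626554115846238816786117205419817419708118667222490620206673519656682287855355508850394919896694142725688469049915418071135403209316658078067720192,
    826024082922153617857614336344853650030271019216586425969895064777337945380650561222468121891104774113987625658248068999101064333269429352180766778382431736131007856758694465267494881204115781859199027647559100131977461760,
    229451134145042671627115093429126013897297505337940673880526406882593873716847378117352256080862437253885451571735574721972517870352619264494657438439564371147502182432970684796526355890032161627555285457655305592215961600,
    0,
    684453048449042028794881777161785787268913361121707757802281840371925029164886550426953749248033443203243125911382067139528118459074055063739806753003931753977802426883752863197096014415680690166451863422452145819628068926,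
    279913029460701449247574084962548757621531025803785533762510497946591314043121973220306654402947938916439227799153322141307146592152652031357786384590220254907575594940175117118434608798781413888166807728929217460663214142,
    1369870898052138762644265718255809713733352064194158039672573881221192225402361464936399103399968644110729073332415658272871262085156878653630392981915290785869493103941694813867237158687595166119602591384647363116728533054,
    1323050580690538652712478053864765753943703357469017713863415278512149335553307776454851297314645624061835606953421413459779041299082774961253728573377724205530464035949576084350735136733699483280583957623748426983855611966,
    454184371940999239258517176170959129041675558276284027293980805138963750907742851341919484517265317592915440444597072382414783076395810388862483142973398510859307471278424111771561209181836047255174267573635266645638987838,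
    19906572266305596583120686357807367475620925802173982589738421741683427803771250889766618984990352732736011035878606038664061582293465135677857553756538877193297021086299361702033156949674490979424669697,
    1241489801804237928833983192110904503821886248092638772702572637356783592744794211593661564053830485387954086218256987774141512394336228028134738504035655853362343589929002164335955979651705194227149102116130876754814828544,
    142242348973675845037291901064531878450471732501492609235671585796206321459269204749442315264590180048553091812641520970472280468696261798814154055280150551866674987575669973983082683257714852229702401316699350318139310080,
    682223499106687800909269686497304818661730653899634197590756574051351142460186557584178768536522332342327647291005813183031050574723493779988406403552730957503616255443403112468528019365245407525722542085990350099456237568,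
    815769670183554947277690170337045995881104413402725823768504383264336319519569971357354349551740272170280205257547658287751430178411031632053166407343387148877030184707103476081968742778474148085761026251395585182509613440,
    238742105601255483175242577314941823005628866117489038783490119119200997488649177320951894279443423118608674541650526103748599060756997990207678044898837820171195605718858935956835172447832566376843171210701989841292779904,
    0]⟩⟩, ⟨30, [181896, 153224, 178312, 120968, 146056, 117384, 181840, 153168, 178256, 120912,
    146000, 117328, 181336, 152664, 174168, 88152, 141912, 84568, 177248, 119904, 173664, 87648,
    109152, 80480, 144488, 115816, 140904, 83560, 108648, 79976], ⟨true, 88264, [16704, 321],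
    22950716616803291403776884558869356603744336553460439565680980771455543510237041777012816627770758070620630271986054067428557587227456129606107860020719308039564565060938899265606152716131177876104186794494655230908829761,
    [826024082922153617857614336344853650030271019216586425969895064777337945380650561222468121891104774113987625658248068999101064333269429352180766778382431736131007856758694465267494881204115781859199027647559100131977461760,
    1101365443896204823810152448459804866707028025622115234626526753036450593840867414963290829188139698818650167544330758665468085777692572469574355704509908981508010475678259287023326508272154375812265370196745466842636615680,
    545740697520363031285415283756044334592649143465317356645067423139215582717301610106810135232328196914626012507543382338722327119330999050628831384350102335067751344679034890300661148009214956732616109719284772993178271744,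
    142612704914764983595929996531333707099243372548504664996511797508566038433240524245246633010259114847030342207663341827195226491726858742855140930968590778374755202619877164088917919660881528150049746653681143783469613056,
    229451134145042671627115093429126013897297505337940673880526406882593873716847378117352256080862437253885451571735574721972517870352619264494657438439564371147502182432970684796526355890032161627555285457655305592215961600,
    0,
    103412176444826278797602632878183604384372293758245682098671893096925773568069959071320190003264871326480890085110134843579250128919576126265643455047742592579666131061184021389276965500306939337288786709681941196878110782,
    740227304730140901250278826241903099347801713435592670285905012677210408391997328704964103525170428422695579875373613583541243981290829755820914538013592470255795357851857844771773636615092088907139257323979245910278004798,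
    596091073366087168480209895491741679175081092346825797909321752164814115883393075962189649047275624940703058185885843210465478743906199533980717435669867552707454974875430596830335970824594399523293074887446701796517167166,
    93898505162786987165378430295201476420026567335618596244964588104161845888596129370819673201471767880252310995293303949150876338209205301299271341613780912706460037131723892871497027181250272838818566910585697642169491518,
    92710585226347399649031244368766762532702257559282104134505357988538940621509443353967622629875877980640513660816720820415001077563376347566284347647069409236165571568636448338264303902769995706533325560344446758824919102,
    22592111669665739995499443003942619489931517652619987673088141249075533232628009740930419171733090865533801908976624705360997410805633166245074007001360704529303922488400606157878077666240989923823215825505167222350548993,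
    417583729351115474099080687397704324689128744309941029876190124027592667736914549246122847603472133771694633959132631772474040533716207469164691640469589326811158830238919736158890572501958940013742892488180902520611667968,
    779057496662378890599315944981675461636202039624023341051778721205743780205719466478216884449014544365490560482504562198839083911951838957503941776733956898866819506205022459172211215604819497731409685879176536915612532736,
    1088881509160671120469941359774771230984325617206261361145166452095579054032199141570624613159835451906136939922758708690280805323409982076446630048294851196829650892616914233830987037804194715517943601850942522472122064896,
    277795011049639514108884935897064387912671493195000305316316315434993144835761657125285367602148957747324161880124556939618942125461198156530308043986623915601963529279646055112882332968614126054385249270677607147837112704,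
    281808318471555800003716487158562397921737013273225596034911998564857078401657454444516471574620680572414866990499357051564979337961643452158982979498263748294265246113970356795567811553346295174630470942754216429370237312,
    0]⟩⟩, ⟨20, [181896, 153224, 181448, 152776, 177416, 120072, 144712, 116040, 180944, 152272,
    176912, 119568, 144208, 115536, 172824, 86808, 140120, 82776, 107360, 78688], ⟨true, 120912, [4,
    4433],
    22950716616803291403776884558869356603744336553460439565680980771455543510237041777012816627770758070620630271986054067428557587227456129606107860020719308039564565060938899265606152716131177876104186794494655230908829761,
    [917804536580170686508460373716504055589190021351762695522105627530375494867389512469409024323449749015541806286942298887890071481410477057978629753758257484590008729731882739186105423560128646510221141830621222368863846400,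
    1101365443896204823810152448459804866707028025622115234626526753036450593840867414963290829188139698818650167544330758665468085777692572469574355704509908981508010475678259287023326508272154375812265370196745466842636615680,
    279577381912113532197961775378258158471784037273306174943656791155406689205758651490681518178527769700118888684330115661234206389721960703815028755760207664536648813056788895936690575176777649244651978588404618506207756288,
    137670680487025602976269056057475608338378503202764404328315844129556324230108426870411353648517462352331270943041344833183510722211571558696794463063738622688501309459782410877915813534019296976533171274593183355329576960,
    408776020523014482683383504909119883220108478740515846697922429492374931944783482861375250064059542061537466030876608504683347221335897089668943559558485448905857734242123158452888492493318835638013877784561298270440128512,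
    0,
    1175125473774594818889789438494839878526211103305919352716022925859318082190144789785599343020954655176936630041708911544977041289520425490889920352128538639970153247778874789146590837011287928108454704631899645470674509886,
    949204337674548996024512880565045561235801902912609407112476755561049751838726017697998773678817448198542021922246629330322367949365830685945279466561626482131674268621578837694148409979552149958697301925413001157342388286,
    949092818204614355598848500767320162094000331328272988494746993522650844678542888450423889171679374562065291373171342782730890852140998402434036571730735816011304486310770111901914979886182340488762744822301018092234031166,
    722947614465042434610792424896282332981540651200557489868192368203826896601553095224853089103159249705519810535036064186927840715083616884883086042074248157913919866509498908729050821328999983639285518734496089281136943166,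
    949092818204614355598848500767320162094000331328272988494746993522650844678542888450423889171679374562065291373171342782730890852140998402434036571730735816011304486310770111901914979886182340488762744822301018092234031166,
    22592111669665739995499443003942619489931517652619987673088141249075533232628009740930419171733090865533801908976624705360997410805633166245074007001360704529303922488400606157878077666240989923823215825505167222350548993,
    782587533514152585579753005252652476027291237416757424941519823591595845311099455358957051892105610880183183074785838330196476653630989499145423627156527111067339225063060794742903267871640870972038531200820265570382905344,
    830595751408803859918637181351909920142364248515314630877250806443987942609811339101499083507177491810209446527848245136389834079754119592298126370598843665309181534874582028372661750927811337112368257689665267094787194880,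
    550906850026755687301136125334789623015892696998535842692978384266235879348390827338555631210244137483180896545335607342148317270460148600923771684938087963554584237189456812861900627994334693486567824870224544437449564160,
    544664330147566067570575721485401720999374437864974381398897797901517711804894915366390453136198192461074010169712394616251593679286706101081017310848640322659673759924762728506996063819174609424280319741427470267399061888,
    137783606577436707659311936206126376890817963768795142276058500090859693053236330949316901603863950726899075850086873226080691197801845513830028771985429496866294645448351834646363575856218415260718845609333655380717756800,
    0]⟩⟩, ⟨24, [181896, 153224, 178312, 120968, 146056, 117384, 181448, 152776, 174280, 88264,
    142024, 84680, 177416, 120072, 173832, 87816, 109320, 80648, 144712, 116040, 141128, 83784,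
    108872, 80200], ⟨true, 55504, [4432, 5],
    22950716616803291403776884558869356603744336553460439565680980771455543510237041777012816627770758070620630271986054067428557587227456129606107860020719308039564565060938899265606152716131177876104186794494655230908829761,
    [780133856093145083532191317659028447250811518148998291193789783400819170637281085598997670674932286663210535343900954054706560759198905499281835290694518861901507420272100328308189610026109349533687970556028039013534269440,
    1101365443896204823810152448459804866707028025622115234626526753036450593840867414963290829188139698818650167544330758665468085777692572469574355704509908981508010475678259287023326508272154375812265370196745466842636615680,
    546446701010040085659652560966595491558486981943280251026238273621931256174891909731786603712577004413868736973917953337866857943547468648365738022622224071594359043701905569330804306027338132614547049059154481625769705472,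
    275341360974051205952538112114951216676757006405528808656631688259112648460216853740822707297034924704662541886082689666367021444423143117393588926127477245377002618919564821755831627068038593953066342549186366710659153920,
    141906701425087929221692719320782550133405534070541770615340947025850364975650224620270164530010307347787617741288770828050695667510389145118234292696469041848147503597006485058774761642758352268118807313811435150878179328,
    0,
    776233502107059097445727814533436192827832363256884027354492403124962578651625501673894651680378418104797306540076297028317125607215102769537669728379757502436803299856941137115706556771693554817473977605514268056514453566,
    1093935053058345142743154708728032739232558790895002755252501104517762810644737440818174812129822985543300537529033684154951186913742098222011140312346582470086252568310068038873495803694803205754539866598703270838586302526,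
    562202905861588558516820589385286144814864845404606867613120928994461789919058693963319161995332864977052283799906435251527999181515658842609198798608024199430285421777638003383464385954681957190607986573700687432128348222,
    286637457844622831332155108775667328093756471819488762304606769885540699810747926989395568309396215173516090315551186715607791349305405483474783589903014984470361870375419268100579166128877288605965006695016154339630899262,
    149190864400511749588013421212859319799729335796313654628173396605792817228733413352085101049780477920058470970782400751977467014880944166518815409416808331364781493398290770749716945352624066261008472749921137366139617342,
    353001744838527207025210871581175066039605596788814666206351043531819318533571554171662043895654639387981218177638232308276447986840837532514901429526003941161403267974216708368600095360949642998626619609345295720386561,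
    3865684400361610796036242014726342708155396223684922510071741156208021588998969009912318177670939215458096663634026273778977542865023195337401613006251722219047202836701824494999973881777873202212439324531643822031503360,
    7395682445358459557971953849260897975444583210579782432039143597512691059521976378936835537067947693192718735098460133866893043350568631064986145304898875284604474207370279225739501796188258780892987401585001493175468032,
    3754145527038547267246287157642974491567876577292697285569260161588949715908617981792559017418325570069435105043083005136928502696210354821127024043742155433617494464680564500953163948873384990089836471200354179088424960,
    10925691951712960647194150308727054825968548525026229233734832968468577866628398884180282068099723033574313590536719262986290571635690211979598777124607508544253298634529381718768602118053642684490178799927744028275163520,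
    3642943538796376554229266201406553381628652955845209853596908374881736111079402203787890356590525870781427238918383388619834596672621943817767500282299556810831831102922818919163552412814997693840371034089015188345348480,
    0]⟩⟩]
  numFree := 11968
  numNorm := 168960

set_option maxRecDepth 100000 in
theorem trivialGroup_check : trivialGroup.check = true := by decide +kernel

set_option maxRecDepth 100000 in
theorem transposition_check : transposition.check = true := by decide +kernel

set_option maxRecDepth 100000 in
theorem doubleTransposition_check : doubleTransposition.check = true := by decide +kernel

set_option maxRecDepth 100000 in
theorem cyclicThree_check : cyclicThree.check = true := by decide +kernel

set_option maxRecDepth 100000 in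
theorem kleinOdd_check : kleinOdd.check = true := by decide +kernel

set_option maxRecDepth 100000 in
theorem kleinEven_check : kleinEven.check = true := by decide +kernel

set_option maxRecDepth 100000 in
theorem cyclicFour_check : cyclicFour.check = true := by decide +kernel

set_option maxRecDepth 100000 in
theorem cyclicFive_check : cyclicFive.check = true := by decide +kernel

set_option maxRecDepth 100000 in
theorem symmetricThree_check : symmetricThree.check = true := by decide +kernel

set_option maxRecDepth 100000 in
theorem cyclicSix_check : cyclicSix.check = true := by decide +kernel

set_option maxRecDepth 100000 in
theorem twistedSymmetricThree_check : twistedSymmetricThree.check = true := by decide +kernel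

set_option maxRecDepth 100000 in
theorem dihedralFour_check : dihedralFour.check = true := by decide +kernel

set_option maxRecDepth 100000 in
theorem dihedralFive_check : dihedralFive.check = true := by decide +kernel

set_option maxRecDepth 100000 in
theorem symmetricThreeTwo_check : symmetricThreeTwo.check = true := by decide +kernel

set_option maxRecDepth 100000 in
theorem alternatingFour_check : alternatingFour.check = true := by decide +kernel

set_option maxRecDepth 100000 in
theorem frobeniusTwenty_check : frobeniusTwenty.check = true := by decide +kernel

set_option maxRecDepth 100000 in
theorem symmetricFour_check : symmetricFour.check = true := by decide +kernel

set_option maxRecDepth 100000 in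
theorem alternatingFive_check : alternatingFive.check = true := by decide +kernel

set_option maxRecDepth 100000 in
theorem symmetricFive_check : symmetricFive.check = true := by decide +kernel

/-- Representatives of all conjugacy classes of subgroups of the symmetric group. -/
noncomputable def representatives : List RepData :=
  [trivialGroup, transposition, doubleTransposition, cyclicThree, kleinOdd, kleinEven, cyclicFour,
    cyclicFive, symmetricThree, cyclicSix, twistedSymmetricThree, dihedralFour, dihedralFive,
    symmetricThreeTwo, alternatingFour, frobeniusTwenty, symmetricFour, alternatingFive,
    symmetricFive]

theorem check_of_mem_representatives : ∀ ρ ∈ representatives, ρ.check = true := by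
  simp only [representatives, List.forall_mem_cons]
  exact ⟨trivialGroup_check, transposition_check, doubleTransposition_check, cyclicThree_check,
    kleinOdd_check, kleinEven_check, cyclicFour_check, cyclicFive_check, symmetricThree_check,
    cyclicSix_check, twistedSymmetricThree_check, dihedralFour_check, dihedralFive_check,
    symmetricThreeTwo_check, alternatingFour_check, frobeniusTwenty_check, symmetricFour_check,
    alternatingFive_check, symmetricFive_check, by simp⟩

set_option maxRecDepth 100000 in
theorem checkSteps_representatives : checkSteps representatives = true := by decide +kernel

set_option maxRecDepth 100000 in
theorem checkDistinct_representatives : checkDistinct representatives = true := by decide +kernel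

theorem sum_numFree :
    (representatives.map fun ρ => ρ.size * ρ.numFree).sum = 64 * 270131 := by
  decide +kernel

theorem sum_numNorm :
    (representatives.map fun ρ => ρ.size * ρ.numNorm).sum = 7680 * 6382 := by
  decide +kernel

end Whitten

/-- The Whitten group Γ_5 (a group of order 7680) has exactly
270131 subgroups, and these subgroups fall into exactly 6382 conjugacy classes. -/
theorem whittenGroup_5_subgroup_counts :
    Nat.card (WhittenGroup 5) = 7680 ∧
    Nat.card (Subgroup (WhittenGroup 5)) = 270131 ∧
    Nat.card (Quot (subgroupConj (G := WhittenGroup 5))) = 6382 := by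
  obtain ⟨h1, h2⟩ := Whitten.card_eq_sum Whitten.representatives
    Whitten.check_of_mem_representatives Whitten.checkSteps_representatives
    Whitten.checkDistinct_representatives ⟨Whitten.trivialGroup, List.mem_cons_self, rfl⟩
  rw [Whitten.sum_numFree] at h1
  rw [Whitten.sum_numNorm] at h2
  exact ⟨Whitten.card_whittenGroup, by omega, by omega⟩
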